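/- arXiv:1611.08263 — 8 statements merged into one kernel-verified Lean document; each statement's English description precedes it below -/
import Mathlib

section
/- Let A be a C*-algebra, let J be a closed two-sided ideal of A, and let ā ∈ A/J be a self-adjoint element lying in the norm closure of the linear span of commutators [x, y] = xy − yx of A/J. Then there exists a self-adjoint element a in the norm closure of the linear span of commutators of A such that the image of a in A/J is ā and ‖a‖ = ‖ā‖. -/
noncomputable section

/-- The norm closure of the linear span of the commutators of `B`. -/
def closedCommutatorSpan (B : Type*) [CStarAlgebra B] : Set B :=
  closure (Submodule.span ℂ {x : B | ∃ y z : B, x = y * z - z * y} : Set B)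

section NormPreservingLift

open Filter Topology

section ApproximateUnit

variable {A B : Type*} [CStarAlgebra A] [CStarAlgebra B] (π : A →⋆ₐ[ℂ] B)

lemma continuous_starAlgHom : Continuous π :=
  AddMonoidHomClass.continuous_of_bound π 1 fun a => by
    simpa using NonUnitalStarAlgHom.norm_apply_le π a

/-- The kernel of `π` as a non-unital star subalgebra. -/
def kerStarSubalgebra : NonUnitalStarSubalgebra ℂ A where
  carrier := {a | π a = 0}
  add_mem' {a b} ha hb := by simp_all
  zero_mem' := by simp
  mul_mem' {a b} ha hb := by simp_all
  smul_mem' c a ha := by simp_all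
  star_mem' {a} ha := by simp_all [map_star]

lemma isClosed_kerStarSubalgebra : IsClosed (kerStarSubalgebra π : Set A) :=
  isClosed_eq (continuous_starAlgHom π) continuous_const

lemma exists_approximateUnit_mem_ker (F : Finset A) (hF : ∀ j ∈ F, π j = 0) {ε : ℝ} (hε : 0 < ε) :
    ∃ e : A, IsSelfAdjoint e ∧ ‖e‖ ≤ 1 ∧ π e = 0 ∧
      ∀ j ∈ F, ‖j - e * j‖ ≤ ε ∧ ‖j - j * e‖ ≤ ε := by
  have := isClosed_kerStarSubalgebra π
  let _ : PartialOrder (kerStarSubalgebra π) := CStarAlgebra.spectralOrder _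
  have : StarOrderedRing (kerStarSubalgebra π) := CStarAlgebra.spectralOrderedRing _
  have hl := CStarAlgebra.increasingApproximateUnit (kerStarSubalgebra π)
  have h1 : ∀ᶠ e : kerStarSubalgebra π in CStarAlgebra.approximateUnit (kerStarSubalgebra π),
      ∀ j ∈ F, ‖j - (e : A) * j‖ ≤ ε ∧ ‖j - j * (e : A)‖ ≤ ε := by
    rw [Filter.eventually_all_finset]
    intro j hj
    let j' : kerStarSubalgebra π := ⟨j, hF j hj⟩
    have h2 := hl.tendsto_mul_right j'
    have h3 := hl.tendsto_mul_left j'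
    rw [Metric.tendsto_nhds] at h2 h3
    filter_upwards [h2 ε hε, h3 ε hε] with e he he'
    rw [dist_comm, dist_eq_norm] at he he'
    exact ⟨he.le, he'.le⟩
  obtain ⟨e, he, hsa, hn⟩ := (h1.and (hl.eventually_isSelfAdjoint.and hl.eventually_norm)).exists
  exact ⟨e, congrArg Subtype.val hsa.star_eq, hn, e.2, he⟩

lemma norm_sum_range_sq_le {d : ℕ → A} {C η : ℝ} (hC : ∀ n, ‖d n‖ ≤ C)
    (hη : ∀ m n, m < n → ‖star (d m) * d n‖ ≤ η) (N : ℕ) :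
    ‖∑ k ∈ Finset.range N, d k‖ ^ 2 ≤ N * C ^ 2 + N ^ 2 * η := by
  have hη0 : 0 ≤ η := (norm_nonneg _).trans (hη 0 1 one_pos)
  induction N with
  | zero => simp
  | succ n ih =>
    rw [Finset.sum_range_succ]
    set S := ∑ k ∈ Finset.range n, d k
    have h1 : ‖star S * d n‖ ≤ n * η := by
      simp only [S, star_sum, Finset.sum_mul]
      refine (norm_sum_le_of_le _ fun k hk => hη k n (Finset.mem_range.1 hk)).trans ?_
      simp
    have h2 : ‖star (d n) * S‖ ≤ n * η := by
      rw [← norm_star]; simpa using h1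
    have h3 : star (S + d n) * (S + d n)
        = star S * S + star S * d n + star (d n) * S + star (d n) * d n := by
      rw [star_add]; noncomm_ring
    have h4 : ‖star (d n) * d n‖ ≤ C ^ 2 := by
      rw [CStarRing.norm_star_mul_self, ← sq]
      exact pow_le_pow_left₀ (norm_nonneg _) (hC n) 2
    have h5 : ‖S + d n‖ ^ 2 ≤ ‖S‖ ^ 2 + n * η + n * η + C ^ 2 := by
      rw [sq, sq, ← CStarRing.norm_star_mul_self, ← CStarRing.norm_star_mul_self, h3]
      refine norm_add_le_of_le (norm_add_le_of_le (norm_add_le_of_le le_rfl h1) h2) h4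
    push_cast
    nlinarith

lemma norm_star_commutator_mul_commutator_le {e e' f y : A} {M δ : ℝ} (he : IsSelfAdjoint e)
    (hn : ‖e‖ ≤ 1) (hn' : ‖e'‖ ≤ 1) (hM : ‖y‖ ≤ M)
    (h1 : ‖e - e * f‖ ≤ δ) (h2 : ‖e * star y - e * star y * f‖ ≤ δ)
    (h3 : ‖f - f * e'‖ ≤ δ) (h4 : ‖f * y - f * y * e'‖ ≤ δ) :
    ‖star (e * y - y * e) * (e' * y - y * e')‖ ≤ 4 * M * (M + 1) * δ := by
  have hM0 : 0 ≤ M := (norm_nonneg _).trans hM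
  have hδ0 : 0 ≤ δ := (norm_nonneg _).trans h1
  have comm_le : ∀ x : A, ‖x‖ ≤ 1 → ‖x * y - y * x‖ ≤ 2 * M := fun x hx => by
    refine (norm_sub_le _ _).trans ?_
    have := norm_mul_le x y
    have := norm_mul_le y x
    nlinarith [norm_nonneg x, norm_nonneg y]
  have hL : ‖star (e * y - y * e) * (1 - f)‖ ≤ (M + 1) * δ := by
    have : star (e * y - y * e) * (1 - f)
        = star y * (e - e * f) - (e * star y - e * star y * f) := by
      simp only [star_sub, star_mul, he.star_eq]; noncomm_ring
    rw [this]
    refine (norm_sub_le _ _).trans ?_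
    have := norm_mul_le (star y) (e - e * f)
    rw [norm_star] at this
    nlinarith [norm_nonneg y, norm_nonneg (e - e * f)]
  have hR : ‖f * (e' * y - y * e')‖ ≤ (M + 1) * δ := by
    have : f * (e' * y - y * e') = (f * y - f * y * e') - (f - f * e') * y := by noncomm_ring
    rw [this]
    refine (norm_sub_le _ _).trans ?_
    have := norm_mul_le (f - f * e') y
    nlinarith [norm_nonneg y, norm_nonneg (f - f * e')]
  have : star (e * y - y * e) * (e' * y - y * e')
      = star (e * y - y * e) * (1 - f) * (e' * y - y * e')
        + star (e * y - y * e) * (f * (e' * y - y * e')) := by noncomm_ring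
  rw [this]
  refine (norm_add_le_of_le (norm_mul_le_of_le hL (comm_le e' hn'))
    (norm_mul_le_of_le ((norm_star _).trans_le (comm_le e hn)) hR)).trans (le_of_eq (by ring))

lemma exists_quasicentral_mem_ker (F G : Finset A) (hF : ∀ j ∈ F, π j = 0) {ε : ℝ} (hε : 0 < ε) :
    ∃ e : A, IsSelfAdjoint e ∧ ‖e‖ ≤ 1 ∧ π e = 0 ∧ (∀ j ∈ F, ‖j - e * j‖ ≤ ε) ∧
      ∀ y ∈ G, ‖e * y - y * e‖ ≤ ε := by
  classical
  obtain ⟨M, hM0, hM⟩ : ∃ M : ℝ, 0 ≤ M ∧ ∀ y ∈ G, ‖y‖ ≤ M :=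
    ⟨∑ y ∈ G, ‖y‖, Finset.sum_nonneg fun _ _ => norm_nonneg _, fun y hy =>
      Finset.single_le_sum (f := fun y => ‖y‖) (fun _ _ => norm_nonneg _) hy⟩
  obtain ⟨δ, hδ0, hδε, hδ⟩ : ∃ δ : ℝ, 0 < δ ∧ δ ≤ ε ∧ 4 * M * (M + 1) * δ ≤ ε ^ 2 / 2 := by
    refine ⟨min ε (ε ^ 2 / 2 / (4 * M * (M + 1) + 1)), by positivity, min_le_left _ _, ?_⟩
    calc 4 * M * (M + 1) * min ε (ε ^ 2 / 2 / (4 * M * (M + 1) + 1))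
        ≤ (4 * M * (M + 1) + 1) * (ε ^ 2 / 2 / (4 * M * (M + 1) + 1)) := by
          gcongr
          · linarith
          · exact min_le_right _ _
      _ = ε ^ 2 / 2 := by field_simp
  obtain ⟨N, hN0, hN⟩ : ∃ N : ℕ, 0 < N ∧ (2 * M) ^ 2 ≤ N * (ε ^ 2 / 2) := by
    obtain ⟨N, hN⟩ := exists_nat_ge ((2 * M) ^ 2 / (ε ^ 2 / 2))
    refine ⟨N + 1, N.succ_pos, ?_⟩
    rw [div_le_iff₀ (by positivity)] at hN
    push_cast
    nlinarith [sq_nonneg ε]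
  obtain ⟨E, hE, hEr⟩ := exists_seq_of_forall_finset_exists
    (fun e : A => IsSelfAdjoint e ∧ ‖e‖ ≤ 1 ∧ π e = 0 ∧ ∀ j ∈ F, ‖j - e * j‖ ≤ δ)
    (fun x z => ‖x - x * z‖ ≤ δ ∧ ∀ y ∈ G, ‖x * y - x * y * z‖ ≤ δ ∧
      ‖x * star y - x * star y * z‖ ≤ δ) (fun s hs => by
      obtain ⟨e, h1, h2, h3, h4⟩ := exists_approximateUnit_mem_ker π
        (F ∪ (s ∪ (s ×ˢ G).image (fun p => p.1 * p.2) ∪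
          (s ×ˢ G).image (fun p => p.1 * star p.2))) (by
          intro j hj
          simp only [Finset.mem_union, Finset.mem_image, Finset.mem_product] at hj
          rcases hj with hj | ((hj | ⟨p, hp, rfl⟩) | ⟨p, hp, rfl⟩)
          · exact hF j hj
          · exact (hs j hj).2.2.1
          · simp [(hs _ hp.1).2.2.1]
          · simp [(hs _ hp.1).2.2.1]) hδ0
      refine ⟨e, ⟨h1, h2, h3, fun j hj => (h4 j (by simp [hj])).1⟩, fun x hx =>
        ⟨(h4 x (by simp [hx])).2, fun y hy => ⟨(h4 (x * y) ?_).2, (h4 (x * star y) ?_).2⟩⟩⟩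
      · exact Finset.mem_union_right _ (Finset.mem_union_left _ (Finset.mem_union_right _
          (Finset.mem_image.2 ⟨(x, y), by simp [hx, hy], rfl⟩)))
      · exact Finset.mem_union_right _ (Finset.mem_union_right _
          (Finset.mem_image.2 ⟨(x, y), by simp [hx, hy], rfl⟩)))
  have hN' : (0 : ℝ) < N := by exact_mod_cast hN0
  have hNc : (N : ℂ) ≠ 0 := by exact_mod_cast hN0.ne'
  have norm_avg : ∀ (v : ℕ → A) {c : ℝ}, (∀ k, ‖v k‖ ≤ c) →
      ‖(N : ℂ)⁻¹ • ∑ k ∈ Finset.range N, v k‖ ≤ c := fun v c hv => by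
    rw [norm_smul, norm_inv, Complex.norm_natCast, inv_mul_le_iff₀ hN']
    refine (norm_sum_le_of_le _ fun k _ => hv k).trans (by simp)
  refine ⟨(N : ℂ)⁻¹ • ∑ k ∈ Finset.range N, E (2 * k), ?_, ?_, ?_, ?_, ?_⟩
  · refine IsSelfAdjoint.smul (by simp [isSelfAdjoint_iff]) ?_
    simp [isSelfAdjoint_iff, star_sum, (hE _).1.star_eq]
  · exact norm_avg _ fun k => (hE _).2.1
  · simp [map_sum, (hE _).2.2.1]
  · intro j hj
    have : j - ((N : ℂ)⁻¹ • ∑ k ∈ Finset.range N, E (2 * k)) * j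
        = (N : ℂ)⁻¹ • ∑ k ∈ Finset.range N, (j - E (2 * k) * j) := by
      rw [Finset.sum_sub_distrib, Finset.sum_const, Finset.card_range, smul_sub, smul_mul_assoc,
        Finset.sum_mul, ← Nat.cast_smul_eq_nsmul ℂ, smul_smul, inv_mul_cancel₀ hNc, one_smul]
    rw [this]
    exact norm_avg _ fun k => ((hE _).2.2.2 j hj).trans hδε
  · intro y hy
    have : ((N : ℂ)⁻¹ • ∑ k ∈ Finset.range N, E (2 * k)) * y
        - y * ((N : ℂ)⁻¹ • ∑ k ∈ Finset.range N, E (2 * k))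
        = (N : ℂ)⁻¹ • ∑ k ∈ Finset.range N, (E (2 * k) * y - y * E (2 * k)) := by
      rw [Finset.sum_sub_distrib, smul_sub, smul_mul_assoc, Finset.sum_mul, mul_smul_comm,
        Finset.mul_sum]
    rw [this, norm_smul, norm_inv, Complex.norm_natCast, inv_mul_le_iff₀ hN']
    have key := norm_sum_range_sq_le (d := fun k => E (2 * k) * y - y * E (2 * k))
      (C := 2 * M) (η := 4 * M * (M + 1) * δ) (fun n => by
        refine (norm_sub_le _ _).trans ?_
        have := norm_mul_le (E (2 * n)) y
        have := norm_mul_le y (E (2 * n))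
        nlinarith [norm_nonneg (E (2 * n)), norm_nonneg y, (hE (2 * n)).2.1, hM y hy])
      (fun m n hmn => by
        have h1 := hEr (2 * m) (2 * m + 1) (by omega)
        have h2 := hEr (2 * m + 1) (2 * n) (by omega)
        exact norm_star_commutator_mul_commutator_le (hE _).1 (hE _).2.1 (hE _).2.1 (hM y hy)
          h1.1 (h1.2 y hy).2 h2.1 (h2.2 y hy).1) N
    refine le_of_sq_le_sq (key.trans ?_) (by positivity)
    calc N * (2 * M) ^ 2 + N ^ 2 * (4 * M * (M + 1) * δ)
        ≤ N * (N * (ε ^ 2 / 2)) + N ^ 2 * (ε ^ 2 / 2) := by gcongr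
      _ = (N * ε) ^ 2 := by ring

/-- Elements `e i` of the unit ball of `ker π` forming a quasi-central approximate unit. -/
lemma exists_quasicentral_approximateUnit :
    ∃ e : Finset A × ℕ → A, (∀ i, IsSelfAdjoint (e i) ∧ ‖e i‖ ≤ 1 ∧ π (e i) = 0) ∧
      (∀ j, π j = 0 → Tendsto (fun i => j - e i * j) atTop (𝓝 0)) ∧
      ∀ y, Tendsto (fun i => e i * y - y * e i) atTop (𝓝 0) := by
  classical
  choose e h1 h2 h3 h4 h5 using fun i : Finset A × ℕ =>
    exists_quasicentral_mem_ker π (i.1.filter (π · = 0)) i.1 (by simp)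
      (Nat.one_div_pos_of_nat (α := ℝ) (n := i.2))
  have hlim : Tendsto (fun i : Finset A × ℕ => 1 / ((i.2 : ℝ) + 1)) atTop (𝓝 0) := by
    rw [← prod_atTop_atTop_eq]
    exact tendsto_one_div_add_atTop_nhds_zero_nat.comp tendsto_snd
  have hmem : ∀ y : A, ∀ᶠ i : Finset A × ℕ in atTop, y ∈ i.1 := fun y => by
    filter_upwards [eventually_ge_atTop (({y} : Finset A), 0)] with i hi
    exact hi.1 (by simp)
  refine ⟨e, fun i => ⟨h1 i, h2 i, h3 i⟩, fun j hj => ?_, fun y => ?_⟩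
  · refine squeeze_zero_norm' ?_ hlim
    filter_upwards [hmem j] with i hi
    exact h4 i j (by simp [hi, hj])
  · refine squeeze_zero_norm' ?_ hlim
    filter_upwards [hmem y] with i hi
    exact h5 i y hi

end ApproximateUnit

section Rotation

variable {A : Type*} [CStarAlgebra A]

/-- A Cayley-type parametrisation `r = (1 - e²) / (1 + e²)`, `t = 2e / (1 + e²)` of the circle,
which is rational in `e`, so that commutators with `r` and `t` are controlled by those with `e`. -/
lemma exists_rotation {e : A} (he : IsSelfAdjoint e) (hn : ‖e‖ ≤ 1) :
    ∃ r t : A, IsSelfAdjoint r ∧ IsSelfAdjoint t ∧ Commute r t ∧ r * r + t * t = 1 ∧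
      (∃ v, t = e * v) ∧ (∀ j, ‖r * j‖ ≤ 2 * ‖j - e * j‖) ∧
      ∀ y, ‖r * y - y * r‖ ≤ 6 * ‖e * y - y * e‖ ∧ ‖t * y - y * t‖ ≤ 6 * ‖e * y - y * e‖ := by
  have hpos : ∀ x : ℝ, 1 + x ^ 2 ≠ 0 := fun x => by positivity
  have hcont : Continuous fun x : ℝ => (1 + x ^ 2)⁻¹ := by fun_prop (disch := exact hpos)
  have hcfc : cfc (fun x : ℝ => 1 + x ^ 2) e = 1 + e * e := by
    rw [cfc_add .., cfc_const_one ℝ e, cfc_pow_id (R := ℝ) e 2, sq]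
  obtain ⟨u, hu, hu1, huw, hwu, hue⟩ : ∃ u : A, IsSelfAdjoint u ∧ ‖u‖ ≤ 1 ∧
      u * (1 + e * e) = 1 ∧ (1 + e * e) * u = 1 ∧ Commute u e := by
    refine ⟨cfc (fun x : ℝ => (1 + x ^ 2)⁻¹) e, cfc_predicate _ _, ?_, ?_, ?_, ?_⟩
    · refine norm_cfc_le zero_le_one fun x _ => ?_
      rw [norm_inv, Real.norm_of_nonneg (by positivity)]
      exact inv_le_one_of_one_le₀ (by nlinarith [sq_nonneg x])
    · rw [← hcfc, ← cfc_mul _ _ e hcont.continuousOn]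
      simp only [inv_mul_cancel₀ (hpos _)]
      exact cfc_const_one ℝ e
    · rw [← hcfc, ← cfc_mul _ _ e (by fun_prop) hcont.continuousOn]
      simp only [mul_inv_cancel₀ (hpos _)]
      exact cfc_const_one ℝ e
    · simpa only [cfc_id ℝ e] using cfc_commute_cfc (fun x : ℝ => (1 + x ^ 2)⁻¹) id e
  have comm_u : ∀ y, ‖u * y - y * u‖ ≤ 2 * ‖e * y - y * e‖ := fun y => by
    have h1 : u * y - y * u = -(u * (e * (e * y - y * e) + (e * y - y * e) * e) * u) := by
      have h2 : u * (e * (e * y - y * e) + (e * y - y * e) * e) * u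
          = (u * (1 + e * e)) * y * u - u * y * ((1 + e * e) * u) := by noncomm_ring
      rw [h2, huw, hwu]; noncomm_ring
    rw [h1, norm_neg]
    refine (norm_mul_le_of_le (norm_mul_le_of_le hu1 (norm_add_le_of_le
      (norm_mul_le_of_le hn le_rfl) (norm_mul_le_of_le le_rfl hn))) hu1).trans_eq (by ring)
  have comm_r : ∀ y, (2 * u - 1) * y - y * (2 * u - 1) = (u * y - y * u) + (u * y - y * u) :=
    fun y => by noncomm_ring
  have comm_t : ∀ y, e * (2 * u) * y - y * (e * (2 * u))
      = (e * (u * y - y * u) + (e * y - y * e) * u)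
        + (e * (u * y - y * u) + (e * y - y * e) * u) := fun y => by noncomm_ring
  have hu_sq : u * u + e * u * (e * u) = u := by
    have h1 : e * u * (e * u) = e * (u * e) * u := by noncomm_ring
    have h2 : u * u + e * (e * u) * u = (1 + e * e) * u * u := by noncomm_ring
    rw [h1, hue.eq, h2, hwu, one_mul]
  refine ⟨2 * u - 1, e * (2 * u), ?_, ?_, ?_, ?_, ⟨2 * u, rfl⟩, fun j => ?_, fun y => ⟨?_, ?_⟩⟩
  · rw [two_mul]
    exact (hu.add hu).sub (.one A)
  · rw [two_mul]
    exact (he.commute_iff (hu.add hu)).1 (hue.symm.add_right hue.symm)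
  · rw [two_mul]
    have h1 : Commute (u + u - 1) u :=
      (((Commute.refl u).add_left (Commute.refl u)).sub_left (Commute.one_left u))
    exact ((hue.add_left hue).sub_left (Commute.one_left e)).mul_right (h1.add_right h1)
  · have : (2 * u - 1) * (2 * u - 1) + e * (2 * u) * (e * (2 * u))
        = 4 * (u * u + e * u * (e * u)) - 4 * u + 1 := by noncomm_ring
    rw [this, hu_sq, sub_self, zero_add]
  · have h1 : (2 * u - 1) * j = u * ((j - e * j) + e * (j - e * j)) := by
      have h2 : u * ((j - e * j) + e * (j - e * j)) = 2 * u * j - u * (1 + e * e) * j := by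
        noncomm_ring
      rw [h2, huw]; noncomm_ring
    rw [h1]
    exact (norm_mul_le_of_le hu1 (norm_add_le_of_le le_rfl
      (norm_mul_le_of_le hn le_rfl))).trans_eq (by ring)
  · rw [comm_r]
    refine (norm_add_le_of_le (comm_u y) (comm_u y)).trans ?_
    linarith [norm_nonneg (e * y - y * e)]
  · rw [comm_t]
    have h1 := norm_add_le_of_le (norm_mul_le_of_le hn (comm_u y))
      (norm_mul_le_of_le (le_refl ‖e * y - y * e‖) hu1)
    exact (norm_add_le_of_le h1 h1).trans_eq (by ring)

lemma norm_rotation_conjugate_le {r t x y : A} {M : ℝ} (hr : IsSelfAdjoint r)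
    (ht : IsSelfAdjoint t) (hrt : Commute r t) (h : r * r + t * t = 1)
    (hx : ‖x‖ ≤ M) (hy : ‖y‖ ≤ M) : ‖r * x * r + t * y * t‖ ≤ M := by
  let _ : PartialOrder A := CStarAlgebra.spectralOrder A
  have : StarOrderedRing A := CStarAlgebra.spectralOrderedRing A
  have hM : 0 ≤ M := (norm_nonneg _).trans hx
  have bound : ∀ {c z : A}, IsSelfAdjoint c → ‖z‖ ≤ M →
      star (z * c) * (z * c) ≤ (M ^ 2 : ℝ) • (c * c) := fun {c z} hc hz => by
    have h1 : star z * z ≤ algebraMap ℝ A (M ^ 2) :=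
      CStarAlgebra.star_mul_le_algebraMap_norm_sq.trans (algebraMap_mono A (by gcongr))
    have h2 := star_left_conjugate_le_conjugate h1 c
    rw [hc.star_eq, Algebra.algebraMap_eq_smul_one, mul_smul_comm, smul_mul_assoc, mul_one] at h2
    rw [star_mul, hc.star_eq]
    simpa [mul_assoc] using h2
  set w := r * x * r + t * y * t
  set z := t * (x * r) - r * (y * t)
  have hwz : star w * w + star z * z
      = star (x * r) * (x * r) + star (y * t) * (y * t) := by
    have hw : star w = star (x * r) * r + star (y * t) * t := by
      simp only [w, star_add, star_mul, hr.star_eq, ht.star_eq, mul_assoc]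
    have hz : star z = star (x * r) * t - star (y * t) * r := by
      simp only [z, star_sub, star_mul, hr.star_eq, ht.star_eq, mul_assoc]
    have expand : ∀ X Y X' Y' : A, (X' * r + Y' * t) * (r * X + t * Y)
        + (X' * t - Y' * r) * (t * X - r * Y)
        = X' * (r * r + t * t) * X + Y' * (r * r + t * t) * Y
          + X' * (r * t - t * r) * Y - Y' * (r * t - t * r) * X := fun X Y X' Y' => by
      noncomm_ring
    have := expand (x * r) (y * t) (star (x * r)) (star (y * t))
    rw [h, hrt.eq, sub_self] at this
    rw [hw, hz]
    simpa [w, z, mul_assoc] using this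
  have hle : star w * w ≤ algebraMap ℝ A (M ^ 2) := calc
    star w * w ≤ star w * w + star z * z := le_add_of_nonneg_right (star_mul_self_nonneg z)
    _ = star (x * r) * (x * r) + star (y * t) * (y * t) := hwz
    _ ≤ (M ^ 2 : ℝ) • (r * r) + (M ^ 2 : ℝ) • (t * t) := add_le_add (bound hr hx) (bound ht hy)
    _ = algebraMap ℝ A (M ^ 2) := by rw [← smul_add, h, Algebra.algebraMap_eq_smul_one]
  rw [← CStarAlgebra.norm_le_iff_le_algebraMap _ (by positivity) (star_mul_self_nonneg w),
    CStarRing.norm_star_mul_self, ← sq] at hle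
  exact le_of_sq_le_sq hle hM

lemma norm_le_one_of_mul_self_add_mul_self_eq_one {r t : A} (hr : IsSelfAdjoint r)
    (ht : IsSelfAdjoint t) (h : r * r + t * t = 1) : ‖r‖ ≤ 1 := by
  let _ : PartialOrder A := CStarAlgebra.spectralOrder A
  have : StarOrderedRing A := CStarAlgebra.spectralOrderedRing A
  have hle : star r * r ≤ 1 := by
    rw [hr.star_eq, ← h]
    exact le_add_of_nonneg_right ht.mul_self_nonneg
  rw [← CStarAlgebra.norm_le_one_iff_of_nonneg _ (star_mul_self_nonneg r),
    CStarRing.norm_star_mul_self, ← sq] at hle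
  exact le_of_sq_le_sq (by simpa using hle) zero_le_one

end Rotation

section Lift

variable {A B : Type*} [CStarAlgebra A] [CStarAlgebra B] {π : A →⋆ₐ[ℂ] B}

lemma exists_lift_norm_le (hπ : Function.Surjective π) (b : B) : ∃ x, π x = b ∧ ‖x‖ ≤ ‖b‖ := by
  rcases eq_or_ne b 0 with rfl | hb
  · exact ⟨0, by simp⟩
  have : Nontrivial B := ⟨b, 0, hb⟩
  have hβ : 0 < ‖b‖ := norm_pos_iff.2 hb
  obtain ⟨a, rfl⟩ := hπ b
  set β := ‖π a‖
  let g : ℝ → ℝ := fun s => β / max β √s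
  have hmax : ∀ s, 0 < max β √s := fun s => lt_max_of_lt_left hβ
  have hg : Continuous g := by
    refine Continuous.div (by fun_prop) (by fun_prop) fun s => (hmax s).ne'
  have hsa : IsSelfAdjoint (cfc g (star a * a)) := cfc_predicate _ _
  refine ⟨a * cfc g (star a * a), ?_, ?_⟩
  · have h1 : cfc g (star (π a) * π a) = 1 := by
      rw [← cfc_const_one ℝ (star (π a) * π a)]
      refine cfc_congr fun s hs => ?_
      have h2 : s ≤ β ^ 2 := by
        rw [sq, ← CStarRing.norm_star_mul_self]
        exact (le_abs_self s).trans (spectrum.norm_le_norm_of_mem hs)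
      have h3 : √s ≤ β := Real.sqrt_le_iff.2 ⟨hβ.le, h2⟩
      simp [g, h3, hβ.ne']
    rw [map_mul, StarAlgHom.map_cfc π g (star a * a) hg.continuousOn (continuous_starAlgHom π)
      (.star_mul_self a) ((IsSelfAdjoint.star_mul_self a).map π),
      map_mul, map_star, h1, mul_one]
  · refine le_of_sq_le_sq ?_ hβ.le
    rw [sq, ← CStarRing.norm_star_mul_self, star_mul, hsa.star_eq]
    have : cfc g (star a * a) * star a * (a * cfc g (star a * a))
        = cfc (fun s => g s * s * g s) (star a * a) := by
      rw [cfc_mul (fun s => g s * s) g _ (by fun_prop) (by fun_prop),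
        cfc_mul g (fun s => s) _ (by fun_prop) (by fun_prop), cfc_id' ℝ (star a * a)]
      simp only [mul_assoc]
    rw [this]
    refine norm_cfc_le (by positivity) fun s hs => ?_
    have hs0 : 0 ≤ s := spectrum_star_mul_self_nonneg s hs
    have h0 : 0 ≤ g s := div_nonneg hβ.le (hmax s).le
    have h1 : g s * √s ≤ β := by
      rw [div_mul_eq_mul_div, div_le_iff₀ (hmax s)]
      gcongr
      exact le_max_right _ _
    rw [Real.norm_of_nonneg (by positivity)]
    calc g s * s * g s = (g s * √s) ^ 2 := by rw [mul_pow, Real.sq_sqrt hs0]; ring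
      _ ≤ β ^ 2 := by gcongr

lemma exists_rotation_approximateUnit (π : A →⋆ₐ[ℂ] B) :
    ∃ r t : Finset A × ℕ → A,
      (∀ i, IsSelfAdjoint (r i) ∧ IsSelfAdjoint (t i) ∧ Commute (r i) (t i) ∧
        r i * r i + t i * t i = 1 ∧ π (t i) = 0) ∧
      (∀ j, π j = 0 → Tendsto (fun i => r i * j) atTop (𝓝 0)) ∧
      (∀ y, Tendsto (fun i => r i * y - y * r i) atTop (𝓝 0)) ∧
      ∀ y, Tendsto (fun i => t i * y - y * t i) atTop (𝓝 0) := by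
  obtain ⟨e, he, hj, hy⟩ := exists_quasicentral_approximateUnit π
  choose r t h1 h2 h3 h4 h5 h6 h7 using fun i => exists_rotation (he i).1 (he i).2.1
  refine ⟨r, t, fun i => ⟨h1 i, h2 i, h3 i, h4 i, ?_⟩, fun j hj' => ?_, fun y => ?_, fun y => ?_⟩
  · obtain ⟨v, hv⟩ := h5 i
    rw [hv, map_mul, (he i).2.2, zero_mul]
  · exact squeeze_zero_norm (fun i => h6 i j) (by simpa using (hj j hj').norm.const_mul 2)
  · exact squeeze_zero_norm (fun i => (h7 i y).1) (by simpa using (hy y).norm.const_mul 6)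
  · exact squeeze_zero_norm (fun i => (h7 i y).2) (by simpa using (hy y).norm.const_mul 6)

/-- The linear span of the commutators of `A`. -/
def commutatorSpan (A : Type*) [CStarAlgebra A] : Submodule ℂ A :=
  Submodule.span ℂ {x : A | ∃ y z : A, x = y * z - z * y}

lemma exists_lift_mem_commutatorSpan (hπ : Function.Surjective π) {b : B}
    (hb : b ∈ commutatorSpan B) : ∃ a ∈ commutatorSpan A, π a = b := by
  refine Submodule.span_induction (p := fun b _ => ∃ a ∈ commutatorSpan A, π a = b)
    ?_ ?_ ?_ ?_ hb
  · rintro _ ⟨y, z, rfl⟩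
    obtain ⟨y, rfl⟩ := hπ y
    obtain ⟨z, rfl⟩ := hπ z
    exact ⟨_, Submodule.subset_span ⟨y, z, rfl⟩, by simp⟩
  · exact ⟨0, zero_mem _, map_zero π⟩
  · rintro _ _ _ _ ⟨x, hx, rfl⟩ ⟨y, hy, rfl⟩
    exact ⟨x + y, add_mem hx hy, map_add π x y⟩
  · rintro c _ _ ⟨x, hx, rfl⟩
    exact ⟨c • x, Submodule.smul_mem _ c hx, map_smul π c x⟩

/-- Asymptotically central contractions of `ker π` almost multiply the closed span of commutators
into the span of commutators intersected with `ker π`. -/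
lemma eventually_exists_mem_commutatorSpan {ι : Type*} {l : Filter ι} {q : ι → A}
    (hq1 : ∀ i, ‖q i‖ ≤ 1) (hqπ : ∀ i, π (q i) = 0)
    (hq : ∀ y, Tendsto (fun i => q i * y - y * q i) l (𝓝 0)) {a : A}
    (ha : a ∈ (commutatorSpan A).topologicalClosure) {ε : ℝ} (hε : 0 < ε) :
    ∀ᶠ i in l, ∃ z ∈ commutatorSpan A, π z = 0 ∧ ‖q i * a - z‖ < ε := by
  obtain ⟨a', ha', hd⟩ := Metric.mem_closure_iff.1 ha (ε / 2) (half_pos hε)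
  suffices h : ∀ ε > 0, ∀ᶠ i in l, ∃ z ∈ commutatorSpan A, π z = 0 ∧ ‖q i * a' - z‖ < ε by
    filter_upwards [h (ε / 2) (half_pos hε)] with i ⟨z, hz, hz0, hzε⟩
    refine ⟨z, hz, hz0, ?_⟩
    have h1 : q i * a - z = q i * (a - a') + (q i * a' - z) := by noncomm_ring
    rw [dist_eq_norm] at hd
    have h2 : ‖q i * (a - a')‖ ≤ ‖a - a'‖ :=
      (norm_mul_le_of_le (hq1 i) le_rfl).trans_eq (one_mul _)
    rw [h1]
    linarith [norm_add_le (q i * (a - a')) (q i * a' - z)]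
  refine Submodule.span_induction (p := fun a _ => ∀ ε > 0, ∀ᶠ i in l,
    ∃ z ∈ commutatorSpan A, π z = 0 ∧ ‖q i * a - z‖ < ε) ?_ ?_ ?_ ?_ ha'
  · rintro _ ⟨x, y, rfl⟩ ε hε
    have hlim : Tendsto (fun i => ‖(q i * y - y * q i) * x‖) l (𝓝 0) := by
      simpa using ((hq y).mul_const x).norm
    filter_upwards [hlim.eventually_lt_const hε] with i hi
    refine ⟨q i * x * y - y * (q i * x), Submodule.subset_span ⟨_, _, rfl⟩, by simp [hqπ], ?_⟩
    have : q i * (x * y - y * x) - (q i * x * y - y * (q i * x))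
        = -((q i * y - y * q i) * x) := by noncomm_ring
    rwa [this, norm_neg]
  · exact fun ε hε => .of_forall fun i => ⟨0, zero_mem _, map_zero π, by simpa using hε⟩
  · intro x y _ _ hx hy ε hε
    filter_upwards [hx (ε / 2) (half_pos hε), hy (ε / 2) (half_pos hε)]
      with i ⟨z, hz, hz0, hzε⟩ ⟨w, hw, hw0, hwε⟩
    refine ⟨z + w, add_mem hz hw, by simp [hz0, hw0], ?_⟩
    rw [mul_add, add_sub_add_comm]
    linarith [norm_add_le (q i * x - z) (q i * y - w)]
  · intro c x _ hx ε hε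
    filter_upwards [hx (ε / (‖c‖ + 1)) (by positivity)] with i ⟨z, hz, hz0, hzε⟩
    refine ⟨c • z, Submodule.smul_mem _ c hz, by simp [hz0], ?_⟩
    rw [mul_smul_comm, ← smul_sub, norm_smul]
    rw [lt_div_iff₀ (by positivity)] at hzε
    nlinarith [norm_nonneg (q i * x - z), norm_nonneg c]

lemma exists_lift_norm_le_add (hπ : Function.Surjective π) {a : A}
    (ha : a ∈ (commutatorSpan A).topologicalClosure) {δ : ℝ} (hδ : 0 < δ) :
    ∃ a' ∈ (commutatorSpan A).topologicalClosure, π a' = π a ∧ ‖a'‖ ≤ ‖π a‖ + δ ∧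
      ‖a' - a‖ ≤ ‖a‖ - ‖π a‖ + δ := by
  classical
  obtain ⟨x, hxa, hx⟩ := exists_lift_norm_le hπ (π a)
  have hπa : ‖π a‖ ≤ ‖a‖ := NonUnitalStarAlgHom.norm_apply_le π a
  obtain ⟨s, hs0, hs1, hsa⟩ : ∃ s : ℝ, 0 ≤ s ∧ s ≤ 1 ∧ s * ‖a‖ = ‖π a‖ := by
    rcases eq_or_ne a 0 with rfl | h
    · exact ⟨0, le_rfl, zero_le_one, by simp⟩
    · have : 0 < ‖a‖ := norm_pos_iff.2 h
      exact ⟨‖π a‖ / ‖a‖, by positivity, div_le_one_of_le₀ hπa this.le, by field_simp⟩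
  obtain ⟨r, t, hrt, hrj, hrc, htc⟩ := exists_rotation_approximateUnit π
  have hr1 : ∀ i, ‖r i‖ ≤ 1 := fun i =>
    norm_le_one_of_mul_self_add_mul_self_eq_one (hrt i).1 (hrt i).2.1 (hrt i).2.2.2.1
  have ht1 : ∀ i, ‖t i‖ ≤ 1 := fun i =>
    norm_le_one_of_mul_self_add_mul_self_eq_one (hrt i).2.1 (hrt i).1
      ((add_comm _ _).trans (hrt i).2.2.2.1)
  have htt1 : ∀ i, ‖t i * t i‖ ≤ 1 := fun i =>
    (norm_mul_le_of_le (ht1 i) (ht1 i)).trans_eq (one_mul 1)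
  have httc : ∀ y, Tendsto (fun i => t i * t i * y - y * (t i * t i)) atTop (𝓝 0) := fun y => by
    refine squeeze_zero_norm (fun i => ?_) (by simpa using (htc y).norm.const_mul 2)
    have : t i * t i * y - y * (t i * t i)
        = t i * (t i * y - y * t i) + (t i * y - y * t i) * t i := by noncomm_ring
    rw [this]
    exact (norm_add_le_of_le (norm_mul_le_of_le (ht1 i) le_rfl)
      (norm_mul_le_of_le le_rfl (ht1 i))).trans_eq (by ring)
  have hδ4 : 0 < δ / 4 := by positivity
  have small : ∀ {v : Finset A × ℕ → A}, Tendsto v atTop (𝓝 0) →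
      ∀ᶠ i in atTop, ‖v i‖ < δ / 4 := fun {v} hv =>
    Tendsto.eventually_lt_const hδ4 (by simpa using hv.norm)
  have near := eventually_exists_mem_commutatorSpan (π := π) htt1
    (fun i => by rw [map_mul, (hrt i).2.2.2.2, zero_mul]) httc ha hδ4
  obtain ⟨i, ⟨z, hz, hz0, hzδ⟩, hi1, hi2, hi3⟩ :=
    (near.and ((small (hrj (a - x) (by simp [hxa]))).and
        ((small (hrc a)).and (small (htc a))))).exists
  obtain ⟨hr, ht, hcomm, hsq, -⟩ := hrt i
  have hs' : ‖(1 - s : ℂ)‖ = 1 - s := by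
    rw [← Complex.ofReal_one, ← Complex.ofReal_sub, Complex.norm_real,
      Real.norm_of_nonneg (by linarith)]
  have hs'' : ‖(s : ℂ)‖ = s := by rw [Complex.norm_real, Real.norm_of_nonneg hs0]
  refine ⟨a - (1 - s : ℂ) • z, sub_mem ha (Submodule.smul_mem _ _
    (Submodule.le_topologicalClosure _ hz)), by simp [hz0], ?_, ?_⟩
  · have key : a - (1 - s : ℂ) • z = (r i * x * r i + t i * ((s : ℂ) • a) * t i)
        + r i * (a - x) * r i + r i * (r i * a - a * r i)
        + (s : ℂ) • (t i * (t i * a - a * t i)) + (1 - s : ℂ) • (t i * t i * a - z) := by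
      have h1 : a = r i * r i * a + t i * t i * a := by rw [← add_mul, hsq, one_mul]
      nth_rw 1 [h1]
      simp only [mul_sub, sub_mul, mul_smul_comm, smul_mul_assoc, smul_sub, sub_smul, one_smul,
        mul_assoc]
      abel
    have b0 : ‖r i * x * r i + t i * ((s : ℂ) • a) * t i‖ ≤ ‖π a‖ :=
      norm_rotation_conjugate_le hr ht hcomm hsq hx (by rw [norm_smul, hs'', hsa])
    have b1 : ‖r i * (a - x) * r i‖ ≤ δ / 4 :=
      (norm_mul_le_of_le hi1.le (hr1 i)).trans_eq (mul_one _)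
    have b2 : ‖r i * (r i * a - a * r i)‖ ≤ δ / 4 :=
      (norm_mul_le_of_le (hr1 i) hi2.le).trans_eq (one_mul _)
    have b3 : ‖(s : ℂ) • (t i * (t i * a - a * t i))‖ ≤ s * (δ / 4) := by
      rw [norm_smul, hs'']
      exact mul_le_mul_of_nonneg_left
        ((norm_mul_le_of_le (ht1 i) hi3.le).trans_eq (one_mul _)) hs0
    have b4 : ‖(1 - s : ℂ) • (t i * t i * a - z)‖ ≤ (1 - s) * (δ / 4) := by
      rw [norm_smul, hs']
      exact mul_le_mul_of_nonneg_left hzδ.le (by linarith)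
    rw [key]
    refine (norm_add_le_of_le (norm_add_le_of_le (norm_add_le_of_le (norm_add_le_of_le b0 b1)
      b2) b3) b4).trans ?_
    linarith
  · rw [sub_sub_cancel_left, norm_neg, norm_smul, hs']
    have h1 : ‖z‖ ≤ ‖a‖ + δ := by
      have h2 : z = t i * t i * a - (t i * t i * a - z) := by abel
      have h3 : ‖t i * t i * a‖ ≤ ‖a‖ := (norm_mul_le_of_le (htt1 i) le_rfl).trans_eq (one_mul _)
      rw [h2]
      linarith [norm_sub_le (t i * t i * a) (t i * t i * a - z)]
    nlinarith

lemma exists_lift_mem_topologicalClosure (hπ : Function.Surjective π) {b : B}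
    (hb : b ∈ (commutatorSpan B).topologicalClosure) :
    ∃ a ∈ (commutatorSpan A).topologicalClosure, π a = b := by
  let Y := (commutatorSpan A).topologicalClosure
  have : CompleteSpace Y :=
    (Submodule.isClosed_topologicalClosure (commutatorSpan A)).completeSpace_coe
  let f : NormedAddGroupHom Y B :=
    { toFun := fun y => π y
      map_add' := fun x y => by simp
      bound' := ⟨1, fun y => by simpa using NonUnitalStarAlgHom.norm_apply_le π (y : A)⟩ }
  have hf : f.SurjectiveOnWith (commutatorSpan B).toAddSubgroup 2 := by
    intro h hh
    rcases eq_or_ne h 0 with rfl | h0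
    · exact ⟨0, map_zero f, by simp⟩
    obtain ⟨a, ha, rfl⟩ := exists_lift_mem_commutatorSpan hπ hh
    obtain ⟨a', ha', haa', hn, -⟩ := exists_lift_norm_le_add hπ
      (Submodule.le_topologicalClosure _ ha) (norm_pos_iff.2 h0)
    exact ⟨⟨a', ha'⟩, haa', hn.trans_eq (two_mul _).symm⟩
  obtain ⟨a, ha, -⟩ := controlled_closure_of_complete two_pos one_pos hf b hb
  exact ⟨a, a.2, ha⟩

/-- Every element of the closed span of commutators of `B` has a norm-preserving lift in the
closed span of commutators of `A`. -/
lemma exists_lift_norm_eq (hπ : Function.Surjective π) {b : B}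
    (hb : b ∈ (commutatorSpan B).topologicalClosure) :
    ∃ a ∈ (commutatorSpan A).topologicalClosure, π a = b ∧ ‖a‖ ≤ ‖b‖ := by
  obtain ⟨a₀, ha₀, rfl⟩ := exists_lift_mem_topologicalClosure hπ hb
  set b := π a₀
  have step : ∀ (n : ℕ) (a : {a : A // a ∈ (commutatorSpan A).topologicalClosure ∧ π a = b}),
      ∃ a' : {a : A // a ∈ (commutatorSpan A).topologicalClosure ∧ π a = b},
        ‖(a' : A)‖ ≤ ‖b‖ + (1 / 2) ^ n ∧ ‖(a' : A) - a‖ ≤ ‖(a : A)‖ - ‖b‖ + (1 / 2) ^ n := by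
    rintro n ⟨a, ha, hab⟩
    obtain ⟨a', ha', haa', h1, h2⟩ :=
      exists_lift_norm_le_add hπ ha (δ := (1 / 2) ^ n) (by positivity)
    exact ⟨⟨a', ha', haa'.trans hab⟩, by rwa [hab] at h1, by rwa [hab] at h2⟩
  choose next hnext hdist using step
  let u : ℕ → {a : A // a ∈ (commutatorSpan A).topologicalClosure ∧ π a = b} :=
    fun n => Nat.rec ⟨a₀, ha₀, rfl⟩ next n
  have hu : ∀ n, ‖(u (n + 1) : A)‖ ≤ ‖b‖ + (1 / 2) ^ n := fun n => hnext n (u n)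
  have hcauchy : CauchySeq fun n => (u (n + 1) : A) := by
    refine cauchySeq_of_le_geometric (1 / 2) 2 (by norm_num) fun n => ?_
    have h1 : ‖(u (n + 2) : A) - u (n + 1)‖ ≤ ‖(u (n + 1) : A)‖ - ‖b‖ + (1 / 2) ^ (n + 1) :=
      hdist (n + 1) (u (n + 1))
    have h2 : (1 / 2 : ℝ) ^ (n + 1) ≤ (1 / 2) ^ n :=
      pow_le_pow_of_le_one (by norm_num) (by norm_num) n.le_succ
    rw [dist_comm, dist_eq_norm]
    change ‖(u (n + 2) : A) - u (n + 1)‖ ≤ _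
    linarith [hu n]
  obtain ⟨a, ha⟩ := cauchySeq_tendsto_of_complete hcauchy
  refine ⟨a, ?_, ?_, ?_⟩
  · exact (Submodule.isClosed_topologicalClosure (commutatorSpan A)).mem_of_tendsto ha
      (.of_forall fun n => (u (n + 1)).2.1)
  · refine tendsto_nhds_unique (((continuous_starAlgHom π).tendsto a).comp ha) ?_
    exact tendsto_const_nhds.congr fun n => ((u (n + 1)).2.2).symm
  · refine le_of_tendsto_of_tendsto' ha.norm ?_ hu
    simpa using (tendsto_pow_atTop_nhds_zero_of_lt_one (r := (1 / 2 : ℝ)) (by norm_num)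
      (by norm_num)).const_add ‖b‖

lemma star_mem_commutatorSpan {a : A} (ha : a ∈ commutatorSpan A) :
    star a ∈ commutatorSpan A := by
  refine Submodule.span_induction ?_ ?_ ?_ ?_ ha
  · rintro _ ⟨y, z, rfl⟩
    exact Submodule.subset_span ⟨star z, star y, by simp⟩
  · simp
  · intro x y _ _ hx hy
    simpa using add_mem hx hy
  · intro c x _ hx
    simpa using Submodule.smul_mem _ (star c) hx

lemma star_mem_topologicalClosure_commutatorSpan {a : A}
    (ha : a ∈ (commutatorSpan A).topologicalClosure) :
    star a ∈ (commutatorSpan A).topologicalClosure :=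
  map_mem_closure continuous_star ha fun _ => star_mem_commutatorSpan

end Lift

end NormPreservingLift

/-- **Theorem 1.6.**  Let `J` be a closed two-sided ideal of a C*-algebra `A` and let
`ā ∈ A/J` be a self-adjoint element of the closed span of commutators of `A/J`.  Then `ā`
admits a self-adjoint lift `a` in the closed span of commutators of `A` with `‖a‖ = ‖ā‖`.
The quotient `A/J` is represented by a surjective star-algebra homomorphism `π : A → B`
(whose kernel is then the closed two-sided ideal `J`, and `B ≅ A/J` isometrically). -/
theorem selfAdjoint_commutator_lift (A B : Type*) [CStarAlgebra A] [CStarAlgebra B]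
    (π : A →⋆ₐ[ℂ] B) (hπ : Function.Surjective π)
    (abar : B) (h_sa : IsSelfAdjoint abar) (h_comm : abar ∈ closedCommutatorSpan B) :
    ∃ a : A, IsSelfAdjoint a ∧ a ∈ closedCommutatorSpan A ∧ π a = abar ∧ ‖a‖ = ‖abar‖ := by
  obtain ⟨a, ha, hab, hn⟩ :=
    exists_lift_norm_eq hπ (b := abar) (show abar ∈ closedCommutatorSpan B from h_comm)
  have hstar := star_mem_topologicalClosure_commutatorSpan ha
  have hπa : π ((2⁻¹ : ℂ) • (a + star a)) = abar := by
    rw [map_smul, map_add, map_star, hab, h_sa.star_eq, ← two_smul ℂ, smul_smul,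
      inv_mul_cancel₀ two_ne_zero, one_smul]
  refine ⟨(2⁻¹ : ℂ) • (a + star a),
    IsSelfAdjoint.smul (r := (2⁻¹ : ℂ)) (by simp [isSelfAdjoint_iff]) (.add_star_self a),
    Submodule.smul_mem (commutatorSpan A).topologicalClosure _ (add_mem ha hstar), hπa,
    le_antisymm ?_ ?_⟩
  · have := norm_add_le a (star a)
    rw [norm_star] at this
    rw [norm_smul, norm_inv, Complex.norm_two]
    linarith
  · conv_lhs => rw [← hπa]
    exact NonUnitalStarAlgHom.norm_apply_le π _

end
end

section
/- Let X be a normal topological space and Y a closed subspace of X. Let f : X → ℝ be upper semicontinuous, g : Y → ℝ be continuous, and h : X → ℝ be lower semicontinuous, satisfying f(x) ≤ h(x) for all x ∈ X and f(x) ≤ g(x) ≤ h(x) for all x ∈ Y. Then there exists a continuous function g̃ : X → ℝ such that g̃ restricted to Y equals g and f(x) ≤ g̃(x) ≤ h(x) for all x ∈ X. -/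
open Set Filter Topology

/-- Raising an upper semicontinuous function on a closed set to a continuous function on that set
keeps it upper semicontinuous. -/
lemma UpperSemicontinuous.extend_of_isClosed {X : Type*} [TopologicalSpace X] {Y : Set X}
    (hY : IsClosed Y) {f F : X → ℝ} {g : Y → ℝ} (hf : UpperSemicontinuous f) (hg : Continuous g)
    (hfg : ∀ y : Y, f y ≤ g y) (hFY : ∀ y : Y, F y = g y) (hF : ∀ x ∉ Y, F x = f x) :
    UpperSemicontinuous F := by
  intro x c hc
  by_cases hx : x ∈ Y
  · have hgx : g ⟨x, hx⟩ < c := by rwa [← hFY ⟨x, hx⟩]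
    have hgc : ∀ᶠ y in 𝓝 x, ∀ hy : y ∈ Y, g ⟨y, hy⟩ < c := by
      have h := hg.continuousAt.eventually_lt_const hgx
      rw [nhds_subtype, eventually_comap] at h
      filter_upwards [h] with y hy hyY using hy ⟨y, hyY⟩ rfl
    filter_upwards [hgc, hf x c ((hfg ⟨x, hx⟩).trans_lt hgx)] with y hy hfy
    by_cases hyY : y ∈ Y
    · exact (hFY ⟨y, hyY⟩).trans_lt (hy hyY)
    · rwa [hF y hyY]
  · rw [hF x hx] at hc
    filter_upwards [hf x c hc, hY.isOpen_compl.mem_nhds hx] with y hfy hy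
    rwa [hF y hy]

/-- A Tietze-type step: a continuous function of size `c / 3` brings the upper bound of `f` and the
lower bound of `h` closer to zero by the factor `2 / 3`. -/
lemma exists_continuous_third_correction {X : Type*} [TopologicalSpace X] [NormalSpace X]
    {f h : X → ℝ} {c : ℝ} (hc : 0 < c) (hf : UpperSemicontinuous f) (hh : LowerSemicontinuous h)
    (hfh : ∀ x, f x ≤ h x) (hfc : ∀ x, f x ≤ c) (hhc : ∀ x, -c ≤ h x) :
    ∃ u : C(X, ℝ), ∀ x, |u x| ≤ c / 3 ∧ f x - u x ≤ 2 / 3 * c ∧ -(2 / 3 * c) ≤ h x - u x := by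
  have hdisj : Disjoint (h ⁻¹' Iic (-(c / 3))) (f ⁻¹' Ici (c / 3)) := by
    refine Set.disjoint_left.2 fun x hx hx' => ?_
    simp only [mem_preimage, mem_Iic, mem_Ici] at hx hx'
    linarith [hfh x]
  obtain ⟨u, hu0, hu1, hu⟩ := exists_continuous_zero_one_of_isClosed
    (hh.isClosed_preimage _) (hf.isClosed_preimage _) hdisj
  refine ⟨⟨fun x => c / 3 * (2 * u x - 1), by fun_prop⟩, fun x => ?_⟩
  obtain ⟨h0, h1⟩ := hu x
  have hlow : 0 ≤ c * u x := by positivity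
  have hupp : c * u x ≤ c := by nlinarith
  simp only [ContinuousMap.coe_mk]
  refine ⟨abs_le.2 ⟨by linarith, by linarith⟩, ?_, ?_⟩
  · by_cases hx : c / 3 ≤ f x
    · have : u x = 1 := hu1 hx
      rw [this]
      linarith [hfc x]
    · linarith
  · by_cases hx : h x ≤ -(c / 3)
    · have : u x = 0 := hu0 hx
      rw [this]
      linarith [hhc x]
    · linarith

/-- The Katětov–Tong insertion theorem for `f ≤ 1` and `-1 ≤ h`. -/
lemma exists_continuous_between_of_le_one {X : Type*} [TopologicalSpace X] [NormalSpace X]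
    {f h : X → ℝ} (hf : UpperSemicontinuous f) (hh : LowerSemicontinuous h)
    (hfh : ∀ x, f x ≤ h x) (hf1 : ∀ x, f x ≤ 1) (hh1 : ∀ x, -1 ≤ h x) :
    ∃ g : X → ℝ, Continuous g ∧ ∀ x, f x ≤ g x ∧ g x ≤ h x := by
  let P : ℕ → C(X, ℝ) → Prop := fun n S =>
    ∀ x, f x - S x ≤ (2 / 3) ^ n ∧ -(2 / 3) ^ n ≤ h x - S x
  have step : ∀ n (S : {S // P n S}), ∃ S' : {S' // P (n + 1) S'},
      ∀ x, dist (S.1 x) (S'.1 x) ≤ 1 / 3 * (2 / 3) ^ n := by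
    rintro n ⟨S, hS⟩
    have hfS : UpperSemicontinuous fun x => f x - S x := by
      simp only [sub_eq_add_neg]
      exact hf.add S.continuous.neg.upperSemicontinuous
    have hhS : LowerSemicontinuous fun x => h x - S x := by
      simp only [sub_eq_add_neg]
      exact hh.add S.continuous.neg.lowerSemicontinuous
    obtain ⟨u, hu⟩ := exists_continuous_third_correction (c := (2 / 3) ^ n) (by positivity)
      hfS hhS (fun x => sub_le_sub_right (hfh x) _) (fun x => (hS x).1) (fun x => (hS x).2)
    refine ⟨⟨S + u, fun x => ?_⟩, fun x => ?_⟩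
    · rw [pow_succ', ContinuousMap.add_apply, ← sub_sub, ← sub_sub]
      exact (hu x).2
    · rw [Real.dist_eq, ContinuousMap.add_apply, sub_add_cancel_left, abs_neg]
      linarith [(hu x).1]
  choose next hnext using step
  let S : ∀ n, {S // P n S} := fun n =>
    Nat.rec ⟨0, fun x => by simpa using And.intro (hf1 x) (hh1 x)⟩ next n
  have hS : ∀ x n, dist ((S n).1 x) ((S (n + 1)).1 x) ≤ 1 / 3 * (2 / 3) ^ n :=
    fun x n => hnext n (S n) x
  choose g hg using fun x => cauchySeq_tendsto_of_complete
    (cauchySeq_of_le_geometric (2 / 3) (1 / 3) (by norm_num) (hS x))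
  have hpow : Tendsto (fun n : ℕ => (2 / 3 : ℝ) ^ n) atTop (𝓝 0) :=
    tendsto_pow_atTop_nhds_zero_of_lt_one (by norm_num) (by norm_num)
  have hunif : TendstoUniformly (fun n x => (S n).1 x) g atTop := by
    refine Metric.tendstoUniformly_iff.2 fun ε hε => ?_
    filter_upwards [hpow.eventually_lt_const hε] with n hn x
    have := dist_le_of_le_geometric_of_tendsto (2 / 3) (1 / 3) (by norm_num) (hS x) (hg x) n
    rw [dist_comm]
    refine this.trans_lt ?_
    convert hn using 1
    ring
  refine ⟨g, hunif.continuous (Frequently.of_forall fun n => (S n).1.continuous),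
    fun x => ⟨?_, ?_⟩⟩
  · simpa using le_of_tendsto_of_tendsto' (tendsto_const_nhds.sub (hg x)) hpow
      fun n => ((S n).2 x).1
  · simpa using le_of_tendsto_of_tendsto' hpow.neg (tendsto_const_nhds.sub (hg x))
      fun n => ((S n).2 x).2

/-- The Katětov–Tong insertion theorem. -/
lemma exists_continuous_between {X : Type*} [TopologicalSpace X] [NormalSpace X]
    {f h : X → ℝ} (hf : UpperSemicontinuous f) (hh : LowerSemicontinuous h)
    (hfh : ∀ x, f x ≤ h x) :
    ∃ g : X → ℝ, Continuous g ∧ ∀ x, f x ≤ g x ∧ g x ≤ h x := by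
  let φ := orderIsoIooNegOneOne ℝ
  have hφ : Continuous fun t => (φ t : ℝ) := continuous_subtype_val.comp φ.continuous
  have hφm : Monotone fun t => (φ t : ℝ) := fun a b hab => φ.monotone hab
  obtain ⟨g, hgc, hg⟩ := exists_continuous_between_of_le_one
    (hφ.comp_upperSemicontinuous hf hφm) (hφ.comp_lowerSemicontinuous hh hφm)
    (fun x => hφm (hfh x)) (fun x => (φ (f x)).2.2.le) (fun x => (φ (h x)).2.1.le)
  have hgI : ∀ x, g x ∈ Ioo (-1 : ℝ) 1 := fun x =>
    ⟨(φ (f x)).2.1.trans_le (hg x).1, (hg x).2.trans_lt (φ (h x)).2.2⟩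
  exact ⟨fun x => φ.symm ⟨g x, hgI x⟩, φ.symm.continuous.comp (hgc.subtype_mk hgI),
    fun x => ⟨φ.le_symm_apply.2 (hg x).1, φ.symm_apply_le.2 (hg x).2⟩⟩


/-- **Theorem 1.5 (Katětov–Tong insertion theorem with a prescribed restriction).**
Let `X` be a normal space and `Y ⊆ X` a closed subspace.  Let `f : X → ℝ` be upper
semicontinuous, `g : Y → ℝ` continuous, and `h : X → ℝ` lower semicontinuous with
`f ≤ h` on `X` and `f ≤ g ≤ h` on `Y`.  Then there is a continuous `g̃ : X → ℝ` with
`g̃|_Y = g` and `f ≤ g̃ ≤ h` on `X`. -/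
theorem katetov_tong_insertion_with_restriction
    (X : Type*) [TopologicalSpace X] [NormalSpace X]
    (Y : Set X) (hY : IsClosed Y)
    (f h : X → ℝ) (g : Y → ℝ)
    (hf : UpperSemicontinuous f) (hg : Continuous g) (hh : LowerSemicontinuous h)
    (hfh : ∀ x : X, f x ≤ h x)
    (hfg : ∀ y : Y, f (y : X) ≤ g y) (hgh : ∀ y : Y, g y ≤ h (y : X)) :
    ∃ gt : X → ℝ, Continuous gt ∧ (∀ y : Y, gt (y : X) = g y) ∧
      ∀ x : X, f x ≤ gt x ∧ gt x ≤ h x := by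
  classical
  let F : X → ℝ := fun x => if hx : x ∈ Y then g ⟨x, hx⟩ else f x
  let H : X → ℝ := fun x => if hx : x ∈ Y then g ⟨x, hx⟩ else h x
  have hFY : ∀ y : Y, F y = g y := fun y => dif_pos y.2
  have hHY : ∀ y : Y, H y = g y := fun y => dif_pos y.2
  have hF : ∀ x ∉ Y, F x = f x := fun x hx => dif_neg hx
  have hH : ∀ x ∉ Y, H x = h x := fun x hx => dif_neg hx
  have hFu : UpperSemicontinuous F := hf.extend_of_isClosed hY hg hfg hFY hF
  have hHl : LowerSemicontinuous H := by
    have hnH : UpperSemicontinuous fun x => -H x :=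
      UpperSemicontinuous.extend_of_isClosed (f := fun x => -h x) (g := fun y => -g y) hY
        (continuous_neg.comp_lowerSemicontinuous_antitone hh fun _ _ => neg_le_neg) hg.neg
        (fun y => neg_le_neg (hgh y)) (fun y => congrArg _ (hHY y))
        (fun x hx => congrArg _ (hH x hx))
    simpa [Function.comp_def] using
      continuous_neg.comp_upperSemicontinuous_antitone hnH fun _ _ => neg_le_neg
  have hFH : ∀ x, F x ≤ H x := by
    intro x
    by_cases hx : x ∈ Y
    · exact ((hFY ⟨x, hx⟩).trans (hHY ⟨x, hx⟩).symm).le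
    · rw [hF x hx, hH x hx]
      exact hfh x
  obtain ⟨k, hkc, hk⟩ := exists_continuous_between hFu hHl hFH
  have hkY : ∀ y : Y, k y = g y := fun y =>
    le_antisymm ((hk y).2.trans_eq (hHY y)) ((hFY y).symm.trans_le (hk y).1)
  refine ⟨k, hkc, hkY, fun x => ?_⟩
  by_cases hx : x ∈ Y
  · rw [hkY ⟨x, hx⟩]
    exact ⟨hfg ⟨x, hx⟩, hgh ⟨x, hx⟩⟩
  · rw [← hF x hx, ← hH x hx]
    exact hk x
end

section
/- Suppose that A is a unital C*-algebra containing a unique maximal proper closed two-sided ideal J. Then the centre of A is the scalar multiples of the identity, Z(A) = ℂ1, and the centre of J is zero, i.e., the only element of J commuting with every element of J is 0. -/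
noncomputable section

variable {A : Type*} [CStarAlgebra A]

/-- A closed two-sided ideal of a C*-algebra, regarded as a `ℂ`-submodule. -/
def IsClosedTwoSidedIdeal (I : Submodule ℂ A) : Prop :=
  IsClosed (I : Set A) ∧ ∀ a b : A, b ∈ I → a * b ∈ I ∧ b * a ∈ I

/-- A maximal (proper, closed, two-sided) ideal of a C*-algebra. -/
def IsMaximalClosedIdeal (M : Submodule ℂ A) : Prop :=
  IsClosedTwoSidedIdeal M ∧ M ≠ ⊤ ∧
    ∀ J : Submodule ℂ A, IsClosedTwoSidedIdeal J → J ≠ ⊤ → M ≤ J → J = M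

lemma one_notMem_topologicalClosure {I : Submodule ℂ A}
    (hI : ∀ a b : A, b ∈ I → a * b ∈ I ∧ b * a ∈ I) (h1 : (1 : A) ∉ I) :
    (1 : A) ∉ I.topologicalClosure := by
  have hsub : (I : Set A) ⊆ nonunits A := by
    rintro x hx ⟨u, rfl⟩
    exact h1 (by simpa using (hI (↑u⁻¹ : A) u hx).1)
  intro h
  exact closure_minimal hsub nonunits.isClosed h isUnit_one

lemma mul_mem_topologicalClosure {I : Submodule ℂ A}
    (hI : ∀ a b : A, b ∈ I → a * b ∈ I ∧ b * a ∈ I) (a b : A)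
    (hb : b ∈ I.topologicalClosure) :
    a * b ∈ I.topologicalClosure ∧ b * a ∈ I.topologicalClosure :=
  ⟨map_mem_closure (continuous_const_mul a) hb fun x hx => (hI a x hx).1,
    map_mem_closure (f := (· * a)) (continuous_mul_const a) hb fun x hx => (hI a x hx).2⟩

lemma eq_top_of_one_mem {I : Submodule ℂ A}
    (hI : ∀ a b : A, b ∈ I → a * b ∈ I ∧ b * a ∈ I) (h1 : (1 : A) ∈ I) : I = ⊤ :=
  (Submodule.eq_top_iff').2 fun x => by simpa using (hI x 1 h1).1

lemma exists_le_isMaximalClosedIdeal {I : Submodule ℂ A}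
    (hI : ∀ a b : A, b ∈ I → a * b ∈ I ∧ b * a ∈ I) (h1 : (1 : A) ∉ I) :
    ∃ M, I ≤ M ∧ IsMaximalClosedIdeal M := by
  obtain ⟨M, hIM, ⟨hM, hM1⟩, hmax⟩ := zorn_le_nonempty₀
    {K : Submodule ℂ A | (∀ a b : A, b ∈ K → a * b ∈ K ∧ b * a ∈ K) ∧ (1 : A) ∉ K}
    (fun c hc hchain y hy => by
      have hmem (x : A) : x ∈ sSup c ↔ ∃ K ∈ c, x ∈ K :=
        Submodule.mem_sSup_of_directed ⟨y, hy⟩ hchain.directedOn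
      refine ⟨sSup c, ⟨fun a b hb => ?_, fun h => ?_⟩, fun K hK => le_sSup hK⟩
      · obtain ⟨K, hK, hbK⟩ := (hmem b).1 hb
        have := (hc hK).1 a b hbK
        exact ⟨(hmem _).2 ⟨K, hK, this.1⟩, (hmem _).2 ⟨K, hK, this.2⟩⟩
      · obtain ⟨K, hK, h⟩ := (hmem 1).1 h
        exact (hc hK).2 h) I ⟨hI, h1⟩
  have hcl : M.topologicalClosure ≤ M :=
    hmax ⟨mul_mem_topologicalClosure hM, one_notMem_topologicalClosure hM hM1⟩
      M.le_topologicalClosure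
  refine ⟨M, hIM, ⟨isClosed_of_closure_subset hcl, hM⟩, ?_, fun K hK hKtop hMK => ?_⟩
  · rintro rfl
    exact hM1 trivial
  · exact le_antisymm (hmax ⟨hK.2, fun h => hKtop (eq_top_of_one_mem hK.2 h)⟩ hMK) hMK

lemma exists_isMaximalClosedIdeal_mem_of_mem_center {z : A} (hz : z ∈ Set.center A)
    (hu : ¬ IsUnit z) : ∃ M, z ∈ M ∧ IsMaximalClosedIdeal M := by
  have hcomm (a : A) : z * a = a * z := (Set.mem_center_iff.1 hz).comm a
  obtain ⟨M, hM, hmax⟩ := exists_le_isMaximalClosedIdeal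
    (I := LinearMap.range (LinearMap.mulLeft ℂ z))
    (by
      rintro a _ ⟨x, rfl⟩
      exact ⟨⟨a * x, by simp [← mul_assoc, hcomm]⟩, ⟨x * a, by simp [mul_assoc]⟩⟩)
    (by
      rintro ⟨x, hx⟩
      have hx : z * x = 1 := hx
      exact hu ⟨⟨z, x, hx, by rw [← hcomm, hx]⟩, rfl⟩)
  exact ⟨M, hM ⟨1, by simp⟩, hmax⟩

lemma mem_center_of_commute_ideal {J : Submodule ℂ A}
    (hJ : ∀ a b : A, b ∈ J → a * b ∈ J ∧ b * a ∈ J) {x : A} (hx : x ∈ J)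
    (hcomm : ∀ y ∈ J, x * y = y * x) : x ∈ Set.center A := by
  rw [Semigroup.mem_center_iff]
  intro a
  set d := a * x - x * a with hd
  have hdJ : d ∈ J := J.sub_mem (hJ a x hx).1 (hJ a x hx).2
  have hann (y : A) (hy : y ∈ J) : d * y = 0 := by
    rw [hd, sub_mul, mul_assoc, mul_assoc, hcomm _ (hJ a y hy).1, hcomm y hy, mul_assoc, sub_self]
  have h0 : d * (star d * d) = 0 := hann _ (hJ _ _ hdJ).1
  have h1 : star (star d * d) * (star d * d) = 0 := by
    simp [mul_assoc, h0]
  exact sub_eq_zero.1 ((CStarRing.star_mul_self_eq_zero_iff d).1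
    ((CStarRing.star_mul_self_eq_zero_iff _).1 h1))

/-- **Lemma 2.1.**  If a unital C*-algebra `A` has a unique maximal proper closed two-sided
ideal `J`, then `Z(A) = ℂ1` and `Z(J) = {0}` (the only element of `J` commuting with every
element of `J` is `0`). -/
theorem center_of_unique_maximal_ideal (A : Type*) [CStarAlgebra A]
    (J : Submodule ℂ A) (hJ : IsMaximalClosedIdeal J)
    (huniq : ∀ M : Submodule ℂ A, IsMaximalClosedIdeal M → M = J) :
    Set.center A = Set.range (algebraMap ℂ A) ∧
      ∀ x ∈ J, (∀ y ∈ J, x * y = y * x) → x = 0 := by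
  have h1 : (1 : A) ∉ J := fun h => hJ.2.1 (eq_top_of_one_mem hJ.1.2 h)
  have hscalar {c : ℂ} (hc : algebraMap ℂ A c ∈ J) : c = 0 := by
    by_contra hc0
    refine h1 ?_
    have := J.smul_mem c⁻¹ hc
    rwa [Algebra.algebraMap_eq_smul_one, smul_smul, inv_mul_cancel₀ hc0, one_smul] at this
  have : Nontrivial A := ⟨1, 0, fun h => h1 (h ▸ J.zero_mem)⟩
  have hcenter : Set.center A = Set.range (algebraMap ℂ A) := by
    refine Set.Subset.antisymm (fun z hz => ?_) ?_
    · have hspec {c : ℂ} (hc : c ∈ spectrum ℂ z) : algebraMap ℂ A c - z ∈ J := by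
        have hmem : algebraMap ℂ A c - z ∈ Set.center A :=
          (Subalgebra.center ℂ A).sub_mem ((Subalgebra.center ℂ A).algebraMap_mem c) hz
        obtain ⟨M, hzM, hM⟩ := exists_isMaximalClosedIdeal_mem_of_mem_center hmem hc
        exact huniq M hM ▸ hzM
      obtain ⟨c, hc⟩ := spectrum.nonempty z
      have hsub : spectrum ℂ z ⊆ {c} := fun d hd => by
        refine sub_eq_zero.1 (hscalar ?_)
        simpa using J.sub_mem (hspec hd) (hspec hc)
      have : IsStarNormal z := ⟨((Set.mem_center_iff.1 hz).comm (star z)).symm⟩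
      exact ⟨c, (CFC.eq_algebraMap_of_spectrum_subset_singleton (R := ℂ) z c hsub).symm⟩
    · rintro _ ⟨c, rfl⟩
      exact (Subalgebra.center ℂ A).algebraMap_mem c
  refine ⟨hcenter, fun x hx hcomm => ?_⟩
  obtain ⟨c, rfl⟩ := hcenter ▸ mem_center_of_commute_ideal hJ.1.2 hx hcomm
  rw [hscalar hx, map_zero]

end
end

section
/- Let A be a unital C*-algebra. The following are equivalent: (i) A has the uniform Dixmier property; (ii) there exist m ∈ ℕ and 0 < γ < 1 such that for every self-adjoint a ∈ A there exist z ∈ Z(A) and unitaries u_1, …, u_m of A with ‖(1/m)∑_{i=1}^m u_i a u_i* − z‖ ≤ γ‖a‖; (iii) there exist m ∈ ℕ and 0 < γ < 1 such that for every self-adjoint a ∈ A there exist z ∈ Z(A), unitaries u_1, …, u_m of A, and t_1, …, t_m ∈ [0,1] with ∑ t_i = 1 and ‖∑_{i=1}^m t_i u_i a u_i* − z‖ ≤ γ‖a‖; (iv) there exists a function Φ : A → Z(A) such that for every ε > 0 there exists n ∈ ℕ such that for all a ∈ A there are unitaries u_1, …, u_n of A with ‖(1/n)∑_{i=1}^n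 u_i a u_i* − Φ(a)‖ ≤ ε‖a‖. -/
noncomputable section

variable {A : Type*} [CStarAlgebra A]

/-- The uniform Dixmier property: for every tolerance `ε > 0` there is a number `n` of
unitaries, depending only on `ε`, such that every element can be averaged to within
`ε * ‖a‖` of the centre using `n` unitary conjugates. -/
def UniformDixmierProperty (A : Type*) [CStarAlgebra A] : Prop :=
  ∀ ε : ℝ, 0 < ε → ∃ n : ℕ, 0 < n ∧ ∀ a : A, ∃ u : Fin n → unitary A,
    Metric.infDist ((n : ℝ)⁻¹ • ∑ i, (u i : A) * a * star (u i : A)) (Set.center A) ≤ ε * ‖a‖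

/-- The mean of the unitary conjugates of an element by a finite family of unitaries. -/
def conjMean {n : ℕ} (u : Fin n → unitary A) : A →ₗ[ℂ] A where
  toFun a := (n : ℝ)⁻¹ • ∑ i, (u i : A) * a * star (u i : A)
  map_add' a b := by simp only [mul_add, add_mul, Finset.sum_add_distrib, smul_add]
  map_smul' c a := by
    simp only [mul_smul_comm, smul_mul_assoc, ← Finset.smul_sum, RingHom.id_apply]
    rw [smul_comm]

theorem conjMean_apply {n : ℕ} (u : Fin n → unitary A) (a : A) :
    conjMean u a = (n : ℝ)⁻¹ • ∑ i, (u i : A) * a * star (u i : A) := rfl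

theorem norm_unitary_conj (u : unitary A) (a : A) : ‖(u : A) * a * star (u : A)‖ = ‖a‖ := by
  rw [← Unitary.coe_star, CStarRing.norm_mul_coe_unitary, CStarRing.norm_coe_unitary_mul]

theorem unitary_conj_of_mem_center (u : unitary A) {z : A} (hz : z ∈ Set.center A) :
    (u : A) * z * star (u : A) = z := by
  rw [← hz.comm, mul_assoc, Unitary.mul_star_self_of_mem u.2, mul_one]

theorem conjMean_of_mem_center {n : ℕ} (hn : 0 < n) (u : Fin n → unitary A) {z : A}
    (hz : z ∈ Set.center A) : conjMean u z = z := by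
  have : (n : ℝ) ≠ 0 := by positivity
  simp [conjMean_apply, unitary_conj_of_mem_center _ hz, ← Nat.cast_smul_eq_nsmul ℝ, smul_smul,
    this]

theorem norm_conjMean_le {n : ℕ} (u : Fin n → unitary A) (a : A) : ‖conjMean u a‖ ≤ ‖a‖ := by
  rcases n.eq_zero_or_pos with rfl | hn
  · simp [conjMean_apply]
  · have h : ‖∑ i, (u i : A) * a * star (u i : A)‖ ≤ n * ‖a‖ :=
      (norm_sum_le _ _).trans (by simp [norm_unitary_conj])
    rw [conjMean_apply, norm_smul, norm_inv, Real.norm_natCast, inv_mul_le_iff₀ (by positivity)]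
    exact h

theorem isSelfAdjoint_conjMean {n : ℕ} (u : Fin n → unitary A) {a : A} (ha : IsSelfAdjoint a) :
    IsSelfAdjoint (conjMean u a) := by
  simp [conjMean_apply, IsSelfAdjoint, star_sum, ha.star_eq, mul_assoc]

theorem exists_conjMean_comp {m n : ℕ} (u : Fin m → unitary A) (v : Fin n → unitary A) :
    ∃ w : Fin (m * n) → unitary A, ∀ a, conjMean w a = conjMean u (conjMean v a) := by
  refine ⟨fun k ↦ u (finProdFinEquiv.symm k).1 * v (finProdFinEquiv.symm k).2, fun a ↦ ?_⟩
  simp only [conjMean_apply]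
  rw [Equiv.sum_comp finProdFinEquiv.symm
    (fun p : Fin m × Fin n ↦ ((u p.1 * v p.2 : unitary A) : A) * a *
      star ((u p.1 * v p.2 : unitary A) : A)), Fintype.sum_prod_type]
  simp only [mul_smul_comm, smul_mul_assoc, ← Finset.smul_sum, smul_smul, Nat.cast_mul, mul_inv,
    Finset.mul_sum, Finset.sum_mul, Submonoid.coe_mul, star_mul, mul_assoc]

theorem exists_conjMean_near_convex_comb {m : ℕ} (u : Fin m → unitary A) {t : Fin m → ℝ}
    (ht : ∀ i, 0 ≤ t i) (ht1 : ∑ i, t i = 1) {N : ℕ} (hN : 0 < N) :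
    ∃ v : Fin N → unitary A, ∀ a,
      ‖conjMean v a - ∑ i, t i • ((u i : A) * a * star (u i : A))‖ ≤ 2 * m / N * ‖a‖ := by
  have hN' : (0 : ℝ) < N := by positivity
  set k : Fin m → ℕ := fun i ↦ ⌊N * t i⌋₊
  have hk_le (i) : (k i : ℝ) ≤ N * t i := Nat.floor_le (by have := ht i; positivity)
  have hk_lt (i) : N * t i < k i + 1 := Nat.lt_floor_add_one _
  have hsum : ∑ i, k i ≤ N := by
    have : ((∑ i, k i : ℕ) : ℝ) ≤ N := by
      push_cast
      calc ∑ i, (k i : ℝ) ≤ ∑ i, N * t i := Finset.sum_le_sum fun i _ ↦ hk_le i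
        _ = N := by rw [← Finset.mul_sum, ht1, mul_one]
    exact_mod_cast this
  obtain ⟨r, hr⟩ := Nat.exists_eq_add_of_le hsum
  have hr_real : (r : ℝ) = ∑ i, (N * t i - k i) := by
    rw [Finset.sum_sub_distrib, ← Finset.mul_sum, ht1]
    have : (N : ℝ) = ∑ i, (k i : ℝ) + r := by exact_mod_cast hr
    linarith
  have hsum_le : ∑ i, (N * t i - k i) ≤ m := by
    calc ∑ i, (N * t i - k i) ≤ ∑ _i : Fin m, (1 : ℝ) :=
          Finset.sum_le_sum fun i _ ↦ by linarith [hk_lt i]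
      _ = m := by simp
  let e : Fin N ≃ (Σ i, Fin (k i)) ⊕ Fin r :=
    Fintype.equivOfCardEq (by simp [hr])
  let w : (Σ i, Fin (k i)) ⊕ Fin r → unitary A := Sum.elim (fun p ↦ u p.1) (fun _ ↦ 1)
  refine ⟨fun j ↦ w (e j), fun a ↦ ?_⟩
  have hv : conjMean (fun j ↦ w (e j)) a - ∑ i, t i • ((u i : A) * a * star (u i : A)) =
      (N : ℝ)⁻¹ • ((r : ℝ) • a -
        ∑ i, (N * t i - k i) • ((u i : A) * a * star (u i : A))) := by
    rw [conjMean_apply, Equiv.sum_comp e (fun p ↦ (w p : A) * a * star (w p : A)),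
      Fintype.sum_sum_type, Fintype.sum_sigma]
    simp only [w, Sum.elim_inl, Sum.elim_inr, Finset.sum_const, Finset.card_univ,
      Fintype.card_fin, OneMemClass.coe_one, one_mul, star_one, mul_one, sub_smul,
      Finset.sum_sub_distrib, mul_smul, ← Finset.smul_sum, smul_sub, smul_add,
      ← Nat.cast_smul_eq_nsmul ℝ]
    rw [inv_smul_smul₀ hN'.ne']
    abel
  have hbound : ‖(r : ℝ) • a - ∑ i, (N * t i - k i) • ((u i : A) * a * star (u i : A))‖ ≤
      2 * m * ‖a‖ := by
    have h1 : ‖(r : ℝ) • a‖ ≤ m * ‖a‖ := by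
      rw [norm_smul, Real.norm_natCast, hr_real]
      gcongr
    have h2 : ‖∑ i, (N * t i - k i) • ((u i : A) * a * star (u i : A))‖ ≤ m * ‖a‖ := by
      refine (norm_sum_le _ _).trans ?_
      calc ∑ i, ‖(N * t i - k i) • ((u i : A) * a * star (u i : A))‖
          = ∑ i, (N * t i - k i) * ‖a‖ := Finset.sum_congr rfl fun i _ ↦ by
            rw [norm_smul, norm_unitary_conj, Real.norm_of_nonneg (by linarith [hk_le i])]
        _ = (∑ i, (N * t i - k i)) * ‖a‖ := by rw [Finset.sum_mul]
        _ ≤ m * ‖a‖ := by gcongr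
    linarith [norm_sub_le ((r : ℝ) • a)
      (∑ i, (N * t i - k i) • ((u i : A) * a * star (u i : A)))]
  rw [hv, norm_smul, norm_inv, Real.norm_natCast]
  calc (N : ℝ)⁻¹ * _ ≤ (N : ℝ)⁻¹ * (2 * m * ‖a‖) := by gcongr
    _ = 2 * m / N * ‖a‖ := by ring

/-- If one mean of conjugates brings each element of `S` closer to the centre by the factor `γ`,
with remainder in `S`, then iterated means converge geometrically to a single central element. -/
theorem exists_center_forall_norm_conjMean_sub_le {S : Set A} {m : ℕ} {γ : ℝ} (hm : 0 < m)
    (hγ : 0 ≤ γ) (hγ1 : γ < 1)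
    (h : ∀ a ∈ S, ∃ z ∈ Set.center A, ∃ u : Fin m → unitary A,
      conjMean u a - z ∈ S ∧ ‖conjMean u a - z‖ ≤ γ * ‖a‖) {a : A} (ha : a ∈ S) :
    ∃ z ∈ Set.center A, ∀ k : ℕ, ∃ u : Fin (m ^ k) → unitary A,
      ‖conjMean u a - z‖ ≤ (1 + 2 / (1 - γ)) * γ ^ k * ‖a‖ := by
  choose! z hz u hS hu using h
  let b : ℕ → A := fun k ↦ (fun x ↦ conjMean (u x) x - z x)^[k] a
  have hb_succ (k) : b (k + 1) = conjMean (u (b k)) (b k) - z (b k) :=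
    Function.iterate_succ_apply' _ _ _
  have hbS (k) : b k ∈ S := by
    induction k with
    | zero => exact ha
    | succ k ih => rw [hb_succ]; exact hS _ ih
  have hb_norm (k) : ‖b k‖ ≤ γ ^ k * ‖a‖ := by
    induction k with
    | zero => simp [b]
    | succ k ih =>
      rw [hb_succ, pow_succ', mul_assoc]
      exact (hu _ (hbS k)).trans (by gcongr)
  let s : ℕ → A := fun k ↦ ∑ j ∈ Finset.range k, z (b j)
  have hs_center (k) : s k ∈ Set.center A :=
    sum_mem (S := Subalgebra.center ℂ A) fun j _ ↦ hz _ (hbS j)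
  have hs_dist (k) : dist (s k) (s (k + 1)) ≤ 2 * ‖a‖ * γ ^ k := by
    have h1 : z (b k) = conjMean (u (b k)) (b k) - b (k + 1) := by rw [hb_succ]; abel
    have h2 : ‖b (k + 1)‖ ≤ ‖b k‖ := by
      rw [hb_succ]
      exact (hu _ (hbS k)).trans (mul_le_of_le_one_left (norm_nonneg _) hγ1.le)
    have h3 : dist (s k) (s (k + 1)) = ‖z (b k)‖ := by
      rw [dist_comm, dist_eq_norm]; simp [s, Finset.sum_range_succ]
    have h4 := norm_sub_le (conjMean (u (b k)) (b k)) (b (k + 1))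
    rw [← h1] at h4
    linarith [norm_conjMean_le (u (b k)) (b k), hb_norm k]
  have hs_mean (k) : ∃ v : Fin (m ^ k) → unitary A, conjMean v a - s k = b k := by
    induction k with
    | zero => exact ⟨fun _ ↦ 1, by simp [conjMean_apply, s, b]⟩
    | succ k ih =>
      obtain ⟨v, hv⟩ := ih
      obtain ⟨w, hw⟩ := exists_conjMean_comp (u (b k)) v
      rw [pow_succ']
      refine ⟨w, ?_⟩
      rw [hw, hb_succ, eq_add_of_sub_eq hv, map_add,
        conjMean_of_mem_center hm _ (hs_center k)]
      simp only [s, Finset.sum_range_succ]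
      abel
  obtain ⟨y, hy⟩ := cauchySeq_tendsto_of_complete (cauchySeq_of_le_geometric γ _ hγ1 hs_dist)
  have hclosed : IsClosed (Set.center A) := by
    rw [← Set.centralizer_univ]; exact Set.isClosed_centralizer _
  refine ⟨y, hclosed.mem_of_tendsto hy (.of_forall hs_center), fun k ↦ ?_⟩
  obtain ⟨v, hv⟩ := hs_mean k
  refine ⟨v, ?_⟩
  have h1 := dist_le_of_le_geometric_of_tendsto γ _ hγ1 hs_dist hy k
  rw [dist_eq_norm] at h1
  calc ‖conjMean v a - y‖ = ‖b k + (s k - y)‖ := by rw [← hv]; congr 1; abel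
    _ ≤ ‖b k‖ + ‖s k - y‖ := norm_add_le _ _
    _ ≤ γ ^ k * ‖a‖ + 2 * ‖a‖ * γ ^ k / (1 - γ) := add_le_add (hb_norm k) h1
    _ = (1 + 2 / (1 - γ)) * γ ^ k * ‖a‖ := by ring

theorem exists_const_mul_pow_le {γ ε : ℝ} (hγ : 0 ≤ γ) (hγ1 : γ < 1) (hε : 0 < ε) (C : ℝ) :
    ∃ k : ℕ, C * γ ^ k ≤ ε := by
  have h := (tendsto_pow_atTop_nhds_zero_of_lt_one hγ hγ1).const_mul C
  rw [mul_zero] at h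
  exact (h.eventually (ge_mem_nhds hε)).exists

theorem realPart_mem_center {z : A} (hz : z ∈ Set.center A) :
    (realPart z : A) ∈ Set.center A := by
  rw [realPart_apply_coe]
  exact (((Subalgebra.center ℂ A).restrictScalars ℝ).smul_mem
    (Set.add_mem_center hz (Set.star_mem_center hz)) _ :)

theorem IsSelfAdjoint.norm_sub_realPart_le {a : A} (ha : IsSelfAdjoint a) (z : A) :
    ‖a - realPart z‖ ≤ ‖a - z‖ := by
  have h := realPart.norm_le (a - z)
  rwa [map_sub, AddSubgroup.coe_norm, AddSubgroup.coe_sub, ha.coe_realPart] at h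

theorem uniformDixmierProperty_of_selfAdjoint {m : ℕ} {γ : ℝ} (hm : 0 < m) (hγ : 0 ≤ γ)
    (hγ1 : γ < 1)
    (h : ∀ a : A, IsSelfAdjoint a → ∃ z ∈ Set.center A, ∃ u : Fin m → unitary A,
      ‖conjMean u a - z‖ ≤ γ * ‖a‖) : UniformDixmierProperty A := by
  have h' : ∀ a ∈ {a : A | IsSelfAdjoint a}, ∃ z ∈ Set.center A, ∃ u : Fin m → unitary A,
      conjMean u a - z ∈ {a : A | IsSelfAdjoint a} ∧ ‖conjMean u a - z‖ ≤ γ * ‖a‖ := by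
    intro a ha
    obtain ⟨z, hz, u, hu⟩ := h a ha
    exact ⟨realPart z, realPart_mem_center hz, u,
      (isSelfAdjoint_conjMean u ha).sub (realPart z).2,
      ((isSelfAdjoint_conjMean u ha).norm_sub_realPart_le z).trans hu⟩
  intro ε hε
  obtain ⟨k, hk⟩ := exists_const_mul_pow_le hγ hγ1 (half_pos hε) (1 + 2 / (1 - γ))
  have key (a : A) (ha : IsSelfAdjoint a) : ∃ z ∈ Set.center A,
      ∃ u : Fin (m ^ k) → unitary A, ‖conjMean u a - z‖ ≤ ε / 2 * ‖a‖ := by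
    obtain ⟨z, hz, hzu⟩ := exists_center_forall_norm_conjMean_sub_le hm hγ hγ1 h' ha
    obtain ⟨u, hu⟩ := hzu k
    exact ⟨z, hz, u, hu.trans (by gcongr)⟩
  have hmk : 0 < m ^ k := pow_pos hm k
  refine ⟨m ^ k * m ^ k, by positivity, fun a ↦ ?_⟩
  obtain ⟨y, hy, u, hu⟩ := key (realPart a) (realPart a).2
  obtain ⟨z, hz, v, hv⟩ := key (conjMean u (imaginaryPart a))
    (isSelfAdjoint_conjMean u (imaginaryPart a).2)
  obtain ⟨w, hw⟩ := exists_conjMean_comp v u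
  refine ⟨w, ?_⟩
  have hcenter : y + Complex.I • z ∈ Set.center A :=
    Set.add_mem_center hy ((Subalgebra.center ℂ A).smul_mem hz Complex.I)
  refine (Metric.infDist_le_dist_of_mem hcenter).trans ?_
  rw [← conjMean_apply, dist_eq_norm, hw]
  have hdecomp : conjMean v (conjMean u a) - (y + Complex.I • z) =
      conjMean v (conjMean u (realPart a) - y) +
        Complex.I • (conjMean v (conjMean u (imaginaryPart a)) - z) := by
    conv_lhs => rw [← realPart_add_I_smul_imaginaryPart a]
    simp only [map_add, map_sub, map_smul, conjMean_of_mem_center hmk v hy, smul_sub]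
    abel
  have h1 : ‖conjMean u (realPart a) - y‖ ≤ ε / 2 * ‖a‖ :=
    hu.trans (by gcongr; exact realPart.norm_le a)
  have h2 : ‖conjMean v (conjMean u (imaginaryPart a)) - z‖ ≤ ε / 2 * ‖a‖ :=
    hv.trans (by gcongr; exact (norm_conjMean_le _ _).trans (imaginaryPart.norm_le a))
  rw [hdecomp]
  calc _ ≤ ‖conjMean v (conjMean u (realPart a) - y)‖ +
        ‖Complex.I • (conjMean v (conjMean u (imaginaryPart a)) - z)‖ := norm_add_le _ _
    _ ≤ ε / 2 * ‖a‖ + ε / 2 * ‖a‖ := by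
      rw [norm_smul, Complex.norm_I, one_mul]
      exact add_le_add ((norm_conjMean_le _ _).trans h1) h2
    _ = ε * ‖a‖ := by ring

theorem UniformDixmierProperty.exists_norm_conjMean_sub_le (h : UniformDixmierProperty A)
    {ε : ℝ} (hε : 0 < ε) : ∃ n : ℕ, 0 < n ∧ ∀ a : A, ∃ z ∈ Set.center A,
      ∃ u : Fin n → unitary A, ‖conjMean u a - z‖ ≤ ε * ‖a‖ := by
  obtain ⟨n, hn, hu⟩ := h (ε / 2) (half_pos hε)
  refine ⟨n, hn, fun a ↦ ?_⟩
  rcases eq_or_ne a 0 with rfl | ha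
  · exact ⟨0, Set.zero_mem_center, fun _ ↦ 1, by simp⟩
  obtain ⟨u, hua⟩ := hu a
  have hlt : ε / 2 * ‖a‖ < ε * ‖a‖ := by
    have := norm_pos_iff.mpr ha
    gcongr
    linarith
  obtain ⟨z, hz, hzu⟩ :=
    (Metric.infDist_lt_iff ⟨0, Set.zero_mem_center⟩).mp (hua.trans_lt hlt)
  exact ⟨z, hz, u, by rw [← dist_eq_norm]; exact hzu.le⟩

/-- **Theorem 3.2.**  Equivalent formulations of the uniform Dixmier property. -/
theorem uniformDixmier_equivalences (A : Type*) [CStarAlgebra A] :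
    (UniformDixmierProperty A ↔
      (∃ (m : ℕ) (γ : ℝ), 0 < m ∧ 0 < γ ∧ γ < 1 ∧
        ∀ a : A, IsSelfAdjoint a → ∃ z ∈ Set.center A, ∃ u : Fin m → unitary A,
          ‖(m : ℝ)⁻¹ • ∑ i, (u i : A) * a * star (u i : A) - z‖ ≤ γ * ‖a‖)) ∧
    (UniformDixmierProperty A ↔
      (∃ (m : ℕ) (γ : ℝ), 0 < m ∧ 0 < γ ∧ γ < 1 ∧
        ∀ a : A, IsSelfAdjoint a → ∃ z ∈ Set.center A, ∃ u : Fin m → unitary A,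
          ∃ t : Fin m → ℝ, (∀ i, t i ∈ Set.Icc (0 : ℝ) 1) ∧ (∑ i, t i) = 1 ∧
            ‖(∑ i, t i • ((u i : A) * a * star (u i : A))) - z‖ ≤ γ * ‖a‖)) ∧
    (UniformDixmierProperty A ↔
      (∃ Φ : A → A, (∀ a : A, Φ a ∈ Set.center A) ∧
        ∀ ε : ℝ, 0 < ε → ∃ n : ℕ, 0 < n ∧ ∀ a : A, ∃ u : Fin n → unitary A,
          ‖(n : ℝ)⁻¹ • ∑ i, (u i : A) * a * star (u i : A) - Φ a‖ ≤ ε * ‖a‖)) := by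
  have h12 : UniformDixmierProperty A → ∃ (m : ℕ) (γ : ℝ), 0 < m ∧ 0 < γ ∧ γ < 1 ∧
      ∀ a : A, IsSelfAdjoint a → ∃ z ∈ Set.center A, ∃ u : Fin m → unitary A,
        ‖conjMean u a - z‖ ≤ γ * ‖a‖ := fun h ↦ by
    obtain ⟨n, hn, hu⟩ := h.exists_norm_conjMean_sub_le one_half_pos
    exact ⟨n, 1 / 2, hn, one_half_pos, one_half_lt_one, fun a _ ↦ hu a⟩
  refine ⟨⟨h12, ?_⟩, ⟨fun h ↦ ?_, ?_⟩, ⟨fun h ↦ ?_, ?_⟩⟩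
  · rintro ⟨m, γ, hm, hγ, hγ1, h⟩
    exact uniformDixmierProperty_of_selfAdjoint hm hγ.le hγ1 h
  · obtain ⟨m, γ, hm, hγ, hγ1, h⟩ := h12 h
    refine ⟨m, γ, hm, hγ, hγ1, fun a ha ↦ ?_⟩
    obtain ⟨z, hz, u, hu⟩ := h a ha
    have hm1 : (1 : ℝ) ≤ m := by exact_mod_cast hm
    refine ⟨z, hz, u, fun _ ↦ (m : ℝ)⁻¹, fun _ ↦ ⟨by positivity, inv_le_one_of_one_le₀ hm1⟩,
      ?_, ?_⟩
    · simp [hm.ne']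
    · rwa [← Finset.smul_sum]
  · rintro ⟨m, γ, hm, hγ, hγ1, h⟩
    obtain ⟨N, hN⟩ := exists_nat_gt (2 * m / ((1 - γ) / 2))
    have hγ' : 0 < (1 - γ) / 2 := by linarith
    have hN0 : (0 : ℝ) < N := lt_of_le_of_lt (by positivity) hN
    refine uniformDixmierProperty_of_selfAdjoint (m := N) (γ := (1 + γ) / 2)
      (by exact_mod_cast hN0) (by linarith) (by linarith) fun a ha ↦ ?_
    obtain ⟨z, hz, u, t, ht, ht1, hu⟩ := h a ha
    obtain ⟨v, hv⟩ := exists_conjMean_near_convex_comb u (fun i ↦ (ht i).1) ht1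
      (N := N) (by exact_mod_cast hN0)
    have hsmall : 2 * m / N ≤ (1 - γ) / 2 := by
      rw [div_lt_iff₀ hγ'] at hN
      rw [div_le_iff₀ hN0]
      linarith
    have hva : ‖conjMean v a - ∑ i, t i • ((u i : A) * a * star (u i : A))‖ ≤
        (1 - γ) / 2 * ‖a‖ := (hv a).trans (by gcongr)
    refine ⟨z, hz, v, ?_⟩
    linarith [norm_sub_le_norm_sub_add_norm_sub (conjMean v a)
      (∑ i, t i • ((u i : A) * a * star (u i : A))) z]
  · obtain ⟨n, hn, hu⟩ := h.exists_norm_conjMean_sub_le one_half_pos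
    have hΦ (a : A) := exists_center_forall_norm_conjMean_sub_le (S := Set.univ) hn
      one_half_pos.le one_half_lt_one (by simpa using hu) (Set.mem_univ a)
    choose Φ hΦ_center hΦ_near using hΦ
    refine ⟨Φ, hΦ_center, fun ε hε ↦ ?_⟩
    obtain ⟨k, hk⟩ := exists_const_mul_pow_le one_half_pos.le one_half_lt_one hε
      (1 + 2 / (1 - 1 / 2))
    refine ⟨n ^ k, pow_pos hn k, fun a ↦ ?_⟩
    obtain ⟨u, hu⟩ := hΦ_near a k
    exact ⟨u, hu.trans (by gcongr)⟩
  · rintro ⟨Φ, hΦ, h⟩ ε hε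
    obtain ⟨n, hn, hu⟩ := h ε hε
    refine ⟨n, hn, fun a ↦ ?_⟩
    obtain ⟨u, hua⟩ := hu a
    exact ⟨u, (Metric.infDist_le_dist_of_mem (hΦ a)).trans (by rwa [dist_eq_norm])⟩

end
end

section
/- Let m ∈ ℕ and 0 < γ < 1. (i) If A is a unital C*-algebra with the uniform Dixmier property with constants (m, γ), then every quotient of A by a proper closed two-sided ideal has the uniform Dixmier property with the same constants (m, γ). (ii) If A_1, A_2, … are unital C*-algebras each with the uniform Dixmier property with constants (m, γ), then the ℓ∞-direct product ∏_{n=1}^∞ A_n (bounded sequences with the supremum norm) has the uniform Dixmier property with constants (m, γ). -/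
open scoped ENNReal

noncomputable section

/-- The uniform Dixmier property with constants `(m, γ)`: every self-adjoint element `a` can be
averaged by `m` unitaries to within `γ * ‖a‖` of some central element. -/
def UniformDixmierWith (B : Type*) [NormedRing B] [StarRing B] [NormedAlgebra ℂ B]
    (m : ℕ) (γ : ℝ) : Prop :=
  ∀ a : B, IsSelfAdjoint a → ∃ z ∈ Set.center B, ∃ u : Fin m → unitary B,
    ‖(m : ℝ)⁻¹ • ∑ i, (u i : B) * a * star (u i : B) - z‖ ≤ γ * ‖a‖

open scoped CStarAlgebra in
/-- A self-adjoint element lifts along a surjective star homomorphism of C⋆-algebras to a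
self-adjoint element of no larger norm. -/
theorem exists_isSelfAdjoint_lift_norm_le {A B : Type*} [CStarAlgebra A] [CStarAlgebra B]
    (π : A →⋆ₐ[ℂ] B) (hπ : Function.Surjective π) {b : B} (hb : IsSelfAdjoint b) :
    ∃ a : A, IsSelfAdjoint a ∧ π a = b ∧ ‖a‖ ≤ ‖b‖ := by
  obtain ⟨c, rfl⟩ := hπ b
  have hre : π (realPart c : A) = π c := by
    rw [realPart_apply_coe]
    have : π ((2 : ℝ)⁻¹ • (c + star c)) = (2 : ℝ)⁻¹ • π (c + star c) :=
      map_real_smul π (map_continuous π) _ _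
    rw [this, map_add, map_star, hb.star_eq, ← two_smul ℝ (π c), smul_smul]
    norm_num
  have hc : IsSelfAdjoint (realPart c : A) := (realPart c).2
  have hcont : Continuous fun t : ℝ => max (-‖π c‖) (min ‖π c‖ t) := by fun_prop
  refine ⟨cfc (fun t : ℝ => max (-‖π c‖) (min ‖π c‖ t)) (realPart c : A), cfc_predicate _ _,
    ?_, ?_⟩
  · have hmap := StarAlgHomClass.map_cfc (R := ℝ) (S := ℂ) π
      (fun t : ℝ => max (-‖π c‖) (min ‖π c‖ t)) (realPart c : A) hcont.continuousOn
      (map_continuous π) hc (by rw [hre]; exact hb)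
    rw [hmap, hre]
    conv_rhs => rw [← cfc_id ℝ (π c) hb]
    refine cfc_congr fun t ht => ?_
    rcases subsingleton_or_nontrivial B with _ | _
    · simp [spectrum.of_subsingleton] at ht
    have h := abs_le.1 (spectrum.norm_le_norm_of_mem ht)
    simp [min_eq_right h.2, max_eq_right h.1]
  · refine norm_cfc_le (norm_nonneg _) fun t _ => ?_
    rw [Real.norm_eq_abs, abs_le]
    exact ⟨le_max_left _ _, max_le (by linarith [norm_nonneg (π c)]) (min_le_left _ _)⟩

open scoped CStarAlgebra in
/-- The uniform Dixmier property passes to images of surjective star homomorphisms. -/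
theorem UniformDixmierWith.of_surjective {A B : Type*} [CStarAlgebra A] [CStarAlgebra B]
    {m : ℕ} {γ : ℝ} (hγ : 0 ≤ γ) (hA : UniformDixmierWith A m γ)
    (π : A →⋆ₐ[ℂ] B) (hπ : Function.Surjective π) : UniformDixmierWith B m γ := by
  intro b hb
  obtain ⟨a, ha, rfl, hab⟩ := exists_isSelfAdjoint_lift_norm_le π hπ hb
  obtain ⟨z, hz, u, hu⟩ := hA a ha
  refine ⟨π z, ?_, fun i => ⟨π (u i), Unitary.map_mem π (u i).2⟩, ?_⟩
  · rw [Semigroup.mem_center_iff] at hz ⊢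
    intro g
    obtain ⟨g, rfl⟩ := hπ g
    rw [← map_mul, hz, map_mul]
  · have h : (m : ℝ)⁻¹ • ∑ i, π (u i) * π a * star (π (u i)) - π z =
        π ((m : ℝ)⁻¹ • ∑ i, (u i : A) * a * star (u i : A) - z) := by
      rw [map_sub, map_real_smul π (map_continuous π)]
      simp [map_sum, map_star]
    calc _ = ‖π ((m : ℝ)⁻¹ • ∑ i, (u i : A) * a * star (u i : A) - z)‖ := by rw [← h]
      _ ≤ _ := NonUnitalStarAlgHom.norm_apply_le π _
      _ ≤ γ * ‖a‖ := hu
      _ ≤ _ := by gcongr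

/-- The uniform Dixmier property passes to `ℓ∞`-direct products. -/
theorem UniformDixmierWith.lp_infty {ι : Type*} {A : ι → Type*} [∀ n, CStarAlgebra (A n)]
    [∀ n, Nontrivial (A n)] {m : ℕ} (hm : 0 < m) {γ : ℝ} (hγ : 0 ≤ γ)
    (hA : ∀ n, UniformDixmierWith (A n) m γ) : UniformDixmierWith (lp A ∞) m γ := by
  intro a ha
  have han : ∀ n, IsSelfAdjoint (a n) := fun n => congrArg (fun x : lp A ∞ => x n) ha.star_eq
  choose z hz u hu using fun n => hA n (a n) (han n)
  have hle : ∀ n, ‖a n‖ ≤ ‖a‖ := lp.norm_apply_le_norm ENNReal.top_ne_zero a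
  have hzn : ∀ n, ‖z n‖ ≤ ‖a‖ + γ * ‖a‖ := by
    intro n
    have havg : ‖(m : ℝ)⁻¹ • ∑ i, (u n i : A n) * a n * star (u n i : A n)‖ ≤ ‖a n‖ := by
      rw [norm_smul, norm_inv, RCLike.norm_natCast, inv_mul_le_iff₀ (by positivity)]
      refine (norm_sum_le _ _).trans ?_
      refine (Finset.sum_le_card_nsmul _ _ ‖a n‖ fun i _ => ?_).trans (by simp)
      rw [← Unitary.coe_star, CStarRing.norm_mul_coe_unitary, CStarRing.norm_coe_unitary_mul]
    have h := norm_sub_norm_le (z n) ((m : ℝ)⁻¹ • ∑ i, (u n i : A n) * a n * star (u n i : A n))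
    rw [norm_sub_rev] at h
    have h' := mul_le_mul_of_nonneg_left (hle n) hγ
    linarith [hu n, hle n]
  let Z : lp A ∞ := ⟨z, memℓp_infty ⟨_, by rintro _ ⟨n, rfl⟩; exact hzn n⟩⟩
  let U : Fin m → lp A ∞ := fun i => ⟨fun n => (u n i : A n),
    memℓp_infty ⟨1, by rintro _ ⟨n, rfl⟩; exact (CStarRing.norm_coe_unitary _).le⟩⟩
  have hU : ∀ i, U i ∈ unitary (lp A ∞) := fun i => by
    rw [Unitary.mem_iff]
    constructor <;> ext n
    · exact Unitary.coe_star_mul_self (u n i)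
    · exact Unitary.coe_mul_star_self (u n i)
  refine ⟨Z, ?_, fun i => ⟨U i, hU i⟩, ?_⟩
  · rw [Semigroup.mem_center_iff]
    intro g
    ext n
    exact Semigroup.mem_center_iff.1 (hz n) (g n)
  · refine lp.norm_le_of_forall_le (by positivity) fun n => ?_
    have h : ((m : ℝ)⁻¹ • ∑ i, U i * a * star (U i) - Z) n =
        (m : ℝ)⁻¹ • ∑ i, (u n i : A n) * a n * star (u n i : A n) - z n := by
      rw [lp.coeFn_sub, Pi.sub_apply, lp.coeFn_smul, Pi.smul_apply, lp.coeFn_sum,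
        Finset.sum_apply]
      rfl
    calc _ = ‖(m : ℝ)⁻¹ • ∑ i, (u n i : A n) * a n * star (u n i : A n) - z n‖ :=
          congrArg norm h
      _ ≤ γ * ‖a n‖ := hu n
      _ ≤ γ * ‖a‖ := by gcongr; exact hle n

/-- **Theorem 3.5.**  (i) The uniform Dixmier property with constants `(m, γ)` passes to
quotients (represented by surjective star-algebra homomorphisms); (ii) it passes to
`ℓ∞`-direct products. -/
theorem uniformDixmierWith_quotient_and_product (m : ℕ) (hm : 0 < m) (γ : ℝ)
    (hγ0 : 0 < γ) (hγ1 : γ < 1) :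
    (∀ (A B : Type*) [CStarAlgebra A] [CStarAlgebra B],
      ∀ π : A →⋆ₐ[ℂ] B, Function.Surjective π →
        UniformDixmierWith A m γ → UniformDixmierWith B m γ) ∧
    (∀ (A : ℕ → Type*) [∀ n, CStarAlgebra (A n)] [∀ n, Nontrivial (A n)],
      (∀ n, UniformDixmierWith (A n) m γ) → UniformDixmierWith (lp A ∞) m γ) := by
  exact ⟨fun _ _ _ _ π hπ hA => hA.of_surjective hγ0.le π hπ,
    fun _ _ _ hA => UniformDixmierWith.lp_infty hm hγ0.le hA⟩

end
end

section
/- Let A be a unital C*-algebra and let (A_k)_{k=1}^∞ be an increasing sequence of C*-subalgebras of A, all containing the unit of A, whose union is norm-dense in A. Suppose that each A_k has the singleton Dixmier property, and let R_k denote the centre-valued trace on A_k. The following are equivalent: (i) A has the Dixmier property; (ii) the limit lim_{k→∞} R_k(a) exists in norm for every a in ⋃_{k=1}^∞ A_k; (iii) A has the singleton Dixmier property and its centre-valued trace R satisfies R(a) = lim_{k→∞} R_k(a) for all a ∈ ⋃_{k=1}^∞ A_k. -/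
noncomputable section

variable {A : Type*} [CStarAlgebra A]

/-- A unital C*-subalgebra of `A`, given as a subset: it contains the unit and is a
norm-closed subalgebra stable under `star`. -/
def IsUnitalCStarSubalgebra (S : Set A) : Prop :=
  (1 : A) ∈ S ∧ IsClosed S ∧ (∀ x ∈ S, ∀ y ∈ S, x + y ∈ S) ∧
    (∀ x ∈ S, ∀ y ∈ S, x * y ∈ S) ∧ (∀ (c : ℂ), ∀ x ∈ S, c • x ∈ S) ∧ ∀ x ∈ S, star x ∈ S

/-- The centre of the subalgebra `S`. -/
def centerIn (S : Set A) : Set A := {z ∈ S | ∀ x ∈ S, z * x = x * z}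

/-- The Dixmier set of `a` relative to the subalgebra `S`: the norm-closed convex hull of the
conjugates of `a` by unitaries of `S`. -/
def dixmierSetIn (S : Set A) (a : A) : Set A :=
  closure (convexHull ℝ
    {b : A | ∃ u ∈ S, u * star u = 1 ∧ star u * u = 1 ∧ b = u * a * star u})

/-- The singleton Dixmier property for the subalgebra `S`. -/
def SingletonDixmierIn (S : Set A) : Prop :=
  ∀ a ∈ S, ∃ z : A, dixmierSetIn S a ∩ centerIn S = {z}

/-- A centre-valued trace on the subalgebra `S`: a positive linear contraction from `S` to the
centre of `S`, fixing the centre and with the trace property.  (Only the values of `R` on `S`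
are relevant.) -/
def IsCenterValuedTraceIn (S : Set A) (R : A → A) : Prop :=
  (∀ a ∈ S, R a ∈ centerIn S) ∧ (∀ a ∈ S, ∀ b ∈ S, R (a + b) = R a + R b) ∧
    (∀ (c : ℂ), ∀ a ∈ S, R (c • a) = c • R a) ∧ (∀ a ∈ S, ‖R a‖ ≤ ‖a‖) ∧
    (∀ a ∈ S, ∃ b ∈ S, R (star a * a) = star b * b) ∧
    (∀ z ∈ centerIn S, R z = z) ∧ ∀ a ∈ S, ∀ b ∈ S, R (a * b) = R (b * a)

/-- The Dixmier set of `a`: the norm-closed convex hull of the unitary conjugates of `a`. -/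
def dixmierSet (a : A) : Set A :=
  closure (convexHull ℝ {b : A | ∃ u : unitary A, b = (u : A) * a * star (u : A)})

/-- The Dixmier property. -/
def DixmierProperty (A : Type*) [CStarAlgebra A] : Prop :=
  ∀ a : A, (dixmierSet a ∩ Set.center A).Nonempty

/-- The singleton Dixmier property. -/
def SingletonDixmierProperty (A : Type*) [CStarAlgebra A] : Prop :=
  ∀ a : A, ∃ z : A, dixmierSet a ∩ Set.center A = {z}

/-- A property of `A` which holds on unitary conjugates in `S` and defines a closed convex set
holds on the Dixmier set. -/
lemma dixmierSetIn_subset {S : Set A} {a : A} {T : Set A} (hconv : Convex ℝ T) (hT : IsClosed T)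
    (h : ∀ u ∈ S, u * star u = 1 → star u * u = 1 → u * a * star u ∈ T) :
    dixmierSetIn S a ⊆ T := by
  refine closure_minimal (convexHull_min ?_ hconv) hT
  rintro b ⟨u, hu, h1, h2, rfl⟩
  exact h u hu h1 h2

lemma dixmierSetIn_mono {S T : Set A} (h : S ⊆ T) (a : A) :
    dixmierSetIn S a ⊆ dixmierSetIn T a :=
  closure_mono (convexHull_mono fun _ ⟨u, hu, h1, h2, hb⟩ => ⟨u, h hu, h1, h2, hb⟩)

lemma dixmierSet_eq (a : A) : dixmierSet a = dixmierSetIn Set.univ a := by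
  unfold dixmierSet dixmierSetIn
  congr 2
  ext b
  constructor
  · rintro ⟨u, rfl⟩
    exact ⟨u, trivial, Unitary.mul_star_self_of_mem u.2, Unitary.star_mul_self_of_mem u.2, rfl⟩
  · rintro ⟨u, -, h1, h2, rfl⟩
    exact ⟨⟨u, Unitary.mem_iff.2 ⟨h2, h1⟩⟩, rfl⟩

lemma center_eq_centerIn_univ : Set.center A = centerIn (Set.univ : Set A) := by
  ext z
  rw [Semigroup.mem_center_iff]
  exact ⟨fun h => ⟨trivial, fun x _ => (h x).symm⟩, fun h x => (h.2 x trivial).symm⟩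

lemma norm_conj_le {u : A} (h1 : u * star u = 1) (h2 : star u * u = 1) (a : A) :
    ‖u * a * star u‖ ≤ ‖a‖ := by
  have hu : u ∈ unitary A := Unitary.mem_iff.2 ⟨h2, h1⟩
  rw [CStarRing.norm_mul_mem_unitary _ (Unitary.star_mem hu), CStarRing.norm_mem_unitary_mul _ hu]

/-- Averaging over unitaries does not increase the distance to an element commuting with them. -/
lemma norm_sub_le_of_mem_dixmierSetIn {S : Set A} {b c z : A} (hz : ∀ x ∈ S, z * x = x * z)
    (hc : c ∈ dixmierSetIn S b) : ‖c - z‖ ≤ ‖b - z‖ := by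
  have := dixmierSetIn_subset (convex_closedBall z ‖b - z‖) Metric.isClosed_closedBall
    (fun u hu h1 h2 => ?_) hc
  · simpa [dist_eq_norm] using this
  · rw [mem_closedBall_iff_norm]
    refine le_trans (le_of_eq ?_) (norm_conj_le h1 h2 (b - z))
    rw [mul_sub, sub_mul, ← hz u hu, mul_assoc z, h1, mul_one]

/-- Convex combinations of conjugates of nearby elements are close. -/
lemma exists_mem_convexHull_norm_sub_le (S : Set A) (a a' : A) {b : A}
    (hb : b ∈ convexHull ℝ
      {b : A | ∃ u ∈ S, u * star u = 1 ∧ star u * u = 1 ∧ b = u * a * star u}) :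
    ∃ b' ∈ convexHull ℝ
      {b : A | ∃ u ∈ S, u * star u = 1 ∧ star u * u = 1 ∧ b = u * a' * star u},
      ‖b - b'‖ ≤ ‖a - a'‖ := by
  refine convexHull_min (t := {b | ∃ b' ∈ convexHull ℝ
      {b : A | ∃ u ∈ S, u * star u = 1 ∧ star u * u = 1 ∧ b = u * a' * star u},
      ‖b - b'‖ ≤ ‖a - a'‖}) ?_ ?_ hb
  · rintro b ⟨u, hu, h1, h2, rfl⟩
    refine ⟨_, subset_convexHull ℝ _ ⟨u, hu, h1, h2, rfl⟩, ?_⟩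
    rw [← sub_mul, ← mul_sub]
    exact norm_conj_le h1 h2 _
  · rintro x ⟨x', hx', hx⟩ y ⟨y', hy', hy⟩ s t hs ht hst
    refine ⟨s • x' + t • y', convex_convexHull ℝ _ hx' hy' hs ht hst, ?_⟩
    have := convex_closedBall (0 : A) ‖a - a'‖ (mem_closedBall_zero_iff.2 hx)
      (mem_closedBall_zero_iff.2 hy) hs ht hst
    rw [mem_closedBall_zero_iff] at this
    rwa [show s • x + t • y - (s • x' + t • y') = s • (x - x') + t • (y - y') by
      simp only [smul_sub]; abel]

lemma IsUnitalCStarSubalgebra.sub_mem {S : Set A} (h : IsUnitalCStarSubalgebra S) {a b : A}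
    (ha : a ∈ S) (hb : b ∈ S) : a - b ∈ S := by
  have := h.2.2.1 a ha _ (h.2.2.2.2.1 (-1) b hb)
  simpa [sub_eq_add_neg] using this

lemma IsUnitalCStarSubalgebra.smul_mem {S : Set A} (h : IsUnitalCStarSubalgebra S) (t : ℝ) {a : A}
    (ha : a ∈ S) : t • a ∈ S := by
  rw [← Complex.coe_smul]
  exact h.2.2.2.2.1 _ a ha

lemma isUnitalCStarSubalgebra_univ : IsUnitalCStarSubalgebra (Set.univ : Set A) := by
  simp [IsUnitalCStarSubalgebra]

lemma IsCenterValuedTraceIn.map_smul {S : Set A} {R : A → A} (hR : IsCenterValuedTraceIn S R)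
    (t : ℝ) {a : A} (ha : a ∈ S) : R (t • a) = t • R a := by
  rw [← Complex.coe_smul, ← Complex.coe_smul]
  exact hR.2.2.1 _ a ha

lemma IsCenterValuedTraceIn.map_sub {S : Set A} {R : A → A} (hR : IsCenterValuedTraceIn S R)
    (hS : IsUnitalCStarSubalgebra S) {a b : A} (ha : a ∈ S) (hb : b ∈ S) :
    R (a - b) = R a - R b := by
  have h := hR.2.1 (a - b) (hS.sub_mem ha hb) b hb
  rw [sub_add_cancel] at h
  exact eq_sub_of_add_eq h.symm

lemma IsCenterValuedTraceIn.norm_sub_le {S : Set A} {R : A → A} (hR : IsCenterValuedTraceIn S R)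
    (hS : IsUnitalCStarSubalgebra S) {a b : A} (ha : a ∈ S) (hb : b ∈ S) :
    ‖R a - R b‖ ≤ ‖a - b‖ := by
  rw [← hR.map_sub hS ha hb]
  exact hR.2.2.2.1 _ (hS.sub_mem ha hb)

/-- A centre-valued trace takes the value `z` at `a` whenever `z` is a central element of the
Dixmier set of `a`. -/
lemma IsCenterValuedTraceIn.eq_of_mem_dixmierSetIn {S : Set A} {R : A → A}
    (hR : IsCenterValuedTraceIn S R) (hS : IsUnitalCStarSubalgebra S) {a z : A} (ha : a ∈ S)
    (hz : z ∈ dixmierSetIn S a) (hzc : z ∈ centerIn S) : R a = z := by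
  have hull : convexHull ℝ
      {b : A | ∃ u ∈ S, u * star u = 1 ∧ star u * u = 1 ∧ b = u * a * star u} ⊆
      {b | b ∈ S ∧ R b = R a} := by
    refine convexHull_min ?_ ?_
    · rintro b ⟨u, hu, h1, h2, rfl⟩
      have hsu := hS.2.2.2.2.2 u hu
      have hua := hS.2.2.2.1 u hu a ha
      refine ⟨hS.2.2.2.1 _ hua _ hsu, ?_⟩
      rw [hR.2.2.2.2.2.2 _ hua _ hsu, ← mul_assoc, h2, one_mul]
    · rintro x ⟨hx, hxR⟩ y ⟨hy, hyR⟩ s t - - hst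
      have hsx := hS.smul_mem s hx
      have hty := hS.smul_mem t hy
      refine ⟨hS.2.2.1 _ hsx _ hty, ?_⟩
      rw [hR.2.1 _ hsx _ hty, hR.map_smul s hx, hR.map_smul t hy, hxR, hyR, ← add_smul, hst,
        one_smul]
  refine eq_of_forall_dist_le fun ε hε => ?_
  obtain ⟨b, hb, hzb⟩ := Metric.mem_closure_iff.1 hz ε hε
  obtain ⟨hbS, hbR⟩ := hull hb
  have h := hR.norm_sub_le hS hbS hzc.1
  rw [hR.2.2.2.2.2.1 z hzc, hbR, ← dist_eq_norm, ← dist_eq_norm, dist_comm b] at h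
  exact h.trans hzb.le

lemma SingletonDixmierIn.trace_mem {S : Set A} {R : A → A} (hSDP : SingletonDixmierIn S)
    (hR : IsCenterValuedTraceIn S R) (hS : IsUnitalCStarSubalgebra S) {a : A} (ha : a ∈ S) :
    R a ∈ dixmierSetIn S a := by
  obtain ⟨z, hz⟩ := hSDP a ha
  have hz' : z ∈ dixmierSetIn S a ∩ centerIn S := hz ▸ rfl
  rw [hR.eq_of_mem_dixmierSetIn hS ha hz'.1 hz'.2]
  exact hz'.1

section InductiveLimit

variable {S : ℕ → Set A} {R : ℕ → A → A}

/-- Averages of unitary conjugates of `a` are approximated by elements of the union whose traces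
are close to those of `a`. -/
lemma exists_approx_of_mem_convexHull (hsub : ∀ k, IsUnitalCStarSubalgebra (S k))
    (hmono : Monotone S) (hdense : Dense (⋃ k, S k))
    (hR : ∀ k, IsCenterValuedTraceIn (S k) (R k)) {k₀ : ℕ} {a : A} (ha : a ∈ S k₀) {b : A}
    (hb : b ∈ convexHull ℝ {b : A | ∃ u ∈ (Set.univ : Set A),
      u * star u = 1 ∧ star u * u = 1 ∧ b = u * a * star u}) {δ : ℝ} (hδ : 0 < δ) :
    ∃ K, ∃ b' ∈ S K, ‖b - b'‖ ≤ δ ∧ ∀ k ≥ K, ‖R k b' - R k a‖ ≤ δ := by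
  refine convexHull_min (t := {b | ∃ K, ∃ b' ∈ S K,
    ‖b - b'‖ ≤ δ ∧ ∀ k ≥ K, ‖R k b' - R k a‖ ≤ δ}) ?_ ?_ hb
  · rintro b ⟨u, -, -, h2, rfl⟩
    have hopen : IsOpen {x : A | ‖u * a * star u - x * a * star x‖ < δ ∧
        ‖star x * x * a - a‖ < δ} := by
      exact IsOpen.inter
        (isOpen_lt (f := fun x : A => ‖u * a * star u - x * a * star x‖) (by fun_prop)
          continuous_const)
        (isOpen_lt (f := fun x : A => ‖star x * x * a - a‖) (by fun_prop) continuous_const)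
    obtain ⟨x, ⟨hx1, hx2⟩, hxS⟩ := hdense.inter_open_nonempty _ hopen ⟨u, by simp [h2, hδ]⟩
    obtain ⟨j, hj⟩ := Set.mem_iUnion.1 hxS
    have hmem : ∀ k ≥ max j k₀, x ∈ S k ∧ star x ∈ S k ∧ a ∈ S k := fun k hk =>
      have hx := hmono (le_of_max_le_left hk) hj
      ⟨hx, (hsub k).2.2.2.2.2 x hx, hmono (le_of_max_le_right hk) ha⟩
    have hmul := fun k => (hsub k).2.2.2.1
    refine ⟨max j k₀, x * a * star x, ?_, hx1.le, fun k hk => ?_⟩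
    · obtain ⟨hx, hsx, ha'⟩ := hmem _ le_rfl
      exact hmul _ _ (hmul _ _ hx _ ha') _ hsx
    · obtain ⟨hx, hsx, ha'⟩ := hmem k hk
      rw [(hR k).2.2.2.2.2.2 _ (hmul _ _ hx _ ha') _ hsx, ← mul_assoc]
      exact ((hR k).norm_sub_le (hsub k) (hmul _ _ (hmul _ _ hsx _ hx) _ ha') ha').trans hx2.le
  · rintro x ⟨K, x', hx', hx, hxR⟩ y ⟨K', y', hy', hy, hyR⟩ s t hs ht hst
    have hmem : ∀ k ≥ max K K', s • x' ∈ S k ∧ t • y' ∈ S k := fun k hk =>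
      ⟨(hsub k).smul_mem s (hmono (le_of_max_le_left hk) hx'),
        (hsub k).smul_mem t (hmono (le_of_max_le_right hk) hy')⟩
    have key : ∀ p q : A, ‖p‖ ≤ δ → ‖q‖ ≤ δ → ‖s • p + t • q‖ ≤ δ := fun p q hp hq =>
      mem_closedBall_zero_iff.1 (convex_closedBall (0 : A) δ (mem_closedBall_zero_iff.2 hp)
        (mem_closedBall_zero_iff.2 hq) hs ht hst)
    refine ⟨max K K', s • x' + t • y',
      (hsub _).2.2.1 _ (hmem _ le_rfl).1 _ (hmem _ le_rfl).2, ?_, fun k hk => ?_⟩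
    · convert key _ _ hx hy using 2
      simp only [smul_sub]
      abel
    · rw [(hR k).2.1 _ (hmem k hk).1 _ (hmem k hk).2,
        (hR k).map_smul s (hmono (le_of_max_le_left hk) hx'),
        (hR k).map_smul t (hmono (le_of_max_le_right hk) hy')]
      convert key _ _ (hxR k (le_of_max_le_left hk)) (hyR k (le_of_max_le_right hk)) using 2
      have : R k a = s • R k a + t • R k a := by rw [← add_smul, hst, one_smul]
      nth_rewrite 1 [this]
      simp only [smul_sub]
      abel

/-- The traces of `a'` are eventually close to any central element of the Dixmier set of a nearby
element `a`. -/
lemma eventually_norm_trace_sub_le (hsub : ∀ k, IsUnitalCStarSubalgebra (S k))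
    (hmono : Monotone S) (hdense : Dense (⋃ k, S k)) (hSDP : ∀ k, SingletonDixmierIn (S k))
    (hR : ∀ k, IsCenterValuedTraceIn (S k) (R k)) {k₀ : ℕ} {a a' z : A} (ha' : a' ∈ S k₀)
    (hz : z ∈ dixmierSet a) (hzc : z ∈ Set.center A) {δ : ℝ} (hδ : 0 < δ) :
    ∀ᶠ k in Filter.atTop, ‖R k a' - z‖ ≤ ‖a - a'‖ + 3 * δ := by
  rw [dixmierSet_eq] at hz
  rw [center_eq_centerIn_univ] at hzc
  obtain ⟨b, hb, hzb⟩ := Metric.mem_closure_iff.1 hz δ hδ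
  rw [dist_eq_norm] at hzb
  obtain ⟨c, hc, hbc⟩ := exists_mem_convexHull_norm_sub_le _ a a' hb
  obtain ⟨K, b', hb', hcb, hK⟩ := exists_approx_of_mem_convexHull hsub hmono hdense hR ha' hc hδ
  filter_upwards [Filter.eventually_ge_atTop K] with k hk
  have h1 : ‖R k b' - z‖ ≤ ‖b' - z‖ :=
    norm_sub_le_of_mem_dixmierSetIn (S := S k) (fun x _ => hzc.2 x trivial)
      ((hSDP k).trace_mem (hR k) (hsub k) (hmono hk hb'))
  have h2 := hK k hk
  have h3 : ‖b' - z‖ ≤ ‖c - b'‖ + ‖b - c‖ + ‖z - b‖ := by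
    rw [norm_sub_rev b' z]
    calc ‖z - b'‖ = ‖(c - b') + (b - c) + (z - b)‖ := by congr 1; abel
      _ ≤ _ := norm_add₃_le
  have h4 : ‖R k a' - z‖ ≤ ‖R k b' - R k a'‖ + ‖R k b' - z‖ := by
    rw [norm_sub_rev (R k b') (R k a')]
    exact norm_sub_le_norm_sub_add_norm_sub _ _ _
  linarith

lemma tendsto_trace_of_mem_dixmierSet (hsub : ∀ k, IsUnitalCStarSubalgebra (S k))
    (hmono : Monotone S) (hdense : Dense (⋃ k, S k)) (hSDP : ∀ k, SingletonDixmierIn (S k))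
    (hR : ∀ k, IsCenterValuedTraceIn (S k) (R k)) {k₀ : ℕ} {a z : A} (ha : a ∈ S k₀)
    (hz : z ∈ dixmierSet a) (hzc : z ∈ Set.center A) :
    Filter.Tendsto (fun k => R k a) Filter.atTop (nhds z) := by
  refine Metric.tendsto_nhds.2 fun ε hε => ?_
  filter_upwards [eventually_norm_trace_sub_le hsub hmono hdense hSDP hR ha hz hzc
    (show 0 < ε / 4 by positivity)] with k hk
  rw [dist_eq_norm]
  rw [sub_self, norm_zero] at hk
  linarith

lemma eq_of_mem_dixmierSet_of_mem_center (hsub : ∀ k, IsUnitalCStarSubalgebra (S k))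
    (hmono : Monotone S) (hdense : Dense (⋃ k, S k)) (hSDP : ∀ k, SingletonDixmierIn (S k))
    (hR : ∀ k, IsCenterValuedTraceIn (S k) (R k)) {a z w : A}
    (hz : z ∈ dixmierSet a) (hzc : z ∈ Set.center A)
    (hw : w ∈ dixmierSet a) (hwc : w ∈ Set.center A) : z = w := by
  refine eq_of_forall_dist_le fun ε hε => ?_
  have hδ : 0 < ε / 8 := by positivity
  obtain ⟨a', ha'S, ha'⟩ := Metric.dense_iff.1 hdense a (ε / 8) hδ
  obtain ⟨k₀, hk₀⟩ := Set.mem_iUnion.1 ha'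
  rw [mem_ball_iff_norm'] at ha'S
  obtain ⟨k, h1, h2⟩ := ((eventually_norm_trace_sub_le hsub hmono hdense hSDP hR hk₀ hz hzc
    hδ).and (eventually_norm_trace_sub_le hsub hmono hdense hSDP hR hk₀ hw hwc hδ)).exists
  have h3 := dist_triangle_left z w (R k a')
  rw [← dist_eq_norm] at h1 h2
  linarith

/-- The limit of the traces is a central element of the Dixmier set. -/
lemma mem_dixmierSet_inter_center_of_tendsto (hsub : ∀ k, IsUnitalCStarSubalgebra (S k))
    (hmono : Monotone S) (hdense : Dense (⋃ k, S k)) (hSDP : ∀ k, SingletonDixmierIn (S k))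
    (hR : ∀ k, IsCenterValuedTraceIn (S k) (R k)) {k₀ : ℕ} {a L : A} (ha : a ∈ S k₀)
    (hL : Filter.Tendsto (fun k => R k a) Filter.atTop (nhds L)) :
    L ∈ dixmierSet a ∩ Set.center A := by
  constructor
  · refine isClosed_closure.mem_of_tendsto hL ?_
    filter_upwards [Filter.eventually_ge_atTop k₀] with k hk
    have := dixmierSetIn_mono (Set.subset_univ _) a
      ((hSDP k).trace_mem (hR k) (hsub k) (hmono hk ha))
    rwa [← dixmierSet_eq] at this
  · rw [Semigroup.mem_center_iff]
    intro x
    have hclosed : IsClosed {x : A | x * L = L * x} := isClosed_eq (by fun_prop) (by fun_prop)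
    refine hclosed.closure_subset_iff.2 ?_ (hdense x)
    intro y hy
    obtain ⟨j, hj⟩ := Set.mem_iUnion.1 hy
    refine tendsto_nhds_unique_of_eventuallyEq (hL.const_mul y) (hL.mul_const y) ?_
    filter_upwards [Filter.eventually_ge_atTop (max j k₀)] with k hk
    exact (((hR k).1 a (hmono (le_of_max_le_right hk) ha)).2 y
      (hmono (le_of_max_le_left hk) hj)).symm

lemma dixmierProperty_of_tendsto (hsub : ∀ k, IsUnitalCStarSubalgebra (S k))
    (hmono : Monotone S) (hdense : Dense (⋃ k, S k)) (hSDP : ∀ k, SingletonDixmierIn (S k))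
    (hR : ∀ k, IsCenterValuedTraceIn (S k) (R k))
    (hlim : ∀ k₀ : ℕ, ∀ a ∈ S k₀, ∃ L : A,
      Filter.Tendsto (fun k : ℕ => R k a) Filter.atTop (nhds L)) :
    DixmierProperty A := by
  intro a
  obtain ⟨s, hs, hsa⟩ := mem_closure_iff_seq_limit.1 (hdense a)
  choose j hj using fun n => Set.mem_iUnion.1 (hs n)
  choose L hL using fun n => hlim (j n) (s n) (hj n)
  have hmem := fun n =>
    mem_dixmierSet_inter_center_of_tendsto hsub hmono hdense hSDP hR (hj n) (hL n)
  have hdist : ∀ m n, dist (L m) (L n) ≤ dist (s m) (s n) := fun m n => by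
    refine le_of_tendsto ((hL m).dist (hL n)) ?_
    filter_upwards [Filter.eventually_ge_atTop (max (j m) (j n))] with k hk
    rw [dist_eq_norm, dist_eq_norm]
    exact (hR k).norm_sub_le (hsub k) (hmono (le_of_max_le_left hk) (hj m))
      (hmono (le_of_max_le_right hk) (hj n))
  have hcauchy : CauchySeq L := by
    refine Metric.cauchySeq_iff.2 fun ε hε => ?_
    obtain ⟨N, hN⟩ := Metric.cauchySeq_iff.1 hsa.cauchySeq ε hε
    exact ⟨N, fun m hm n hn => (hdist m n).trans_lt (hN m hm n hn)⟩
  obtain ⟨z, hz⟩ := cauchySeq_tendsto_of_complete hcauchy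
  refine ⟨z, ?_, ?_⟩
  · rw [dixmierSet_eq]
    refine Metric.mem_closure_iff.2 fun ε hε => ?_
    have hδ : 0 < ε / 3 := by positivity
    obtain ⟨n, hn1, hn2⟩ := ((Metric.tendsto_nhds.1 hsa _ hδ).and
      (Metric.tendsto_nhds.1 hz _ hδ)).exists
    have hLn := (hmem n).1
    rw [dixmierSet_eq] at hLn
    obtain ⟨b, hb, hLb⟩ := Metric.mem_closure_iff.1 hLn _ hδ
    obtain ⟨c, hc, hbc⟩ := exists_mem_convexHull_norm_sub_le _ (s n) a hb
    refine ⟨c, hc, ?_⟩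
    rw [← dist_eq_norm, ← dist_eq_norm] at hbc
    have h1 := dist_triangle4 z (L n) b c
    rw [dist_comm z (L n)] at h1
    linarith
  · rw [Semigroup.mem_center_iff]
    exact fun x => tendsto_nhds_unique_of_eventuallyEq (hz.const_mul x) (hz.mul_const x)
      (Filter.Eventually.of_forall fun n => Semigroup.mem_center_iff.1 (hmem n).2 x)

end InductiveLimit

/-- **Proposition 3.6.**  Let `(A_k)` be an increasing sequence of unital C*-subalgebras of `A`
with dense union, each with the singleton Dixmier property and centre-valued trace `R_k`.
Then `A` has the Dixmier property iff `lim_k R_k(a)` exists for all `a` in the union, iff `A`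
has the singleton Dixmier property with centre-valued trace `R = lim_k R_k` on the union. -/
theorem dixmier_of_inductive_limit (A : Type*) [CStarAlgebra A] (S : ℕ → Set A)
    (hsub : ∀ k, IsUnitalCStarSubalgebra (S k)) (hmono : Monotone S)
    (hdense : Dense (⋃ k, S k)) (hSDP : ∀ k, SingletonDixmierIn (S k))
    (R : ℕ → A → A) (hR : ∀ k, IsCenterValuedTraceIn (S k) (R k)) :
    (DixmierProperty A ↔
      ∀ k₀ : ℕ, ∀ a ∈ S k₀, ∃ L : A,
        Filter.Tendsto (fun k : ℕ => R k a) Filter.atTop (nhds L)) ∧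
    (DixmierProperty A ↔
      (SingletonDixmierProperty A ∧
        ∀ R' : A → A, IsCenterValuedTraceIn Set.univ R' →
          ∀ k₀ : ℕ, ∀ a ∈ S k₀,
            Filter.Tendsto (fun k : ℕ => R k a) Filter.atTop (nhds (R' a)))) := by
  refine ⟨⟨fun hD k₀ a ha => ?_, dixmierProperty_of_tendsto hsub hmono hdense hSDP hR⟩,
    ⟨fun hD => ⟨fun a => ?_, fun R' hR' k₀ a ha => ?_⟩, fun h a => ?_⟩⟩
  · obtain ⟨z, hz, hzc⟩ := hD a
    exact ⟨z, tendsto_trace_of_mem_dixmierSet hsub hmono hdense hSDP hR ha hz hzc⟩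
  · obtain ⟨z, hz, hzc⟩ := hD a
    exact ⟨z, Set.eq_singleton_iff_unique_mem.2 ⟨⟨hz, hzc⟩, fun w hw =>
      eq_of_mem_dixmierSet_of_mem_center hsub hmono hdense hSDP hR hw.1 hw.2 hz hzc⟩⟩
  · obtain ⟨z, hz, hzc⟩ := hD a
    rw [hR'.eq_of_mem_dixmierSetIn isUnitalCStarSubalgebra_univ trivial (dixmierSet_eq a ▸ hz)
      (center_eq_centerIn_univ (A := A) ▸ hzc)]
    exact tendsto_trace_of_mem_dixmierSet hsub hmono hdense hSDP hR ha hz hzc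
  · obtain ⟨z, hz⟩ := h.1 a
    exact hz ▸ Set.singleton_nonempty z

end
end

section
/- Let A be a C*-algebra. The following are equivalent: (i) the centre of the C*-algebra ℓ∞(ℕ, A)/c₀(ℕ, A) equals the image of ℓ∞(ℕ, Z(A)) under the quotient map ℓ∞(ℕ, A) → ℓ∞(ℕ, A)/c₀(ℕ, A); (ii) K(A) < ∞, i.e., there exists a constant C ∈ [0, ∞) such that d(a, Z(A)) ≤ C‖ad(a)‖ for all a ∈ A. -/
noncomputable section

variable {A : Type*} [CStarAlgebra A]

/-- The inner derivation `ad(a) : x ↦ x * a - a * x` of `A`, as a continuous linear map. -/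
def innerDerivation (a : A) : A →L[ℂ] A :=
  (ContinuousLinearMap.mul ℂ A).flip a - ContinuousLinearMap.mul ℂ A a

theorem innerDerivation_apply (a x : A) : innerDerivation a x = x * a - a * x := by
  simp [innerDerivation]

theorem norm_commutator_le (a x : A) : ‖a * x - x * a‖ ≤ ‖innerDerivation a‖ * ‖x‖ := by
  rw [norm_sub_rev, ← innerDerivation_apply]
  exact (innerDerivation a).le_opNorm x

theorem exists_half_norm_innerDerivation_le (a : A) :
    ∃ x : A, ‖x‖ ≤ 1 ∧ ‖innerDerivation a‖ ≤ 2 * ‖a * x - x * a‖ := by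
  rcases (norm_nonneg (innerDerivation a)).eq_or_lt with h | h
  · exact ⟨0, by simp, by simp [← h]⟩
  · obtain ⟨x, hx, hx'⟩ :=
      (innerDerivation a).exists_lt_apply_of_lt_opNorm (half_lt_self h)
    rw [innerDerivation_apply, norm_sub_rev] at hx'
    exact ⟨x, hx.le, by linarith⟩

/-- If all commutators with bounded sequences tend to zero, so do the norms of the inner
derivations. -/
theorem tendsto_norm_innerDerivation {b : ℕ → A}
    (hb : ∀ a : ℕ → A, (∃ C : ℝ, ∀ n, ‖a n‖ ≤ C) →
      Filter.Tendsto (fun n => b n * a n - a n * b n) Filter.atTop (nhds 0)) :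
    Filter.Tendsto (fun n => ‖innerDerivation (b n)‖) Filter.atTop (nhds 0) := by
  choose x hx hx' using fun n => exists_half_norm_innerDerivation_le (b n)
  have h := ((hb x ⟨1, hx⟩).norm).const_mul 2
  rw [norm_zero, mul_zero] at h
  exact squeeze_zero (fun n => norm_nonneg _) hx' h

/-- If the norms of the inner derivations tend to zero, so do all commutators with bounded
sequences. -/
theorem tendsto_commutator {b a : ℕ → A} (ha : ∃ C : ℝ, ∀ n, ‖a n‖ ≤ C)
    (hb : Filter.Tendsto (fun n => ‖innerDerivation (b n)‖) Filter.atTop (nhds 0)) :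
    Filter.Tendsto (fun n => b n * a n - a n * b n) Filter.atTop (nhds 0) := by
  obtain ⟨C, hC⟩ := ha
  have h := hb.mul_const C
  rw [zero_mul] at h
  exact squeeze_zero_norm (fun n => (norm_commutator_le _ _).trans
    (mul_le_mul_of_nonneg_left (hC n) (norm_nonneg _))) h

theorem innerDerivation_smul (c : ℂ) (a : A) :
    innerDerivation (c • a) = c • innerDerivation a := by
  ext x
  simp [innerDerivation_apply, smul_sub]

theorem innerDerivation_sub_of_mem_center (a : A) {z : A} (hz : z ∈ Set.center A) :
    innerDerivation (a - z) = innerDerivation a := by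
  ext x
  have h : z * x = x * z := (Set.mem_center_iff.1 hz).comm x
  simp only [innerDerivation_apply, mul_sub, sub_mul, h]
  abel

theorem sub_mem_set_center {y z : A} (hy : y ∈ Set.center A) (hz : z ∈ Set.center A) :
    y - z ∈ Set.center A :=
  (Subring.center A).sub_mem hy hz

theorem smul_mem_set_center (c : ℂ) {z : A} (hz : z ∈ Set.center A) :
    c • z ∈ Set.center A :=
  (Subalgebra.center ℂ A).smul_mem hz c

/-- An element violating the distance estimate with constant `K` can be normalised to have norm
at most `2`, distance at least `1` from the centre and inner derivation of norm at most `1 / K`. -/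
theorem exists_normalized {K : ℝ} (hK : 0 < K) {a : A}
    (ha : K * ‖innerDerivation a‖ < Metric.infDist a (Set.center A)) :
    ∃ b : A, ‖b‖ ≤ 2 ∧ ‖innerDerivation b‖ ≤ 1 / K ∧ ∀ z ∈ Set.center A, 1 ≤ ‖b - z‖ := by
  set d := Metric.infDist a (Set.center A)
  have hd0 : 0 < d := lt_of_le_of_lt (by positivity) ha
  obtain ⟨y, hy, hay⟩ := (Metric.infDist_lt_iff (⟨0, Set.zero_mem_center⟩ :
    (Set.center A).Nonempty)).1 (show Metric.infDist a (Set.center A) < 2 * d by linarith)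
  have hnorm : ‖((d⁻¹ : ℝ) : ℂ)‖ = d⁻¹ := by
    rw [Complex.norm_real, Real.norm_of_nonneg (inv_nonneg.2 hd0.le)]
  refine ⟨((d⁻¹ : ℝ) : ℂ) • (a - y), ?_, ?_, fun z hz => ?_⟩
  · rw [norm_smul, hnorm, ← dist_eq_norm, inv_mul_le_iff₀ hd0]
    linarith
  · rw [innerDerivation_smul, innerDerivation_sub_of_mem_center a hy, norm_smul, hnorm,
      inv_mul_le_iff₀ hd0, mul_one_div, le_div_iff₀ hK]
    linarith
  · have hmem : y - ((-d : ℝ) : ℂ) • z ∈ Set.center A :=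
      sub_mem_set_center hy (smul_mem_set_center _ hz)
    have hle := Metric.infDist_le_dist_of_mem (x := a) hmem
    have heq : ((d⁻¹ : ℝ) : ℂ) • (a - y) - z =
        ((d⁻¹ : ℝ) : ℂ) • (a - (y - ((-d : ℝ) : ℂ) • z)) := by
      have h1 : ((d⁻¹ : ℝ) : ℂ) • ((d : ℝ) : ℂ) • z = z := by
        rw [smul_smul, ← Complex.ofReal_mul, inv_mul_cancel₀ hd0.ne', Complex.ofReal_one,
          one_smul]
      rw [Complex.ofReal_neg, neg_smul, sub_neg_eq_add, ← sub_sub, smul_sub _ (a - y), h1]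
    rwa [heq, norm_smul, hnorm, ← dist_eq_norm, le_inv_mul_iff₀ hd0, mul_one]

/-- **Proposition 3.9.**  For a C*-algebra `A`, the centre of `ℓ∞(ℕ, A)/c₀(ℕ, A)` equals the
canonical image of `ℓ∞(ℕ, Z(A))` if and only if `K(A) < ∞`, i.e. there is a constant
`C ∈ [0, ∞)` with `d(a, Z(A)) ≤ C * ‖ad(a)‖` for all `a ∈ A`.  The first condition is stated
explicitly in terms of bounded sequences: a bounded sequence `b` represents a central element
of the quotient iff all commutators `b n * a n - a n * b n` (for bounded `a`) tend to `0`, and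
it represents an element of the image of `ℓ∞(ℕ, Z(A))` iff it differs from a bounded central
sequence by a sequence tending to `0`. -/
theorem center_of_sequence_algebra_iff_K_finite (A : Type*) [CStarAlgebra A] :
    (∀ b : ℕ → A, (∃ C : ℝ, ∀ n, ‖b n‖ ≤ C) →
      ((∀ a : ℕ → A, (∃ C : ℝ, ∀ n, ‖a n‖ ≤ C) →
          Filter.Tendsto (fun n => b n * a n - a n * b n) Filter.atTop (nhds 0)) ↔
       (∃ z : ℕ → A, (∃ C : ℝ, ∀ n, ‖z n‖ ≤ C) ∧ (∀ n, z n ∈ Set.center A) ∧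
          Filter.Tendsto (fun n => b n - z n) Filter.atTop (nhds 0)))) ↔
    (∃ C : ℝ, 0 ≤ C ∧ ∀ a : A, Metric.infDist a (Set.center A) ≤ C * ‖innerDerivation a‖) := by
  constructor
  · intro h
    by_contra! hcon
    have hK (n : ℕ) : (0 : ℝ) < n + 1 := by positivity
    choose a ha using fun n : ℕ => hcon (n + 1) (hK n).le
    choose b hb hb' hbz using fun n : ℕ => exists_normalized (hK n) (ha n)
    have had : Filter.Tendsto (fun n => ‖innerDerivation (b n)‖) Filter.atTop (nhds 0) :=
      squeeze_zero (fun n => norm_nonneg _) hb' tendsto_one_div_add_atTop_nhds_zero_nat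
    obtain ⟨z, -, hz, hlim⟩ := (h b ⟨2, hb⟩).1 fun a ha => tendsto_commutator ha had
    have h1 := ge_of_tendsto' hlim.norm fun n => hbz n (z n) (hz n)
    rw [norm_zero] at h1
    linarith
  · rintro ⟨C, -, hC⟩ b ⟨M, hM⟩
    constructor
    · intro hb
      choose z hz hbz using fun n : ℕ => (Metric.infDist_lt_iff (⟨0, Set.zero_mem_center⟩ :
        (Set.center A).Nonempty)).1
          (lt_add_of_pos_right (Metric.infDist (b n) (Set.center A))
            (Nat.one_div_pos_of_nat (α := ℝ) (n := n)))
      have hlim : Filter.Tendsto (fun n => b n - z n) Filter.atTop (nhds 0) := by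
        have h := ((tendsto_norm_innerDerivation hb).const_mul C).add
          (tendsto_one_div_add_atTop_nhds_zero_nat (𝕜 := ℝ))
        rw [mul_zero, add_zero] at h
        refine squeeze_zero_norm (fun n => ?_) h
        rw [← dist_eq_norm]
        exact (hbz n).le.trans (by gcongr; exact hC _)
      obtain ⟨R, hR⟩ := hlim.norm.bddAbove_range
      refine ⟨z, ⟨M + R, fun n => ?_⟩, hz, hlim⟩
      have hle := norm_sub_le (b n) (b n - z n)
      rw [sub_sub_cancel] at hle
      exact hle.trans (add_le_add (hM n) (hR ⟨n, rfl⟩))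
    · rintro ⟨z, -, hz, hlim⟩ a ha
      refine tendsto_commutator ha ?_
      have h : Filter.Tendsto (fun n => innerDerivation (b n - z n)) Filter.atTop (nhds 0) := by
        have hcont : Continuous (innerDerivation : A → A →L[ℂ] A) := by
          unfold innerDerivation
          fun_prop
        have h0 : innerDerivation (0 : A) = 0 := by simp [innerDerivation]
        simpa [h0, Function.comp_def] using (hcont.tendsto 0).comp hlim
      simpa [innerDerivation_sub_of_mem_center _ (hz _)] using h.norm

end
end

section
/- Let W be a von Neumann algebra and let h ∈ W be a self-adjoint element with finite spectrum. Then there exist central projections e_1, …, e_n in W with e_1 + ⋯ + e_n = 1 and a unitary u ∈ W such that, for each k, ω_{e_k}((h + u h u*)/2) ≤ (1/2)·ω_{e_k}(h). -/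
noncomputable section

variable {H : Type*} [NormedAddCommGroup H] [InnerProductSpace ℂ H] [CompleteSpace H]

/-- The (real) spectrum of the element `x` of the corner `eWe` of a von Neumann algebra `W`
(where `e` is a central projection of `W`, the unit of the corner): the set of `t : ℝ` such
that `x - t • e` is not invertible in the corner `eWe`. -/
def cornerSpectrum (W : VonNeumannAlgebra H) (e x : H →L[ℂ] H) : Set ℝ :=
  {t : ℝ | ¬ ∃ y ∈ W, y = e * y * e ∧ y * (x - t • e) = e ∧ (x - t • e) * y = e}

/-- `ω_e(h)`: the length of the smallest closed interval containing the spectrum of `e * h`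
in the corner `eWe`. -/
def cornerOmega (W : VonNeumannAlgebra H) (e h : H →L[ℂ] H) : ℝ :=
  sSup (cornerSpectrum W e (e * h)) - sInf (cornerSpectrum W e (e * h))

namespace VonNeumannAlgebra

open ContinuousLinearMap

theorem operator_mul_apply {E : Type*} [NormedAddCommGroup E] [InnerProductSpace ℂ E]
    (a b : E →L[ℂ] E) (ξ : E) : (a * b) ξ = a (b ξ) := rfl

theorem mem_of_commutant (W : VonNeumannAlgebra H) {x : H →L[ℂ] H}
    (hx : ∀ y ∈ W.commutant, y * x = x * y) : x ∈ W := by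
  rw [← commutant_commutant W]
  exact mem_commutant_iff.2 hx

theorem commute_of_mem {W : VonNeumannAlgebra H} {x y : H →L[ℂ] H}
    (hx : x ∈ W) (hy : y ∈ W.commutant) : x * y = y * x :=
  mem_commutant_iff.1 hy x hx

theorem smul_mem (W : VonNeumannAlgebra H) (t : ℝ) {x : H →L[ℂ] H} (hx : x ∈ W) : t • x ∈ W := by
  refine W.mem_of_commutant fun y hy => ?_
  rw [mul_smul_comm, smul_mul_assoc, commute_of_mem hx hy]

/-- A subspace of `H × H` which is the graph of an isometry from a subspace of the range of `p` to
a subspace of the range of `q` and is invariant under the commutant of `W`. -/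
structure IsMatchingGraph (W : VonNeumannAlgebra H) (p q : H →L[ℂ] H)
    (G : Submodule ℂ (WithLp 2 (H × H))) : Prop where
  fst_mem : ∀ x ∈ G, p x.fst = x.fst
  snd_mem : ∀ x ∈ G, q x.snd = x.snd
  norm_eq : ∀ x ∈ G, ‖x.fst‖ = ‖x.snd‖
  invariant : ∀ y ∈ W.commutant, ∀ x ∈ G, WithLp.toLp 2 (y x.fst, y x.snd) ∈ G

namespace IsMatchingGraph

variable {W : VonNeumannAlgebra H} {p q : H →L[ℂ] H} {G : Submodule ℂ (WithLp 2 (H × H))}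

theorem bot (W : VonNeumannAlgebra H) (p q : H →L[ℂ] H) : IsMatchingGraph W p q ⊥ := by
  constructor <;> simp +contextual

theorem topologicalClosure (hG : IsMatchingGraph W p q G) :
    IsMatchingGraph W p q G.topologicalClosure := by
  have hf : Continuous fun x : WithLp 2 (H × H) => x.fst := (WithLp.fstL 2 ℂ H H).continuous
  have hs : Continuous fun x : WithLp 2 (H × H) => x.snd := (WithLp.sndL 2 ℂ H H).continuous
  refine ⟨?_, ?_, ?_, ?_⟩
  · exact closure_minimal hG.fst_mem (isClosed_eq (p.continuous.comp hf) hf)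
  · exact closure_minimal hG.snd_mem (isClosed_eq (q.continuous.comp hs) hs)
  · exact closure_minimal hG.norm_eq (isClosed_eq hf.norm hs.norm)
  · intro y hy
    have hc : Continuous fun x : WithLp 2 (H × H) => WithLp.toLp 2 (y x.fst, y x.snd) :=
      (WithLp.prod_continuous_toLp 2 H H).comp
        ((y.continuous.comp hf).prodMk (y.continuous.comp hs))
    exact closure_minimal (fun x hx => subset_closure (hG.invariant y hy x hx))
      (isClosed_closure.preimage hc)

theorem exists_maximal (W : VonNeumannAlgebra H) (p q : H →L[ℂ] H) :
    ∃ G, Maximal (IsMatchingGraph W p q) G := by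
  refine zorn_le₀ {G | IsMatchingGraph W p q G} fun c hc hchain => ?_
  rcases c.eq_empty_or_nonempty with rfl | hne
  · exact ⟨⊥, bot W p q, by simp⟩
  refine ⟨sSup c, ?_, fun z hz => le_sSup hz⟩
  have hmem : ∀ x, x ∈ sSup c ↔ ∃ G ∈ c, x ∈ G := fun x =>
    Submodule.mem_sSup_of_directed hne hchain.directedOn
  refine ⟨?_, ?_, ?_, ?_⟩
  · intro x hx
    obtain ⟨G, hG, hxG⟩ := (hmem x).1 hx
    exact (hc hG).fst_mem x hxG
  · intro x hx
    obtain ⟨G, hG, hxG⟩ := (hmem x).1 hx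
    exact (hc hG).snd_mem x hxG
  · intro x hx
    obtain ⟨G, hG, hxG⟩ := (hmem x).1 hx
    exact (hc hG).norm_eq x hxG
  · intro y hy x hx
    obtain ⟨G, hG, hxG⟩ := (hmem x).1 hx
    exact (hmem _).2 ⟨G, hG, (hc hG).invariant y hy x hxG⟩

/-- A closed matching graph is the graph of a partial isometry in `W`. -/
theorem exists_partialIsometry
    (hG : IsMatchingGraph W p q G) (hcl : IsClosed (G : Set (WithLp 2 (H × H)))) :
    ∃ v ∈ W, p * (star v * v) = star v * v ∧ q * (v * star v) = v * star v ∧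
      v * star v * v = v ∧
      (∀ x ∈ G, (star v * v) x.fst = x.fst ∧ (v * star v) x.snd = x.snd) := by
  have : CompleteSpace G := hcl.completeSpace_coe
  let i : G →L[ℂ] H := WithLp.fstL 2 ℂ H H ∘L G.subtypeL
  let j : G →L[ℂ] H := WithLp.sndL 2 ℂ H H ∘L G.subtypeL
  have hi : ∀ g : G, i g = (g : WithLp 2 (H × H)).fst := fun g => rfl
  have hj : ∀ g : G, j g = (g : WithLp 2 (H × H)).snd := fun g => rfl
  have hpi : p ∘L i = i := by ext g; exact hG.fst_mem g g.2
  have hqj : q ∘L j = j := by ext g; exact hG.snd_mem g g.2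
  have half : ∀ k : G →L[ℂ] H, (∀ g, 2 * ‖k g‖ ^ 2 = ‖g‖ ^ 2) →
      (2 : ℂ) • (adjoint k ∘L k) = ContinuousLinearMap.id ℂ G := by
    intro k hk
    refine coe_injective ((ext_inner_map _ _).1 fun g => ?_)
    refine (inner_smul_left (adjoint k (k g)) g (2 : ℂ)).trans ?_
    refine Eq.trans ?_ (inner_self_eq_norm_sq_to_K (𝕜 := ℂ) g).symm
    rw [adjoint_inner_left, inner_self_eq_norm_sq_to_K, map_ofNat]
    have := congrArg (fun t : ℝ => (t : ℂ)) (hk g)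
    push_cast at this
    exact this
  have hnorm : ∀ g : G, ‖g‖ ^ 2 = ‖i g‖ ^ 2 + ‖j g‖ ^ 2 := fun g =>
    WithLp.prod_norm_sq_eq_of_L2 (g : WithLp 2 (H × H))
  have hij : ∀ g : G, ‖i g‖ = ‖j g‖ := fun g => hG.norm_eq g g.2
  have hii := half i fun g => by rw [hnorm, ← hij]; ring
  have hjj := half j fun g => by rw [hnorm, hij]; ring
  have hii' : ∀ g, (2 : ℂ) • adjoint i (i g) = g := fun g => by
    simpa using congr($hii g)
  have hjj' : ∀ g, (2 : ℂ) • adjoint j (j g) = g := fun g => by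
    simpa using congr($hjj g)
  let v : H →L[ℂ] H := (2 : ℂ) • (j ∘L adjoint i)
  have hv : ∀ x, v x = (2 : ℂ) • j (adjoint i x) := fun x => rfl
  have hsv : ∀ x, star v x = (2 : ℂ) • i (adjoint j x) := by
    intro x
    have : star v = (2 : ℂ) • (i ∘L adjoint j) := by
      simp [v, star_eq_adjoint, adjoint_comp]
    rw [this]; rfl
  have hsvv : ∀ x, (star v * v) x = (2 : ℂ) • i (adjoint i x) := by
    intro x
    rw [operator_mul_apply, hv, hsv, map_smul, map_smul, ← map_smul i, hjj']
  have hvsv : ∀ x, (v * star v) x = (2 : ℂ) • j (adjoint j x) := by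
    intro x
    rw [operator_mul_apply, hsv, hv, map_smul, map_smul, ← map_smul j, hii']
  refine ⟨v, ?_, ?_, ?_, ?_, ?_⟩
  · refine W.mem_of_commutant fun y hy => ?_
    have hres : ∀ y ∈ W.commutant, ∀ g : G, ∃ g' : G, i g' = y (i g) ∧ j g' = y (j g) :=
      fun y hy g => ⟨⟨_, hG.invariant y hy g g.2⟩, rfl, rfl⟩
    ext x
    obtain ⟨g', hg₁, hg₂⟩ := hres y hy (adjoint i x)
    have key : adjoint i (y x) = g' := by
      refine ext_inner_right ℂ fun g => ?_
      obtain ⟨g'', hg₃, hg₄⟩ := hres (star y) (star_mem hy) g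
      have h1 : inner ℂ g' g = inner ℂ (i g') (i g) + inner ℂ (j g') (j g) :=
        WithLp.prod_inner_apply (g' : WithLp 2 (H × H)) g
      have h2 : inner ℂ (adjoint i x) g'' =
          inner ℂ (i (adjoint i x)) (i g'') + inner ℂ (j (adjoint i x)) (j g'') :=
        WithLp.prod_inner_apply ((adjoint i x : G) : WithLp 2 (H × H)) g''
      rw [hg₃, hg₄, star_eq_adjoint, adjoint_inner_right, adjoint_inner_right, ← hg₁, ← hg₂,
        ← h1, adjoint_inner_left, hg₃, star_eq_adjoint, adjoint_inner_right] at h2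
      rw [adjoint_inner_left, h2]
    rw [operator_mul_apply, operator_mul_apply, hv, hv, key, hg₂, map_smul]
  · ext x
    rw [operator_mul_apply, hsvv, map_smul]
    exact congr((2 : ℂ) • $hpi (adjoint i x))
  · ext x
    rw [operator_mul_apply, hvsv, map_smul]
    exact congr((2 : ℂ) • $hqj (adjoint j x))
  · ext x
    rw [operator_mul_apply, hvsv, hv, map_smul, hjj']
  · intro x hx
    rw [hsvv, hvsv, ← hi ⟨x, hx⟩, ← hj ⟨x, hx⟩, ← map_smul i, ← map_smul j, hii', hjj']
    exact ⟨rfl, rfl⟩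

end IsMatchingGraph

/-- **Comparison theorem** for projections: up to the part matched by a partial isometry `v`, the
projection `q` vanishes on the central projection `e` and `p` vanishes on `1 - e`. -/
theorem exists_comparison (W : VonNeumannAlgebra H) {p q : H →L[ℂ] H}
    (hpW : p ∈ W) (hqW : q ∈ W) (hp : IsStarProjection p) (hq : IsStarProjection q) :
    ∃ e v : H →L[ℂ] H, e ∈ W ∧ IsStarProjection e ∧ (∀ x ∈ W, e * x = x * e) ∧ v ∈ W ∧
      v * star v * v = v ∧ p * (star v * v) = star v * v ∧ q * (v * star v) = v * star v ∧
      e * q = e * (v * star v) ∧ (1 - e) * p = (1 - e) * (star v * v) := by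
  obtain ⟨G, hmax⟩ := IsMatchingGraph.exists_maximal W p q
  have hG := hmax.prop
  have hcl : IsClosed (G : Set (WithLp 2 (H × H))) := by
    have := hmax.eq_of_ge hG.topologicalClosure G.le_topologicalClosure
    rw [← this]
    exact G.isClosed_topologicalClosure
  obtain ⟨v, hvW, hpv, hqv, hv, hGv⟩ := hG.exists_partialIsometry hcl
  have hsvW : star v ∈ W := star_mem hvW
  set p' := p - star v * v with hp'
  set q' := q - v * star v with hq'
  have hp'W : p' ∈ W := sub_mem hpW (mul_mem hsvW hvW)
  have hq'W : q' ∈ W := sub_mem hqW (mul_mem hvW hsvW)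
  have hp's : star p' = p' := by simp [hp', hp.isSelfAdjoint.star_eq]
  have hq's : star q' = q' := by simp [hq', hq.isSelfAdjoint.star_eq]
  have hp'p : p * p' = p' := by rw [hp', mul_sub, hp.isIdempotentElem.eq, hpv]
  have hq'q : q * q' = q' := by rw [hq', mul_sub, hq.isIdempotentElem.eq, hqv]
  have hp'p' : p' * p' = p' := by
    have h1 : star v * v * p' = 0 := by
      have := congr(star $hpv)
      simp only [star_mul, star_star, hp.isSelfAdjoint.star_eq] at this
      rw [hp', mul_sub, this, ← mul_assoc, mul_assoc (star v), mul_assoc (star v), hv, sub_self]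
    rw [hp', sub_mul, ← hp', hp'p, h1, sub_zero]
  have hq'q' : q' * q' = q' := by
    have h1 : v * star v * q' = 0 := by
      have := congr(star $hqv)
      simp only [star_mul, star_star, hq.isSelfAdjoint.star_eq] at this
      rw [hq', mul_sub, this, ← mul_assoc, hv, sub_self]
    rw [hq', sub_mul, ← hq', hq'q, h1, sub_zero]
  have hfst : ∀ x ∈ G, p' x.fst = 0 := fun x hx => by
    rw [hp', sub_apply, hG.fst_mem x hx, (hGv x hx).1, sub_self]
  have hsnd : ∀ x ∈ G, q' x.snd = 0 := fun x hx => by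
    rw [hq', sub_apply, hG.snd_mem x hx, (hGv x hx).2, sub_self]
  have adj : ∀ {r : H →L[ℂ] H} (_ : star r = r) (x y : H), inner ℂ (r x) y = inner ℂ x (r y) :=
    fun {r} hr x y => by
      conv_lhs => rw [← hr, star_eq_adjoint, adjoint_inner_left]
  have hzero : ∀ x ∈ W, q' * x * p' = 0 := by
    intro x hx
    set y := q' * x * p' with hy
    have hyW : y ∈ W := mul_mem (mul_mem hq'W hx) hp'W
    set a := CFC.abs y with ha
    have haa : a * a = star y * y := CFC.abs_mul_abs y
    have has : star a = a := (CFC.abs_nonneg y).isSelfAdjoint.star_eq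
    have haW : a ∈ W := W.mem_of_commutant fun z hz =>
      (Commute.cfcAbs_left (a := y) (b := z) (commute_of_mem hyW hz)
        (commute_of_mem hyW (star_mem hz))).symm.eq
    have hnorm : ∀ ξ, ‖a ξ‖ = ‖y ξ‖ := by
      intro ξ
      have h1 : inner ℂ (a ξ) (a ξ) = inner ℂ (y ξ) (y ξ) := by
        rw [adj has, ← operator_mul_apply a, haa, operator_mul_apply, star_eq_adjoint,
          adjoint_inner_right]
      rw [inner_self_eq_norm_sq_to_K, inner_self_eq_norm_sq_to_K] at h1
      have h2 : ‖a ξ‖ ^ 2 = ‖y ξ‖ ^ 2 := by exact_mod_cast h1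
      exact (sq_eq_sq₀ (norm_nonneg _) (norm_nonneg _)).1 h2
    have hyp : y * p' = y := by rw [hy, mul_assoc, hp'p']
    have hqy : q' * y = y := by rw [hy, ← mul_assoc, ← mul_assoc, hq'q']
    have hap : a * p' = a := by
      ext ξ
      have : ‖a (p' ξ - ξ)‖ = 0 := by
        rw [hnorm, map_sub, ← operator_mul_apply y, hyp, sub_self, norm_zero]
      rw [norm_eq_zero, map_sub, sub_eq_zero] at this
      exact this
    have hpa : p' * a = a := by simpa [has, hp's] using congr(star $hap)
    have hpa' : ∀ ξ, p' (a ξ) = a ξ := fun ξ => congr($hpa ξ)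
    have hqy' : ∀ ξ, q' (y ξ) = y ξ := fun ξ => congr($hqy ξ)
    let T : H →ₗ[ℂ] WithLp 2 (H × H) :=
      (WithLp.linearEquiv 2 ℂ (H × H)).symm.toLinearMap ∘ₗ
        (a : H →ₗ[ℂ] H).prod (y : H →ₗ[ℂ] H)
    have hTf : ∀ ξ, (T ξ).fst = a ξ := fun ξ => rfl
    have hTs : ∀ ξ, (T ξ).snd = y ξ := fun ξ => rfl
    have hG' : IsMatchingGraph W p q (G ⊔ LinearMap.range T) := by
      refine ⟨?_, ?_, ?_, ?_⟩ <;> simp only [Submodule.mem_sup, LinearMap.mem_range]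
      · rintro _ ⟨g, hg, _, ⟨ξ, rfl⟩, rfl⟩
        rw [WithLp.add_fst, map_add, hG.fst_mem g hg, hTf, ← hpa', ← operator_mul_apply p, hp'p]
      · rintro _ ⟨g, hg, _, ⟨ξ, rfl⟩, rfl⟩
        rw [WithLp.add_snd, map_add, hG.snd_mem g hg, hTs, ← hqy', ← operator_mul_apply q, hq'q]
      · rintro _ ⟨g, hg, _, ⟨ξ, rfl⟩, rfl⟩
        have h1 : inner ℂ g.fst (a ξ) = 0 := by
          rw [← hpa', ← adj hp's, hfst g hg, inner_zero_left]
        have h2 : inner ℂ g.snd (y ξ) = 0 := by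
          rw [← hqy', ← adj hq's, hsnd g hg, inner_zero_left]
        have h3 := norm_add_sq_eq_norm_sq_add_norm_sq_of_inner_eq_zero _ _ h1
        have h4 := norm_add_sq_eq_norm_sq_add_norm_sq_of_inner_eq_zero _ _ h2
        rw [WithLp.add_fst, WithLp.add_snd, hTf, hTs]
        rw [hnorm, hG.norm_eq g hg, ← h4] at h3
        exact (mul_self_inj (norm_nonneg _) (norm_nonneg _)).1 h3
      · rintro z hz _ ⟨g, hg, _, ⟨ξ, rfl⟩, rfl⟩
        refine ⟨_, hG.invariant z hz g hg, _, ⟨z ξ, rfl⟩, ?_⟩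
        have e1 : a (z ξ) = z (a ξ) := congr($(commute_of_mem haW hz) ξ)
        have e2 : y (z ξ) = z (y ξ) := congr($(commute_of_mem hyW hz) ξ)
        refine (WithLp.ofLp_injective 2) (Prod.ext ?_ ?_)
        · change z g.fst + a (z ξ) = z (g.fst + a ξ)
          rw [e1, map_add]
        · change z g.snd + y (z ξ) = z (g.snd + y ξ)
          rw [e2, map_add]
    have hle : G ⊔ LinearMap.range T ≤ G := hmax.le_of_ge hG' le_sup_left
    ext ξ
    have hTG : T ξ ∈ G := hle (Submodule.mem_sup_right ⟨ξ, rfl⟩)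
    rw [← hqy, operator_mul_apply, ← hTs, hsnd _ hTG, zero_apply]
  let K : Submodule ℂ H := ⨅ x : W, LinearMap.ker ((q' * (x : H →L[ℂ] H) : H →L[ℂ] H) : H →ₗ[ℂ] H)
  have hK : ∀ ξ, ξ ∈ K ↔ ∀ x ∈ W, q' (x ξ) = 0 := by
    intro ξ
    simp [K]
  have hKcl : IsClosed (K : Set H) := by
    have : (K : Set H) = ⋂ x : W, {ξ | q' ((x : H →L[ℂ] H) ξ) = 0} := by
      ext ξ; simp [hK]
    rw [this]
    exact isClosed_iInter fun x => isClosed_eq (q'.continuous.comp x.val.continuous) continuous_const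
  have : CompleteSpace K := hKcl.completeSpace_coe
  set e := K.starProjection with he_def
  have he : IsStarProjection e := isStarProjection_starProjection
  have heK : ∀ ξ, e ξ ∈ K := fun ξ => K.starProjection_apply_mem ξ
  have heW : e ∈ W := by
    rw [IsStarProjection.mem_iff he]
    intro y hy
    rw [he_def, Submodule.range_starProjection, Module.End.mem_invtSubmodule]
    intro ξ hξ
    rw [hK] at hξ
    refine (hK _).2 fun x hx => ?_
    have e1 : (q' * x) (y ξ) = y ((q' * x) ξ) := congr($(commute_of_mem (mul_mem hq'W hx) hy) ξ)
    change (q' * x) (y ξ) = 0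
    rw [e1, operator_mul_apply, hξ x hx, map_zero]
  have heW' : e ∈ W.commutant := by
    rw [IsStarProjection.mem_iff he, commutant_commutant]
    intro y hy
    rw [he_def, Submodule.range_starProjection, Module.End.mem_invtSubmodule]
    intro ξ hξ
    rw [hK] at hξ
    exact (hK _).2 fun x hx => hξ (x * y) (mul_mem hx hy)
  have hep : e * p' = p' := by
    ext ξ
    refine Submodule.starProjection_eq_self_iff.2 ((hK _).2 fun x hx => ?_)
    exact congr($(hzero x hx) ξ)
  have hqe : q' * e = 0 := by
    ext ξ
    exact (hK _).1 (heK ξ) 1 (one_mem W)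
  refine ⟨e, v, heW, he, fun x hx => (commute_of_mem hx heW').symm, hvW, hv, hpv, hqv, ?_, ?_⟩
  · rw [← sub_eq_zero, ← mul_sub, ← hq', ← commute_of_mem hq'W heW', hqe]
  · rw [← sub_eq_zero, ← mul_sub, ← hp', sub_mul, one_mul, hep, sub_self]

theorem mul_eq_zero_of_mul_sq_eq_zero {w x : H →L[ℂ] H} (hw : star w = w)
    (h : x * (w * w) = 0) : x * w = 0 := by
  rw [← CStarRing.mul_star_self_eq_zero_iff, star_mul, hw, mul_assoc, ← mul_assoc w, ← mul_assoc,
    h, zero_mul]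

theorem IsStarProjection.mul_eq_of_mul_eq {p q : H →L[ℂ] H} (hp : IsStarProjection p)
    (hq : IsStarProjection q) (h : p * q = q) : q * p = q := by
  simpa [hp.isSelfAdjoint.star_eq, hq.isSelfAdjoint.star_eq] using congr(star $h)

theorem isStarProjection_star_mul_self {v : H →L[ℂ] H} (hv : v * star v * v = v) :
    IsStarProjection (star v * v) where
  isIdempotentElem := by
    rw [IsIdempotentElem, mul_assoc, ← mul_assoc v, hv]
  isSelfAdjoint := .star_mul_self v

theorem isStarProjection_mul_star_self {v : H →L[ℂ] H} (hv : v * star v * v = v) :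
    IsStarProjection (v * star v) where
  isIdempotentElem := by
    rw [IsIdempotentElem, ← mul_assoc, hv]
  isSelfAdjoint := .mul_star_self v

/-- A family of mutually orthogonal projections of `W` indexed by a finite set. -/
structure IsOrthogonalFamily (W : VonNeumannAlgebra H) (S : Finset ℝ) (g : ℝ → H →L[ℂ] H) :
    Prop where
  mem : ∀ i ∈ S, g i ∈ W
  proj : ∀ i ∈ S, IsStarProjection (g i)
  orth : ∀ i ∈ S, ∀ j ∈ S, i ≠ j → g i * g j = 0

/-- The family `g` with `r` subtracted from its member `g d`. -/
def shrink {M : Type*} [AddCommGroup M] (g : ℝ → M) (d : ℝ) (r : M) (i : ℝ) : M :=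
  g i - if i = d then r else 0

theorem sum_shrink {M : Type*} [AddCommGroup M] {S : Finset ℝ} {g : ℝ → M} {c d : ℝ} {r : M}
    (hc : c ∈ S) (hd : d ∈ S) (hcd : d ≠ c) :
    ∑ i ∈ S.erase c, shrink g d r i = ∑ i ∈ S, g i - g c - r := by
  simp only [shrink, Finset.sum_sub_distrib, Finset.sum_ite_eq', Finset.mem_erase, hd, hcd,
    ne_eq, not_false_eq_true, and_self, if_true]
  rw [Finset.sum_erase_eq_sub hc]

namespace IsOrthogonalFamily

variable {W : VonNeumannAlgebra H} {S : Finset ℝ} {g : ℝ → H →L[ℂ] H} {c d : ℝ} {r : H →L[ℂ] H}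

theorem mul_eq_zero_of_le (hg : IsOrthogonalFamily W S g) (hr : IsStarProjection r) (hd : d ∈ S)
    (hdr : g d * r = r) :
    ∀ i ∈ S, i ≠ d → g i * r = 0 ∧ r * g i = 0 := by
  intro i hi hid
  have hrd := IsStarProjection.mul_eq_of_mul_eq (hg.proj d hd) hr hdr
  constructor
  · rw [← hdr, ← mul_assoc, hg.orth i hi d hd hid, zero_mul]
  · rw [← hrd, mul_assoc, hg.orth d hd i hi hid.symm, mul_zero]

theorem shrink (hg : IsOrthogonalFamily W S g) (hrW : r ∈ W) (hr : IsStarProjection r) (hd : d ∈ S)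
    (hdr : g d * r = r) :
    IsOrthogonalFamily W (S.erase c) (shrink g d r) := by
  have hrd := IsStarProjection.mul_eq_of_mul_eq (hg.proj d hd) hr hdr
  have hz := hg.mul_eq_zero_of_le hr hd hdr
  refine ⟨fun i hi => ?_, fun i hi => ?_, fun i hi j hj hij => ?_⟩
  · have hi := Finset.mem_of_mem_erase hi
    unfold VonNeumannAlgebra.shrink
    split_ifs
    · exact sub_mem (hg.mem i hi) hrW
    · exact sub_mem (hg.mem i hi) (zero_mem W)
  · have hi := Finset.mem_of_mem_erase hi
    unfold VonNeumannAlgebra.shrink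
    split_ifs with h
    · subst h
      exact hr.sub_of_mul_eq_left (hg.proj i hi) hrd
    · rw [sub_zero]
      exact hg.proj i hi
  · have hi := Finset.mem_of_mem_erase hi
    have hj := Finset.mem_of_mem_erase hj
    have hgij := hg.orth i hi j hj hij
    unfold VonNeumannAlgebra.shrink
    split_ifs with h h' h'
    · exact absurd (h.trans h'.symm) hij
    · rw [sub_zero, sub_mul, hgij, (hz j hj h').2, sub_zero]
    · rw [sub_zero, mul_sub, hgij, (hz i hi h).1, sub_zero]
    · rw [sub_zero, sub_zero, hgij]

theorem mul_sum_shrink (hg : IsOrthogonalFamily W S g) (hr : IsStarProjection r) (hc : c ∈ S)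
    (hd : d ∈ S) (hcd : d ≠ c) (hdr : g d * r = r) :
    g c * ∑ i ∈ S.erase c, VonNeumannAlgebra.shrink g d r i = 0 ∧
      r * ∑ i ∈ S.erase c, VonNeumannAlgebra.shrink g d r i = 0 := by
  have hrd := IsStarProjection.mul_eq_of_mul_eq (hg.proj d hd) hr hdr
  have hz := hg.mul_eq_zero_of_le hr hd hdr
  constructor <;> rw [Finset.mul_sum] <;> refine Finset.sum_eq_zero fun i hi => ?_ <;>
    obtain ⟨hic, hi⟩ := Finset.mem_erase.1 hi <;> unfold VonNeumannAlgebra.shrink <;>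
    split_ifs with h
  · rw [mul_sub, hg.orth c hc i hi hic.symm, (hz c hc hcd.symm).1, sub_zero]
  · rw [sub_zero, hg.orth c hc i hi hic.symm]
  · rw [mul_sub, h, hrd, hr.isIdempotentElem.eq, sub_self]
  · rw [sub_zero, (hz i hi h).2]

/-- A symmetry of the shrunk family vanishes on the removed parts, hence compresses to the members
of `g` as it does to those of the shrunk family. -/
theorem compression_eq_shrink (hg : IsOrthogonalFamily W S g) (hr : IsStarProjection r) (hc : c ∈ S)
    (hd : d ∈ S) (hcd : d ≠ c) (hdr : g d * r = r) {w : H →L[ℂ] H} (hw : star w = w)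
    (hww : w * w = ∑ i ∈ S.erase c, VonNeumannAlgebra.shrink g d r i) :
    (g c * w = 0 ∧ w * g c = 0) ∧ (r * w = 0 ∧ w * r = 0) ∧
      ∀ i j, g i * w * g j =
        VonNeumannAlgebra.shrink g d r i * w * VonNeumannAlgebra.shrink g d r j := by
  obtain ⟨h1, h2⟩ := hg.mul_sum_shrink hr hc hd hcd hdr
  rw [← hww] at h1 h2
  have h3 := mul_eq_zero_of_mul_sq_eq_zero hw h1
  have h4 := mul_eq_zero_of_mul_sq_eq_zero hw h2
  have h5 : w * g c = 0 := by
    simpa [hw, (hg.proj c hc).isSelfAdjoint.star_eq] using congr(star $h3)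
  have h6 : w * r = 0 := by simpa [hw, hr.isSelfAdjoint.star_eq] using congr(star $h4)
  refine ⟨⟨h3, h5⟩, ⟨h4, h6⟩, fun i j => ?_⟩
  have h7 : VonNeumannAlgebra.shrink g d r i * w = g i * w := by
    unfold VonNeumannAlgebra.shrink
    split_ifs <;> simp [sub_mul, h4]
  have h8 : w * VonNeumannAlgebra.shrink g d r j = w * g j := by
    unfold VonNeumannAlgebra.shrink
    split_ifs <;> simp [mul_sub, h6]
  rw [h7, mul_assoc, mul_assoc, h8]

/-- The symmetry matches the low members of the family with the high ones, central summand by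
central summand, around a median index. -/
theorem exists_matching {n : ℕ} : ∀ {S : Finset ℝ} {g : ℝ → H →L[ℂ] H}, S.card = n + 1 →
    IsOrthogonalFamily W S g →
    ∃ w ∈ W, star w = w ∧ w * w = ∑ i ∈ S, g i ∧
      ∃ (ι : Type) (_ : Fintype ι) (E : ι → H →L[ℂ] H),
        (∀ k, E k ∈ W ∧ IsStarProjection (E k) ∧ ∀ x ∈ W, E k * x = x * E k) ∧
        ∑ k, E k = 1 ∧
        ∀ k, ∃ m ∈ S, ∀ i ∈ S, ∀ j ∈ S, (i < m ∧ j < m ∨ m < i ∧ m < j) →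
          E k * (g i * w * g j) = 0 := by
  induction n with
  | zero =>
    intro S g hS hg
    obtain ⟨a, rfl⟩ := Finset.card_eq_one.1 hS
    have ha := hg.proj a (by simp)
    refine ⟨g a, hg.mem a (by simp), ha.isSelfAdjoint.star_eq, by simp [ha.isIdempotentElem.eq],
      Unit, inferInstance, fun _ => 1, fun _ => ⟨one_mem W, .one _, by simp⟩, by simp,
      fun _ => ⟨a, by simp, ?_⟩⟩
    rintro i hi j hj h
    rw [Finset.mem_singleton] at hi hj
    subst hi hj
    simp at h
  | succ n ih =>
    intro S g hS hg
    have hne : S.Nonempty := Finset.card_pos.1 (by omega)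
    obtain ⟨a, haS, ha⟩ := S.exists_min_image id hne
    obtain ⟨b, hbS, hb⟩ := S.exists_max_image id hne
    simp only [id] at ha hb
    have hab : a ≠ b := by
      rintro rfl
      have : S ⊆ {a} := fun x hx => Finset.mem_singleton.2 (le_antisymm (hb x hx) (ha x hx))
      have := Finset.card_le_card this
      rw [Finset.card_singleton] at this
      omega
    obtain ⟨e, v, heW, he, hec, hvW, hv, hav, hbv, heb, hea⟩ :=
      W.exists_comparison (hg.mem a haS) (hg.mem b hbS) (hg.proj a haS) (hg.proj b hbS)
    have hsvW : star v ∈ W := star_mem hvW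
    set f := star v * v with hf
    set f' := v * star v with hf'
    have hfp : IsStarProjection f := isStarProjection_star_mul_self hv
    have hfp' : IsStarProjection f' := isStarProjection_mul_star_self hv
    have hfW : f ∈ W := mul_mem hsvW hvW
    have hfW' : f' ∈ W := mul_mem hvW hsvW
    obtain ⟨w₁, hw₁W, hw₁, hw₁s, ι₁, _, E₁, hE₁, hE₁s, hm₁⟩ :=
      ih (by rw [Finset.card_erase_of_mem hbS]; omega) (hg.shrink (c := b) hfW hfp haS hav)
    obtain ⟨w₂, hw₂W, hw₂, hw₂s, ι₂, _, E₂, hE₂, hE₂s, hm₂⟩ :=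
      ih (by rw [Finset.card_erase_of_mem haS]; omega) (hg.shrink (c := a) hfW' hfp' hbS hbv)
    obtain ⟨⟨hbw₁, hw₁b⟩, ⟨hfw₁, hw₁f⟩, hc₁⟩ :=
      hg.compression_eq_shrink hfp hbS haS hab hav hw₁ hw₁s
    obtain ⟨⟨haw₂, hw₂a⟩, ⟨hfw₂, hw₂f⟩, hc₂⟩ :=
      hg.compression_eq_shrink hfp' haS hbS hab.symm hbv hw₂ hw₂s
    rw [sum_shrink hbS haS hab] at hw₁s
    rw [sum_shrink haS hbS hab.symm] at hw₂s
    have hvf : v * f = v := by rw [hf, ← mul_assoc, ← hf', hv]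
    have hfv : f' * v = v := hv
    have hbv' : g b * v = v := by rw [← hfv, ← mul_assoc, hbv]
    have hva : v * g a = v := by
      rw [← hvf, mul_assoc, IsStarProjection.mul_eq_of_mul_eq (hg.proj a haS) hfp hav]
    have hsv : f * star v = star v := by
      simpa [hfp.isSelfAdjoint.star_eq] using congr(star $hvf)
    have hsv' : star v * f' = star v := by
      simpa [hfp'.isSelfAdjoint.star_eq] using congr(star $hfv)
    have hsvb : star v * g b = star v := by
      simpa [(hg.proj b hbS).isSelfAdjoint.star_eq] using congr(star $hbv')
    have hasv : g a * star v = star v := by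
      simpa [(hg.proj a haS).isSelfAdjoint.star_eq] using congr(star $hva)
    have hvv : v * v = 0 := by
      rw [← hva, ← hbv', mul_assoc, ← mul_assoc (g a), ← mul_assoc (g a), hg.orth a haS b hbS hab]
      simp
    have hsvv : star v * star v = 0 := by simpa using congr(star $hvv)
    have x1 : v * w₁ = 0 := by rw [← hvf, mul_assoc, hfw₁, mul_zero]
    have x2 : star v * w₁ = 0 := by rw [← hsvb, mul_assoc, hbw₁, mul_zero]
    have x3 : w₁ * v = 0 := by rw [← hbv', ← mul_assoc, hw₁b, zero_mul]
    have x4 : w₁ * star v = 0 := by rw [← hsv, ← mul_assoc, hw₁f, zero_mul]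
    have y1 : v * w₂ = 0 := by rw [← hva, mul_assoc, haw₂, mul_zero]
    have y2 : star v * w₂ = 0 := by rw [← hsv', mul_assoc, hfw₂, mul_zero]
    have y3 : w₂ * v = 0 := by rw [← hfv, ← mul_assoc, hw₂f, zero_mul]
    have y4 : w₂ * star v = 0 := by rw [← hasv, ← mul_assoc, hw₂a, zero_mul]
    have hee : e * e = e := he.isIdempotentElem.eq
    have hes : star e = e := he.isSelfAdjoint.star_eq
    have he' : IsStarProjection (1 - e) := he.one_sub
    have hec' : ∀ x ∈ W, (1 - e) * x = x * (1 - e) := fun x hx => by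
      rw [sub_mul, mul_sub, hec x hx, one_mul, mul_one]
    have he'W : 1 - e ∈ W := sub_mem (one_mem W) heW
    have hgv : ∀ i ∈ S, ∀ j ∈ S, ¬ (i = b ∧ j = a) → g i * v * g j = 0 := by
      intro i hi j hj hij
      rw [← hbv', ← hva, ← mul_assoc, ← mul_assoc, mul_assoc _ (g a)]
      by_cases h : i = b
      · rw [hg.orth a haS j hj fun h' => hij ⟨h, h'.symm⟩, mul_zero]
      · rw [hg.orth i hi b hbS h, zero_mul, zero_mul]
    have hgsv : ∀ i ∈ S, ∀ j ∈ S, ¬ (i = a ∧ j = b) → g i * star v * g j = 0 := by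
      intro i hi j hj hij
      simpa [(hg.proj i hi).isSelfAdjoint.star_eq, (hg.proj j hj).isSelfAdjoint.star_eq,
        mul_assoc] using congr(star $(hgv j hj i hi fun h => hij h.symm))
    refine ⟨v + star v + e * w₁ + (1 - e) * w₂, ?_, ?_, ?_, ι₁ ⊕ ι₂, inferInstance,
      Sum.elim (fun k => e * E₁ k) (fun k => (1 - e) * E₂ k), ?_, ?_, ?_⟩
    · exact add_mem (add_mem (add_mem hvW hsvW) (mul_mem heW hw₁W)) (mul_mem he'W hw₂W)
    · simp only [star_add, star_mul, star_star, hw₁, hw₂, hes, star_sub, star_one]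
      rw [hec w₁ hw₁W, hec' w₂ hw₂W, add_comm (star v)]
    · have z1 : v * (e * w₁) = 0 := by rw [← mul_assoc, ← hec v hvW, mul_assoc, x1, mul_zero]
      have z2 : star v * (e * w₁) = 0 := by
        rw [← mul_assoc, ← hec _ hsvW, mul_assoc, x2, mul_zero]
      have z3 : v * ((1 - e) * w₂) = 0 := by
        rw [← mul_assoc, ← hec' v hvW, mul_assoc, y1, mul_zero]
      have z4 : star v * ((1 - e) * w₂) = 0 := by
        rw [← mul_assoc, ← hec' _ hsvW, mul_assoc, y2, mul_zero]
      have z5 : e * w₁ * (e * w₁) = e * (∑ i ∈ S, g i - g b - f) := by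
        rw [mul_assoc, ← mul_assoc w₁, ← hec w₁ hw₁W, mul_assoc, ← mul_assoc e, hee, hw₁s]
      have z6 : (1 - e) * w₂ * ((1 - e) * w₂) = (1 - e) * (∑ i ∈ S, g i - g a - f') := by
        rw [mul_assoc, ← mul_assoc w₂, ← hec' w₂ hw₂W, mul_assoc, ← mul_assoc (1 - e),
          he'.isIdempotentElem.eq, hw₂s]
      have z7 : e * w₁ * ((1 - e) * w₂) = 0 := by
        rw [mul_assoc, ← mul_assoc w₁, ← hec' w₁ hw₁W, mul_assoc, ← mul_assoc e,
          he.mul_one_sub_self, zero_mul]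
      have z8 : (1 - e) * w₂ * (e * w₁) = 0 := by
        rw [mul_assoc, ← mul_assoc w₂, ← hec w₂ hw₂W, mul_assoc, ← mul_assoc (1 - e),
          he.one_sub_mul_self, zero_mul]
      simp only [add_mul, mul_add, hvv, hsvv, z1, z2, z3, z4, z5, z6, z7, z8, ← hf, ← hf',
        mul_assoc e w₁ v, mul_assoc e w₁ (star v), mul_assoc (1 - e) w₂ v,
        mul_assoc (1 - e) w₂ (star v), x3, x4, y3, y4, mul_zero, add_zero, zero_add]
      simp only [mul_sub, heb, hea]
      noncomm_ring
    · rintro (k | k)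
      · obtain ⟨h1, h2, h3⟩ := hE₁ k
        refine ⟨mul_mem heW h1, he.mul h2 (hec _ h1), fun x hx => ?_⟩
        rw [Sum.elim_inl, mul_assoc, h3 x hx, ← mul_assoc, hec x hx, mul_assoc]
      · obtain ⟨h1, h2, h3⟩ := hE₂ k
        refine ⟨mul_mem he'W h1, he'.mul h2 (hec' _ h1), fun x hx => ?_⟩
        rw [Sum.elim_inr, mul_assoc, h3 x hx, ← mul_assoc, hec' x hx, mul_assoc]
    · simp only [Fintype.sum_sum_type, Sum.elim_inl, Sum.elim_inr, ← Finset.mul_sum, hE₁s, hE₂s]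
      noncomm_ring
    · rintro (k | k)
      · obtain ⟨m, hmS, hm⟩ := hm₁ k
        obtain ⟨hmb, hmS⟩ := Finset.mem_erase.1 hmS
        refine ⟨m, hmS, fun i hi j hj hij => ?_⟩
        have ham := ha m hmS
        have hmb' := lt_of_le_of_ne (hb m hmS) hmb
        have t1 : E₁ k * (g i * w₁ * g j) = 0 := by
          rcases eq_or_ne i b with rfl | hib
          · rw [hbw₁, zero_mul, mul_zero]
          rcases eq_or_ne j b with rfl | hjb
          · rw [mul_assoc (g i), hw₁b, mul_zero, mul_zero]
          rw [hc₁]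
          exact hm i (Finset.mem_erase.2 ⟨hib, hi⟩) j (Finset.mem_erase.2 ⟨hjb, hj⟩) hij
        have t2 : g i * v * g j = 0 := hgv i hi j hj <| by
          rintro ⟨rfl, rfl⟩
          rcases hij with ⟨_, _⟩ | ⟨_, _⟩ <;> linarith
        have t3 : g i * star v * g j = 0 := hgsv i hi j hj <| by
          rintro ⟨rfl, rfl⟩
          rcases hij with ⟨_, _⟩ | ⟨_, _⟩ <;> linarith
        have t4 : e * (g i * ((1 - e) * w₂) * g j) = 0 := by
          rw [← mul_assoc (g i), ← hec' _ (hg.mem i hi), mul_assoc, mul_assoc, ← mul_assoc e,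
            he.mul_one_sub_self, zero_mul]
        have t5 : g i * (e * w₁) * g j = e * (g i * w₁ * g j) := by
          rw [← mul_assoc (g i), ← hec _ (hg.mem i hi)]
          simp only [mul_assoc]
        rw [Sum.elim_inl, ← (hec (E₁ k) (hE₁ k).1).symm, mul_assoc]
        simp only [mul_add, add_mul, t2, t3, t4, t5, zero_add, add_zero]
        rw [← mul_assoc e, hee, ← mul_assoc, ← hec _ (hE₁ k).1, mul_assoc, t1, mul_zero]
      · obtain ⟨m, hmS, hm⟩ := hm₂ k
        obtain ⟨hma, hmS⟩ := Finset.mem_erase.1 hmS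
        refine ⟨m, hmS, fun i hi j hj hij => ?_⟩
        have hbm := hb m hmS
        have ham' := lt_of_le_of_ne (ha m hmS) hma.symm
        have t1 : E₂ k * (g i * w₂ * g j) = 0 := by
          rcases eq_or_ne i a with rfl | hia
          · rw [haw₂, zero_mul, mul_zero]
          rcases eq_or_ne j a with rfl | hja
          · rw [mul_assoc (g i), hw₂a, mul_zero, mul_zero]
          rw [hc₂]
          exact hm i (Finset.mem_erase.2 ⟨hia, hi⟩) j (Finset.mem_erase.2 ⟨hja, hj⟩) hij
        have t2 : g i * v * g j = 0 := hgv i hi j hj <| by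
          rintro ⟨rfl, rfl⟩
          rcases hij with ⟨_, _⟩ | ⟨_, _⟩ <;> linarith
        have t3 : g i * star v * g j = 0 := hgsv i hi j hj <| by
          rintro ⟨rfl, rfl⟩
          rcases hij with ⟨_, _⟩ | ⟨_, _⟩ <;> linarith
        have t4 : (1 - e) * (g i * (e * w₁) * g j) = 0 := by
          rw [← mul_assoc (g i), ← hec _ (hg.mem i hi), mul_assoc, mul_assoc, ← mul_assoc (1 - e),
            he.one_sub_mul_self, zero_mul]
        have t5 : g i * ((1 - e) * w₂) * g j = (1 - e) * (g i * w₂ * g j) := by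
          rw [← mul_assoc (g i), ← hec' _ (hg.mem i hi)]
          simp only [mul_assoc]
        rw [Sum.elim_inr, ← (hec' (E₂ k) (hE₂ k).1).symm, mul_assoc]
        simp only [mul_add (g i), add_mul _ _ (g j), mul_add (1 - e),
          t2, t3, t4, t5, zero_add, add_zero]
        rw [← mul_assoc (1 - e), he'.isIdempotentElem.eq, ← mul_assoc, ← hec' _ (hE₂ k).1,
          mul_assoc, t1, mul_zero]

end IsOrthogonalFamily

/-- A projection of `W` which commutes with `W`. -/
structure IsCentralProjection (W : VonNeumannAlgebra H) (e : H →L[ℂ] H) : Prop where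
  mem : e ∈ W
  proj : IsStarProjection e
  comm : ∀ x ∈ W, e * x = x * e

theorem IsCentralProjection.mul_mul {W : VonNeumannAlgebra H} {e x y : H →L[ℂ] H}
    (he : IsCentralProjection W e) (hx : x ∈ W) : (e * x) * (e * y) = e * (x * y) := by
  rw [he.comm x hx, mul_assoc, ← mul_assoc e e, he.proj.isIdempotentElem.eq, ← mul_assoc,
    ← he.comm x hx, mul_assoc]

namespace IsOrthogonalFamily

variable {W : VonNeumannAlgebra H} {S : Finset ℝ} {g : ℝ → H →L[ℂ] H} {e w : H →L[ℂ] H}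

theorem isStarProjection_sum (hg : IsOrthogonalFamily W S g) {T : Finset ℝ} (hT : T ⊆ S) :
    IsStarProjection (∑ i ∈ T, g i) where
  isIdempotentElem := by
    rw [IsIdempotentElem, Finset.sum_mul_sum]
    refine Finset.sum_congr rfl fun i hi => ?_
    rw [Finset.sum_eq_single_of_mem i hi fun j hj hji => hg.orth i (hT hi) j (hT hj) hji.symm]
    exact (hg.proj i (hT hi)).isIdempotentElem.eq
  isSelfAdjoint := isSelfAdjoint_sum _ fun i hi => (hg.proj i (hT hi)).isSelfAdjoint

theorem isStarProjection_corner (hg : IsOrthogonalFamily W S g) (he : IsCentralProjection W e)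
    {T : Finset ℝ} (hT : T ⊆ S) : IsStarProjection (e * ∑ i ∈ T, g i) :=
  he.proj.mul (hg.isStarProjection_sum hT)
    (he.comm _ (sum_mem fun i hi => hg.mem i (hT hi)))

theorem corner_sum_le (hg : IsOrthogonalFamily W S g) (he : IsCentralProjection W e) {a b : ℝ → ℝ}
    (hab : ∀ i ∈ S, e * g i ≠ 0 → a i ≤ b i) :
    e * ∑ i ∈ S, a i • g i ≤ e * ∑ i ∈ S, b i • g i := by
  rw [Finset.mul_sum, Finset.mul_sum]
  refine Finset.sum_le_sum fun i hi => ?_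
  rw [mul_smul_comm, mul_smul_comm]
  by_cases h : e * g i = 0
  · simp [h]
  have hp : 0 ≤ e * g i := (he.proj.mul (hg.proj i hi) (he.comm _ (hg.mem i hi))).nonneg
  rw [← sub_nonneg, ← sub_smul]
  exact smul_nonneg (sub_nonneg.2 (hab i hi h)) hp

/-- If the compression of the symmetry `w` to the part of `∑ c i • g i` above `m` vanishes in the
corner of `e`, then averaging over `w` moves that element half of the way down to `m`. -/
theorem average_le (hg : IsOrthogonalFamily W S g) (hsum : ∑ i ∈ S, g i = 1)
    (he : IsCentralProjection W e) (hwW : w ∈ W) (hw : star w = w) (hww : w * w = 1) {c : ℝ → ℝ}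
    {m r : ℝ} (hmr : m ≤ r) (hr : ∀ i ∈ S, e * g i ≠ 0 → c i ≤ r)
    (hm : ∀ i ∈ S, ∀ j ∈ S, m < c i → m < c j → e * (g i * w * g j) = 0) :
    e * ∑ i ∈ S, c i • g i + w * (e * ∑ i ∈ S, c i • g i) * w ≤ (m + r) • e := by
  classical
  set x := e * ∑ i ∈ S, c i • g i with hx
  set T := S.filter fun i => m < c i with hT
  set Q := ∑ i ∈ T, g i with hQ
  have hQW : Q ∈ W := sum_mem fun i hi => hg.mem i (Finset.filter_subset _ _ hi)
  have hP : IsStarProjection (e * Q) := hg.isStarProjection_corner he (Finset.filter_subset _ _)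
  have hle : x ≤ m • e + (r - m) • (e * Q) := by
    have h := hg.corner_sum_le he (a := c) (b := fun i => m + if m < c i then r - m else 0)
      fun i hi hne => by
        split_ifs with h
        · linarith [hr i hi hne]
        · linarith
    refine h.trans_eq ?_
    simp only [add_smul, Finset.sum_add_distrib, ← Finset.smul_sum, hsum, ite_smul, zero_smul,
      ← Finset.sum_filter, ← hT, ← hQ, mul_add, mul_smul_comm, mul_one]
  have hPwP : e * Q * (w * (e * Q) * w) = 0 := by
    have h : e * (Q * w * Q) = 0 := by
      rw [hQ, Finset.sum_mul, Finset.sum_mul_sum, Finset.mul_sum]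
      refine Finset.sum_eq_zero fun i hi => ?_
      rw [Finset.mul_sum]
      refine Finset.sum_eq_zero fun j hj => ?_
      obtain ⟨hi, hi'⟩ := Finset.mem_filter.1 hi
      obtain ⟨hj, hj'⟩ := Finset.mem_filter.1 hj
      exact hm i hi j hj hi' hj'
    have h' : w * (e * Q) = e * (w * Q) := by rw [← mul_assoc, ← he.comm w hwW, mul_assoc]
    rw [← mul_assoc, h', he.mul_mul hQW, ← mul_assoc Q, h, zero_mul]
  have hwPw : IsStarProjection (w * (e * Q) * w) := by
    refine ⟨?_, ?_⟩
    · rw [IsIdempotentElem, mul_assoc, ← mul_assoc w (w * _), ← mul_assoc w w, hww, one_mul,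
        mul_assoc w, ← mul_assoc (e * Q), hP.isIdempotentElem.eq, ← mul_assoc]
    · simpa [hw] using hP.isSelfAdjoint.conjugate w
  have hsumP : IsStarProjection (e * Q + w * (e * Q) * w) := hP.add hwPw hPwP
  have hbound : e * Q + w * (e * Q) * w ≤ e := by
    rw [← sub_nonneg]
    refine (hsumP.sub_of_mul_eq_right he.proj ?_).nonneg
    rw [mul_add, ← mul_assoc e (w * _), ← mul_assoc e w, he.comm w hwW,
      mul_assoc w e, ← mul_assoc e e, he.proj.isIdempotentElem.eq]
  have hconj : w * x * w ≤ m • e + (r - m) • (w * (e * Q) * w) := by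
    have h := star_left_conjugate_le_conjugate hle w
    rw [hw] at h
    refine h.trans_eq ?_
    simp only [mul_add, add_mul, mul_smul_comm, smul_mul_assoc]
    rw [← he.comm w hwW, mul_assoc e, hww, mul_one]
  have h3 : (r - m) • (e * Q + w * (e * Q) * w) ≤ (r - m) • e := by
    rw [← sub_nonneg, ← smul_sub]
    exact smul_nonneg (sub_nonneg.2 hmr) (sub_nonneg.2 hbound)
  calc x + w * x * w
      ≤ (m • e + (r - m) • (e * Q)) + (m • e + (r - m) • (w * (e * Q) * w)) :=
        add_le_add hle hconj
    _ = (2 * m) • e + (r - m) • (e * Q + w * (e * Q) * w) := by module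
    _ ≤ (2 * m) • e + (r - m) • e := by gcongr
    _ = (m + r) • e := by module

/-- The corner spectrum of `∑ i • g i` consists of the `i` for which `g i` does not vanish in the
corner. -/
theorem cornerSpectrum_eq (hg : IsOrthogonalFamily W S g) (hsum : ∑ i ∈ S, g i = 1)
    (he : IsCentralProjection W e) :
    cornerSpectrum W e (e * ∑ i ∈ S, i • g i) = {i | i ∈ S ∧ e * g i ≠ 0} := by
  have hx : ∀ t : ℝ, e * ∑ i ∈ S, i • g i - t • e = e * ∑ i ∈ S, (i - t) • g i := fun t => by
    simp only [sub_smul, Finset.sum_sub_distrib, ← Finset.smul_sum, hsum, mul_sub,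
      mul_smul_comm, mul_one]
  have hW : ∀ a : ℝ → ℝ, ∑ i ∈ S, a i • g i ∈ W := fun a =>
    sum_mem fun i hi => W.smul_mem _ (hg.mem i hi)
  have hmul : ∀ a b : ℝ → ℝ, (∑ i ∈ S, a i • g i) * ∑ i ∈ S, b i • g i =
      ∑ i ∈ S, (a i * b i) • g i := fun a b => by
    rw [Finset.sum_mul_sum]
    refine Finset.sum_congr rfl fun i hi => ?_
    rw [Finset.sum_eq_single_of_mem i hi fun j hj hji => by
      rw [smul_mul_smul_comm, hg.orth i hi j hj hji.symm, smul_zero]]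
    rw [smul_mul_smul_comm, (hg.proj i hi).isIdempotentElem.eq]
  ext t
  rw [Set.mem_ofPred_eq, cornerSpectrum, Set.mem_ofPred_eq, not_iff_comm, hx]
  constructor
  · intro ht
    have hone : e * ∑ i ∈ S, ((i - t)⁻¹ * (i - t)) • g i = e := by
      conv_rhs => rw [← mul_one e, ← hsum]
      rw [Finset.mul_sum, Finset.mul_sum]
      refine Finset.sum_congr rfl fun i hi => ?_
      rw [mul_smul_comm]
      by_cases hit : i = t
      · have : e * g i = 0 := by
          by_contra h
          exact ht (hit ▸ ⟨hi, h⟩)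
        rw [this, smul_zero]
      · rw [inv_mul_cancel₀ (sub_ne_zero.2 hit), one_smul]
    refine ⟨e * ∑ i ∈ S, (i - t)⁻¹ • g i, mul_mem he.mem (hW _), ?_, ?_, ?_⟩
    · rw [← mul_assoc, he.proj.isIdempotentElem.eq, he.comm _ (hW _), mul_assoc,
        he.proj.isIdempotentElem.eq]
    · rw [he.mul_mul (hW _), hmul, hone]
    · rw [he.mul_mul (hW _), hmul]
      simpa only [mul_comm] using hone
  · rintro ⟨y, -, -, hy, -⟩ ⟨ht, hne⟩
    refine hne ?_
    rw [← hy, mul_assoc, mul_assoc, Finset.sum_mul, Finset.sum_eq_zero, mul_zero, mul_zero]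
    intro i hi
    by_cases hit : i = t
    · rw [hit, sub_self, zero_smul, zero_mul]
    · rw [smul_mul_assoc, hg.orth i hi t ht hit, smul_zero]

end IsOrthogonalFamily

theorem cornerSpectrum_subset_Icc {W : VonNeumannAlgebra H} {e x : H →L[ℂ] H}
    (he : IsCentralProjection W e) (hx : x ∈ W) (hex : e * x = x) {α β : ℝ} (hαβ : α ≤ β)
    (hα : α • e ≤ x) (hβ : x ≤ β • e) : cornerSpectrum W e x ⊆ Set.Icc α β := by
  intro t ht
  have hf : (0 : H →L[ℂ] H) ≤ 1 - e := he.proj.one_sub.nonneg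
  set X := x + α • (1 - e) with hX
  have hαX : algebraMap ℝ (H →L[ℂ] H) α ≤ X := by
    rw [Algebra.algebraMap_eq_smul_one]
    calc α • (1 : H →L[ℂ] H) = α • e + α • (1 - e) := by module
      _ ≤ X := add_le_add_left hα _
  have hXβ : X ≤ algebraMap ℝ (H →L[ℂ] H) β := by
    rw [Algebra.algebraMap_eq_smul_one]
    calc X ≤ β • e + β • (1 - e) := by
          refine add_le_add hβ ?_
          rw [← sub_nonneg, ← sub_smul]
          exact smul_nonneg (sub_nonneg.2 hαβ) hf
      _ = β • (1 : H →L[ℂ] H) := by module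
  have hsaX : IsSelfAdjoint X := by
    have h := (IsSelfAdjoint.of_nonneg (sub_nonneg.2 hαX)).add
      (IsSelfAdjoint.algebraMap (H →L[ℂ] H) (IsSelfAdjoint.all α))
    rwa [sub_add_cancel] at h
  have hmem : t ∈ spectrum ℝ X := by
    by_contra hts
    obtain ⟨u, hu⟩ := spectrum.notMem_iff.1 hts
    refine ht ?_
    have huW : (u : H →L[ℂ] H) ∈ W := by
      rw [hu, hX, Algebra.algebraMap_eq_smul_one]
      exact sub_mem (W.smul_mem _ (one_mem W)) (add_mem hx
        (W.smul_mem _ (sub_mem (one_mem W) he.mem)))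
    have huinv : (↑u⁻¹ : H →L[ℂ] H) ∈ W := W.mem_of_commutant fun y hy =>
      (Commute.units_inv_right (show Commute y ↑u from (commute_of_mem huW hy).symm)).eq
    have hee := he.proj.isIdempotentElem.eq
    have heu : e * (u : H →L[ℂ] H) = -(x - t • e) := by
      rw [hu, hX, Algebra.algebraMap_eq_smul_one, mul_sub, mul_add, hex, mul_smul_comm,
        mul_smul_comm, mul_sub, hee, mul_one, sub_self]
      module
    have hxt : x - t • e = -(e * (u : H →L[ℂ] H)) := by rw [heu, neg_neg]
    refine ⟨-(e * ↑u⁻¹), neg_mem (mul_mem he.mem huinv), ?_, ?_, ?_⟩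
    · rw [mul_neg, neg_mul, ← mul_assoc, hee, he.comm _ huinv, mul_assoc, hee]
    · rw [hxt, neg_mul_neg, he.mul_mul huinv, Units.inv_mul, mul_one]
    · rw [hxt, neg_mul_neg, he.mul_mul huW, Units.mul_inv, mul_one]
  exact ⟨(algebraMap_le_iff_le_spectrum hsaX).1 hαX t hmem,
    (le_algebraMap_iff_spectrum_le hsaX).1 hXβ t hmem⟩

/-- Averaging over a symmetry `w` as in `IsOrthogonalFamily.exists_matching` halves the length of
the spectrum in the corner of `e`. -/
theorem IsOrthogonalFamily.cornerOmega_average_le {W : VonNeumannAlgebra H} {S : Finset ℝ}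
    {g : ℝ → H →L[ℂ] H} {e w h : H →L[ℂ] H} (hg : IsOrthogonalFamily W S g)
    (hsum : ∑ i ∈ S, g i = 1) (hh : ∑ i ∈ S, i • g i = h) (he : IsCentralProjection W e)
    (hwW : w ∈ W) (hw : star w = w) (hww : w * w = 1) {m : ℝ}
    (hm : ∀ i ∈ S, ∀ j ∈ S, (i < m ∧ j < m ∨ m < i ∧ m < j) → e * (g i * w * g j) = 0) :
    cornerOmega W e ((2 : ℝ)⁻¹ • (h + w * h * star w)) ≤ 1 / 2 * cornerOmega W e h := by
  classical
  have hhW : h ∈ W := hh ▸ sum_mem fun i hi => W.smul_mem _ (hg.mem i hi)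
  rcases eq_or_ne e 0 with rfl | hne
  · have h0 : ∀ x : H →L[ℂ] H, cornerOmega W 0 x = 0 := fun x => by
      have : cornerSpectrum W 0 (0 * x) = ∅ := by
        ext t
        simp [cornerSpectrum, zero_mem W]
      rw [cornerOmega, this, Real.sSup_empty, Real.sInf_empty, sub_zero]
    simp [h0]
  set S' := S.filter fun i => e * g i ≠ 0 with hS'
  have hne' : S'.Nonempty := by
    by_contra hemp
    rw [Finset.not_nonempty_iff_eq_empty, hS', Finset.filter_eq_empty_iff] at hemp
    refine hne ?_
    rw [← mul_one e, ← hsum, Finset.mul_sum]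
    exact Finset.sum_eq_zero fun i hi => not_not.1 (hemp hi)
  have hspec : cornerSpectrum W e (e * h) = S' := by
    rw [← hh, hg.cornerSpectrum_eq hsum he, hS', Finset.coe_filter]
  have hcompl : ¬ ∀ i ∈ S, ∀ j ∈ S, e * g i ≠ 0 → e * g j ≠ 0 → e * (g i * w * g j) = 0 := by
    intro hall
    refine hne ?_
    have hew : e * w = 0 := by
      calc e * w = e * ((∑ i ∈ S, g i) * w * ∑ i ∈ S, g i) := by rw [hsum, one_mul, mul_one]
        _ = 0 := by
          rw [Finset.sum_mul, Finset.sum_mul_sum, Finset.mul_sum]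
          refine Finset.sum_eq_zero fun i hi => ?_
          rw [Finset.mul_sum]
          refine Finset.sum_eq_zero fun j hj => ?_
          by_cases hi' : e * g i = 0
          · rw [mul_assoc, ← mul_assoc, hi', zero_mul]
          by_cases hj' : e * g j = 0
          · rw [← mul_assoc, he.comm _ (mul_mem (hg.mem i hi) hwW), mul_assoc, hj', mul_zero]
          exact hall i hi j hj hi' hj'
    rw [← mul_one e, ← hww, ← mul_assoc, hew, zero_mul]
  set l := S'.min' hne' with hl
  set r := S'.max' hne' with hr
  have hle_r : ∀ i ∈ S, e * g i ≠ 0 → i ≤ r := fun i hi hi' =>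
    S'.le_max' i (Finset.mem_filter.2 ⟨hi, hi'⟩)
  have hl_le : ∀ i ∈ S, e * g i ≠ 0 → l ≤ i := fun i hi hi' =>
    S'.min'_le i (Finset.mem_filter.2 ⟨hi, hi'⟩)
  have hmr : m ≤ r := by
    by_contra! hlt
    exact hcompl fun i hi j hj hi' hj' => hm i hi j hj
      (.inl ⟨(hle_r i hi hi').trans_lt hlt, (hle_r j hj hj').trans_lt hlt⟩)
  have hlm : l ≤ m := by
    by_contra! hlt
    exact hcompl fun i hi j hj hi' hj' => hm i hi j hj
      (.inr ⟨hlt.trans_le (hl_le i hi hi'), hlt.trans_le (hl_le j hj hj')⟩)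
  have hewh : w * (e * h) * w = e * (w * h * w) := by
    rw [← mul_assoc w e, ← he.comm w hwW, mul_assoc e, mul_assoc e]
  have hupper : e * h + e * (w * h * w) ≤ (m + r) • e := by
    rw [← hewh, ← hh]
    exact hg.average_le hsum he hwW hw hww (c := id) hmr hle_r
      fun i hi j hj hi' hj' => hm i hi j hj (.inr ⟨hi', hj'⟩)
  have hlower : (l + m) • e ≤ e * h + e * (w * h * w) := by
    have := hg.average_le hsum he hwW hw hww (c := fun i => -i) (m := -m) (r := -l)
      (neg_le_neg hlm) (fun i hi hi' => neg_le_neg (hl_le i hi hi'))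
      fun i hi j hj hi' hj' => hm i hi j hj (.inl ⟨neg_lt_neg_iff.1 hi', neg_lt_neg_iff.1 hj'⟩)
    simp only [neg_smul, Finset.sum_neg_distrib, hh, mul_neg, neg_mul, hewh] at this
    rw [← neg_le_neg_iff]
    refine (le_of_eq ?_).trans (this.trans_eq ?_) <;> module
  have hhalf : (0 : ℝ) ≤ 2⁻¹ := by norm_num
  have hmono : ∀ {a b : H →L[ℂ] H}, a ≤ b → (2 : ℝ)⁻¹ • a ≤ (2 : ℝ)⁻¹ • b := fun {a b} hab => by
    rw [← sub_nonneg, ← smul_sub]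
    exact smul_nonneg hhalf (sub_nonneg.2 hab)
  have hsub : cornerSpectrum W e (e * ((2 : ℝ)⁻¹ • (h + w * h * star w))) ⊆
      Set.Icc (2⁻¹ * (l + m)) (2⁻¹ * (m + r)) := by
    refine cornerSpectrum_subset_Icc he (mul_mem he.mem (W.smul_mem _ (add_mem hhW ?_))) ?_ ?_ ?_ ?_
    · rw [hw]
      exact mul_mem (mul_mem hwW hhW) hwW
    · rw [← mul_assoc, he.proj.isIdempotentElem.eq]
    · linarith
    · rw [hw, mul_smul_comm, mul_add e, mul_smul]
      exact hmono hlower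
    · rw [hw, mul_smul_comm, mul_add e, mul_smul]
      exact hmono hupper
  have homega : cornerOmega W e h = r - l := by
    rw [cornerOmega, hspec, hr, hl, (S'.isGreatest_max' hne').csSup_eq,
      (S'.isLeast_min' hne').csInf_eq]
  rw [homega, cornerOmega]
  rcases (cornerSpectrum W e (e * ((2 : ℝ)⁻¹ • (h + w * h * star w)))).eq_empty_or_nonempty
    with hemp | hnon
  · rw [hemp, Real.sSup_empty, Real.sInf_empty]
    linarith
  · linarith [csSup_le hnon fun t ht => (hsub ht).2, le_csInf hnon fun t ht => (hsub ht).1]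

/-- Spectral decomposition of a self-adjoint element with finite spectrum. -/
theorem exists_isOrthogonalFamily {W : VonNeumannAlgebra H} {h : H →L[ℂ] H} (hW : h ∈ W)
    (hsa : IsSelfAdjoint h) (hfin : (spectrum ℂ h).Finite) :
    ∃ (S : Finset ℝ) (g : ℝ → H →L[ℂ] H), IsOrthogonalFamily W S g ∧ ∑ i ∈ S, g i = 1 ∧
      ∑ i ∈ S, i • g i = h := by
  classical
  have hfinR : (spectrum ℝ h).Finite := by
    rw [← spectrum.preimage_algebraMap ℂ]
    exact hfin.preimage (algebraMap ℝ ℂ).injective.injOn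
  have hc : ∀ f : ℝ → ℝ, ContinuousOn f (spectrum ℝ h) := fun f => hfinR.continuousOn f
  set δ : ℝ → ℝ → ℝ := fun i x => if x = i then 1 else 0 with hδ
  have hdecomp : ∀ f : ℝ → ℝ, ∑ i ∈ hfinR.toFinset, f i • cfc (δ i) h = cfc f h := fun f => by
    calc ∑ i ∈ hfinR.toFinset, f i • cfc (δ i) h
        = ∑ i ∈ hfinR.toFinset, cfc (fun x => f i • δ i x) h :=
          Finset.sum_congr rfl fun i _ => (cfc_smul (f i) (δ i) h (hc _)).symm
      _ = cfc (∑ i ∈ hfinR.toFinset, fun x => f i • δ i x) h :=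
          (cfc_sum _ h _ fun i _ => hc _).symm
      _ = cfc f h := cfc_congr fun x hx => by
          simp [hδ, hx]
  refine ⟨hfinR.toFinset, fun i => cfc (δ i) h, ⟨fun i _ => ?_, fun i _ => ⟨?_, ?_⟩,
    fun i _ j _ hij => ?_⟩, ?_, ?_⟩
  · exact W.mem_of_commutant fun y hy =>
      (hsa.commute_cfc (commute_of_mem hW hy) (δ i)).eq.symm
  · rw [IsIdempotentElem, ← cfc_mul _ _ h (hc _) (hc _)]
    exact cfc_congr fun x _ => by simp [hδ]
  · exact cfc_predicate _ h
  · rw [← cfc_mul _ _ h (hc _) (hc _), ← cfc_zero ℝ h]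
    refine cfc_congr fun x _ => ?_
    by_cases hx : x = i <;> simp [hδ, hx, hij]
  · simpa [cfc_const_one ℝ h] using hdecomp fun _ => 1
  · simpa [cfc_id ℝ h] using hdecomp id

end VonNeumannAlgebra

/-- **Lemma 4.1.**  Let `h` be a self-adjoint element of a von Neumann algebra `W` with finite
spectrum.  Then there are central projections `e₁, …, eₙ` of `W` summing to `1` and a unitary
`u ∈ W` such that `ω_{e_k}((h + u h u*)/2) ≤ (1/2) ω_{e_k}(h)` for each `k`. -/
theorem vonNeumann_spectrum_halving (W : VonNeumannAlgebra H)
    (h : H →L[ℂ] H) (hW : h ∈ W) (hsa : IsSelfAdjoint h)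
    (hfin : (spectrum ℂ h).Finite) :
    ∃ (n : ℕ) (e : Fin n → (H →L[ℂ] H)) (u : H →L[ℂ] H),
      (∀ k, e k ∈ W ∧ IsSelfAdjoint (e k) ∧ e k * e k = e k ∧ ∀ x ∈ W, e k * x = x * e k) ∧
      (∑ k, e k) = 1 ∧
      u ∈ W ∧ u * star u = 1 ∧ star u * u = 1 ∧
      ∀ k, cornerOmega W (e k) ((2 : ℝ)⁻¹ • (h + u * h * star u)) ≤
        (1 / 2) * cornerOmega W (e k) h := by
  obtain ⟨S, g, hg, hsum, hh⟩ := VonNeumannAlgebra.exists_isOrthogonalFamily hW hsa hfin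
  rcases S.eq_empty_or_nonempty with rfl | hne
  · exact ⟨0, Fin.elim0, 1, fun k => k.elim0, by simpa using hsum, one_mem W, by simp, by simp,
      fun k => k.elim0⟩
  obtain ⟨n, hn⟩ := Nat.exists_eq_succ_of_ne_zero hne.card_pos.ne'
  obtain ⟨w, hwW, hw, hww, ι, _, E, hE, hE1, hm⟩ := hg.exists_matching hn
  rw [hsum] at hww
  let φ := (Fintype.equivFin ι).symm
  refine ⟨Fintype.card ι, E ∘ φ, w, fun k => ?_, ?_, hwW, by rw [hw, hww], by rw [hw, hww],
    fun k => ?_⟩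
  · obtain ⟨hEW, hEp, hEc⟩ := hE (φ k)
    exact ⟨hEW, hEp.isSelfAdjoint, hEp.isIdempotentElem.eq, hEc⟩
  · rw [← hE1]
    exact φ.sum_comp E
  · obtain ⟨hEW, hEp, hEc⟩ := hE (φ k)
    obtain ⟨m, -, hm⟩ := hm (φ k)
    exact hg.cornerOmega_average_le hsum hh ⟨hEW, hEp, hEc⟩ hwW hw hww hm

end
end
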